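/- The proportion of matrices γ in Γ_T which are hyperbolic with u_γ = 1 (equivalently, for which the quadratic form sgn(Tr γ)·(cX² + (d−a)XY − bY²) is primitive, i.e. the discriminant Δ_γ equals Tr(γ)² − 4) converges as T → ∞ to (5/6)·∏_{p odd prime} (1 − 2/(p(p²−1))) ≈ 0.7439. -/

import Mathlib

noncomputable section

open Matrix Filter Topology

/-- `Γ = SL(2,ℤ)`. -/
abbrev SL2Z := Matrix.SpecialLinearGroup (Fin 2) ℤ

/-- Frobenius norm of a matrix in `SL(2,ℤ)`. -/
noncomputable def frobNorm (γ : SL2Z) : ℝ :=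
  Real.sqrt ((γ 0 0 ^ 2 + γ 0 1 ^ 2 + γ 1 0 ^ 2 + γ 1 1 ^ 2 : ℤ) : ℝ)

/-- Trace of a matrix in `SL(2,ℤ)`. -/
def trZ (γ : SL2Z) : ℤ := γ 0 0 + γ 1 1

/-- `u_γ = gcd(c, d-a, b)` for `γ = (a b; c d)`. -/
def uGamma (γ : SL2Z) : ℕ :=
  Int.gcd (γ 1 0) (Int.gcd (γ 1 1 - γ 0 0) (γ 0 1))

open ZMod in
lemma sum_stdAddChar_mul {C : ℕ} [NeZero C] (b : ZMod C) :
    ∑ h : ZMod C, stdAddChar (h * b) = if b = 0 then (C : ℂ) else 0 := by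
  rw [AddChar.sum_mulShift b (isPrimitive_stdAddChar C)]
  simp [ZMod.card]

open ZMod in
lemma sum_normSq_expSum_le {C : ℕ} [NeZero C] {ι : Type*} (s : Finset ι) (w : ι → ℂ)
    (hw : ∀ i ∈ s, ‖w i‖ ≤ 1) (x y : ι → ZMod C) :
    ∑ h : ZMod C, ∑ k : ZMod C, ‖∑ i ∈ s, w i * stdAddChar (h * x i + k * y i)‖ ^ 2 ≤
      (C : ℝ) ^ 2 *
        (((s ×ˢ s).filter fun p => x p.1 = x p.2 ∧ y p.1 = y p.2).card : ℝ) := by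
  classical
  have key : ((∑ h : ZMod C, ∑ k : ZMod C,
      ‖∑ i ∈ s, w i * stdAddChar (h * x i + k * y i)‖ ^ 2 : ℝ) : ℂ) =
      ∑ p ∈ (s ×ˢ s).filter (fun p => x p.1 = x p.2 ∧ y p.1 = y p.2),
        w p.1 * (starRingEnd ℂ) (w p.2) * (C : ℂ) ^ 2 := by
    have h1 : ∀ h k : ZMod C,
        ((‖∑ i ∈ s, w i * stdAddChar (h * x i + k * y i)‖ ^ 2 : ℝ) : ℂ) =
        ∑ p ∈ s ×ˢ s, w p.1 * (starRingEnd ℂ) (w p.2) *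
          (stdAddChar (h * (x p.1 - x p.2)) * stdAddChar (k * (y p.1 - y p.2))) := by
      intro h k
      rw [← Complex.normSq_eq_norm_sq, ← Complex.mul_conj, map_sum, Finset.sum_mul_sum,
        Finset.sum_product]
      refine Finset.sum_congr rfl fun i _ => Finset.sum_congr rfl fun j _ => ?_
      rw [map_mul, ← AddChar.map_neg_eq_conj]
      have : h * (x i - x j) + k * (y i - y j) =
        (h * x i + k * y i) + -(h * x j + k * y j) := by ring
      have e : (stdAddChar (h * (x i - x j)) * stdAddChar (k * (y i - y j)) : ℂ) =
          stdAddChar (h * x i + k * y i) * stdAddChar (-(h * x j + k * y j)) := by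
        rw [← AddChar.map_add_eq_mul, ← AddChar.map_add_eq_mul, this]
      rw [e]
      ring
    push_cast
    push_cast at h1
    simp_rw [h1]
    rw [Finset.sum_congr rfl fun h _ => Finset.sum_comm, Finset.sum_comm, Finset.sum_filter]
    refine Finset.sum_congr rfl fun p _ => ?_
    simp_rw [← Finset.mul_sum, ← Finset.sum_mul, sum_stdAddChar_mul, sub_eq_zero]
    by_cases h1 : x p.1 = x p.2 <;> by_cases h2 : y p.1 = y p.2 <;> simp [h1, h2, sq]
  have h2 := congrArg (fun z : ℂ => ‖z‖) key
  simp only [Complex.norm_real] at h2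
  rw [Real.norm_of_nonneg (by positivity)] at h2
  rw [h2]
  refine (norm_sum_le _ _).trans ?_
  rw [mul_comm, ← nsmul_eq_mul]
  refine Finset.sum_le_card_nsmul _ _ _ fun p hp => ?_
  have hp' := Finset.mem_product.1 (Finset.mem_filter.1 hp).1
  rw [norm_mul, norm_mul, RCLike.norm_conj, norm_pow, Complex.norm_natCast]
  have := mul_le_mul (hw _ hp'.1) (hw _ hp'.2) (norm_nonneg _) zero_le_one
  nlinarith [sq_nonneg (C : ℝ)]

/-- The exponential sum attached to a weight `X` on a set `S` of pairs modulo `C`. -/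
def pairExpSum {C : ℕ} [NeZero C] (S : Finset (ZMod C × ZMod C)) (X : ZMod C × ZMod C → ℂ)
    (h k : ZMod C) : ℂ :=
  ∑ p ∈ S, X p * ZMod.stdAddChar (h * p.1 + k * p.2)

/-- Quadruples of pairs with matching sums, the additive energy of `S`. -/
def pairEnergy {C : ℕ} (S : Finset (ZMod C × ZMod C)) :
    Finset (((ZMod C × ZMod C) × (ZMod C × ZMod C)) × ((ZMod C × ZMod C) × (ZMod C × ZMod C))) :=
  ((S ×ˢ S) ×ˢ (S ×ˢ S)).filter fun q =>
    q.1.1.1 + q.1.2.1 = q.2.1.1 + q.2.2.1 ∧ q.1.1.2 + q.1.2.2 = q.2.1.2 + q.2.2.2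

lemma sum_pairExpSum_pow_four_le {C : ℕ} [NeZero C] (S : Finset (ZMod C × ZMod C))
    (X : ZMod C × ZMod C → ℂ) (hX : ∀ p ∈ S, ‖X p‖ ≤ 1) :
    ∑ h : ZMod C, ∑ k : ZMod C, ‖pairExpSum S X h k‖ ^ 4 ≤
      (C : ℝ) ^ 2 * ((pairEnergy S).card : ℝ) := by
  have := sum_normSq_expSum_le (S ×ˢ S) (fun p => X p.1 * X p.2)
    (fun p hp => by
      have hp' := Finset.mem_product.1 hp
      rw [norm_mul]
      exact mul_le_one₀ (hX _ hp'.1) (norm_nonneg _) (hX _ hp'.2))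
    (fun p => p.1.1 + p.2.1) (fun p => p.1.2 + p.2.2)
  refine le_trans (le_of_eq ?_) this
  refine Finset.sum_congr rfl fun h _ => Finset.sum_congr rfl fun k _ => ?_
  rw [show (4 : ℕ) = 2 * 2 from rfl, pow_mul, ← norm_pow, sq (pairExpSum S X h k), pairExpSum,
    Finset.sum_mul_sum, Finset.sum_product]
  congr 2
  refine Finset.sum_congr rfl fun i _ => Finset.sum_congr rfl fun j _ => ?_
  have e : (ZMod.stdAddChar (h * (i.1 + j.1) + k * (i.2 + j.2)) : ℂ) =
      ZMod.stdAddChar (h * i.1 + k * i.2) * ZMod.stdAddChar (h * j.1 + k * j.2) := by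
    rw [← AddChar.map_add_eq_mul]
    congr 1
    ring
  rw [e]
  ring

/-- Reduction `ZMod (c * N) → ZMod c`. -/
abbrev redMod (c N : ℕ) : ZMod (c * N) →+* ZMod c := ZMod.castHom (Dvd.intro N rfl) (ZMod c)

lemma redMod_eq_natCast (c N : ℕ) [NeZero (c * N)] (x : ZMod (c * N)) :
    redMod c N x = (x.val : ZMod c) := by
  rw [ZMod.castHom_apply, ZMod.natCast_val]

lemma card_filter_dvd_val_le {C d : ℕ} [NeZero C] (hd : d ∣ C) :
    (Finset.univ.filter fun x : ZMod C => d ∣ x.val).card ≤ C / d := by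
  have hd0 : 0 < d := Nat.pos_of_dvd_of_pos hd (NeZero.pos C)
  rw [← Finset.card_range (C / d)]
  refine Finset.card_le_card_of_injOn (fun x => x.val / d) (fun x hx => ?_) ?_
  · rw [Finset.coe_range, Set.mem_Iio]
    exact Nat.div_lt_div_of_lt_of_dvd hd (ZMod.val_lt x)
  · intro x hx y hy h
    simp only [Finset.coe_filter, Finset.mem_univ, true_and, Set.mem_ofPred_eq] at hx hy
    apply ZMod.val_injective
    rw [← Nat.div_mul_cancel hx, ← Nat.div_mul_cancel hy]
    exact congrArg (· * d) h

lemma card_filter_prod_eq_zero_le (c N : ℕ) [NeZero (c * N)] :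
    (Finset.univ.filter fun t : ZMod (c * N) × ZMod (c * N) × ZMod (c * N) =>
      redMod c N (t.1 * t.2.1 * t.2.2) = 0).card ≤ c.divisors.card ^ 2 * (N * (c * N) ^ 2) := by
  classical
  have hC : 0 < c * N := NeZero.pos _
  have hc : 0 < c := Nat.pos_of_mul_pos_right hC
  let D := (c.divisors ×ˢ c.divisors).filter fun e => e.1 * e.2 ∣ c
  let F : ℕ → Finset (ZMod (c * N)) := fun d => Finset.univ.filter fun x => d ∣ x.val
  have hsub : (Finset.univ.filter fun t : ZMod (c * N) × ZMod (c * N) × ZMod (c * N) =>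
      redMod c N (t.1 * t.2.1 * t.2.2) = 0) ⊆
      D.biUnion fun e => F e.1 ×ˢ F e.2 ×ˢ F (c / (e.1 * e.2)) := by
    rintro ⟨x, y, z⟩ h
    simp only [Finset.mem_filter, Finset.mem_univ, true_and, map_mul, redMod_eq_natCast] at h
    rw [← Nat.cast_mul, ← Nat.cast_mul, ZMod.natCast_eq_zero_iff] at h
    set a := x.val
    set b := y.val
    have hd1 : Nat.gcd a c ∣ c := Nat.gcd_dvd_right _ _
    have hd2 : Nat.gcd b (c / Nat.gcd a c) ∣ c / Nat.gcd a c := Nat.gcd_dvd_right _ _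
    have hg1 : 0 < Nat.gcd a c := Nat.gcd_pos_of_pos_right _ hc
    have hq : 0 < c / Nat.gcd a c := Nat.div_pos (Nat.le_of_dvd hc hd1) hg1
    have hg2 : 0 < Nat.gcd b (c / Nat.gcd a c) := Nat.gcd_pos_of_pos_right _ hq
    have hstep : ∀ {m k l : ℕ}, 0 < m → m ∣ k * l → m / Nat.gcd k m ∣ l := by
      intro m k l hm h
      rw [Nat.gcd_comm]
      exact Nat.Coprime.dvd_of_dvd_mul_left
        (Nat.coprime_div_gcd_div_gcd (Nat.gcd_pos_of_pos_left _ hm))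
        (by
          have h2 : m / Nat.gcd m k ∣ (k * l) / Nat.gcd m k :=
            Nat.div_dvd_div (Nat.gcd_dvd_left _ _) h
          rwa [Nat.mul_comm, Nat.mul_div_assoc _ (Nat.gcd_dvd_right _ _), Nat.mul_comm] at h2)
    refine Finset.mem_biUnion.2 ⟨(Nat.gcd a c, Nat.gcd b (c / Nat.gcd a c)), ?_, ?_⟩
    · simp only [D, Finset.mem_filter, Finset.mem_product, Nat.mem_divisors]
      exact ⟨⟨⟨hd1, hc.ne'⟩, hd2.trans (Nat.div_dvd_of_dvd hd1), hc.ne'⟩,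
        (Nat.dvd_div_iff_mul_dvd hd1).1 hd2⟩
    · simp only [F, Finset.mem_product, Finset.mem_filter, Finset.mem_univ, true_and]
      refine ⟨Nat.gcd_dvd_left _ _, Nat.gcd_dvd_left _ _, ?_⟩
      rw [← Nat.div_div_eq_div_mul]
      exact hstep hq (hstep hc (by rwa [mul_assoc] at h))
  refine (Finset.card_le_card hsub).trans (Finset.card_biUnion_le.trans ?_)
  have hterm : ∀ e ∈ D, (F e.1 ×ˢ F e.2 ×ˢ F (c / (e.1 * e.2))).card ≤ N * (c * N) ^ 2 := by
    intro e he
    simp only [D, Finset.mem_filter, Finset.mem_product, Nat.mem_divisors] at he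
    obtain ⟨⟨⟨h1, -⟩, h2, -⟩, h12⟩ := he
    have p12 : 0 < e.1 * e.2 := Nat.pos_of_dvd_of_pos h12 hc
    have p1 := Nat.pos_of_dvd_of_pos h1 hc
    have p2 := Nat.pos_of_dvd_of_pos h2 hc
    obtain ⟨f, hf⟩ := h12
    have pf : 0 < f := by
      rcases Nat.eq_zero_or_pos f with rfl | h
      · simp at hf; omega
      · exact h
    have b1 : (F e.1).card ≤ c * N / e.1 := card_filter_dvd_val_le (h1.mul_right N)
    have b2 : (F e.2).card ≤ c * N / e.2 := card_filter_dvd_val_le (h2.mul_right N)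
    have hfe : c / (e.1 * e.2) = f := by rw [hf, Nat.mul_div_cancel_left _ p12]
    have b3 : (F (c / (e.1 * e.2))).card ≤ c * N / f := by
      rw [hfe]
      exact card_filter_dvd_val_le (Dvd.intro_left (e.1 * e.2 * N) (by rw [hf]; ring))
    rw [Finset.card_product, Finset.card_product]
    refine (Nat.mul_le_mul b1 (Nat.mul_le_mul b2 b3)).trans (le_of_eq ?_)
    have e1 : c * N / e.1 = e.2 * f * N :=
      Nat.div_eq_of_eq_mul_right p1 (by rw [hf]; ring)
    have e2 : c * N / e.2 = e.1 * f * N :=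
      Nat.div_eq_of_eq_mul_right p2 (by rw [hf]; ring)
    have e3 : c * N / f = e.1 * e.2 * N :=
      Nat.div_eq_of_eq_mul_right pf (by rw [hf]; ring)
    rw [e1, e2, e3, hf]
    ring
  refine (Finset.sum_le_card_nsmul _ _ _ hterm).trans ?_
  rw [smul_eq_mul]
  refine Nat.mul_le_mul_right _ ?_
  refine (Finset.card_filter_le _ _).trans ?_
  rw [Finset.card_product, sq]

lemma card_pairEnergy_le (c N : ℕ) [NeZero (c * N)] (S : Finset (ZMod (c * N) × ZMod (c * N)))
    (hS : ∀ p ∈ S, redMod c N p.1 * redMod c N p.2 = 1) :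
    (pairEnergy S).card ≤ 2 * N ^ 4 * c.divisors.card ^ 2 * (c * N) ^ 2 := by
  classical
  have hC : 0 < c * N := NeZero.pos _
  have hc : 0 < c := Nat.pos_of_mul_pos_right hC
  let Z := Finset.univ.filter fun t : ZMod (c * N) × ZMod (c * N) × ZMod (c * N) =>
      redMod c N (t.1 * t.2.1 * t.2.2) = 0
  have hcard : (pairEnergy S).card ≤
      (Z ×ˢ Finset.range 2 ×ˢ Finset.range N ×ˢ Finset.range N ×ˢ Finset.range N).card := by
    refine Finset.card_le_card_of_injOn (fun q =>
      ((q.1.1.1 - q.2.1.1, q.1.2.1 - q.2.1.1, q.1.1.1 + q.1.2.1), 2 * q.2.1.1.val / (c * N),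
        q.1.1.2.val / c, q.1.2.2.val / c, q.2.1.2.val / c)) ?_ ?_
    · rintro ⟨⟨⟨a1, d1⟩, ⟨a2, d2⟩⟩, ⟨⟨a3, d3⟩, ⟨a4, d4⟩⟩⟩ hq
      simp only [pairEnergy, Finset.coe_filter, Finset.mem_product, Set.mem_ofPred_eq] at hq
      obtain ⟨⟨⟨h1, h2⟩, h3, h4⟩, ha, hd⟩ := hq
      have hlt : ∀ x : ZMod (c * N), x.val / c < N := fun x =>
        Nat.div_lt_of_lt_mul (ZMod.val_lt x)
      simp only [Finset.coe_product, Set.mem_prod, Finset.mem_coe, Finset.mem_range, Z,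
        Finset.mem_filter, Finset.mem_univ, true_and]
      refine ⟨?_, ?_, hlt _, hlt _, hlt _⟩
      · have e1 := hS _ h1
        have e2 := hS _ h2
        have e3 := hS _ h3
        have e4 := hS _ h4
        have ea := congrArg (redMod c N) ha
        have ed := congrArg (redMod c N) hd
        simp only [map_add, map_sub, map_mul] at *
        generalize redMod c N a1 = α1 at *
        generalize redMod c N a2 = α2 at *
        generalize redMod c N a3 = α3 at *
        generalize redMod c N a4 = α4 at *
        generalize redMod c N d1 = δ1 at *
        generalize redMod c N d2 = δ2 at *
        generalize redMod c N d3 = δ3 at *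
        generalize redMod c N d4 = δ4 at *
        obtain rfl : α4 = α1 + α2 - α3 := by rw [ea]; ring
        have hs : (α1 + α2) * (α3 * (α1 + α2 - α3) - α1 * α2) = 0 := by
          linear_combination (α1 * α2 * α3 * (α1 + α2 - α3)) * ed
            - (α2 * α3 * (α1 + α2 - α3)) * e1 - (α1 * α3 * (α1 + α2 - α3)) * e2
            + (α1 * α2 * (α1 + α2 - α3)) * e3 + (α1 * α2 * α3) * e4
        linear_combination -hs
      · exact Nat.div_lt_of_lt_mul (by have := ZMod.val_lt a3; omega)
    · rintro ⟨⟨⟨a1, d1⟩, ⟨a2, d2⟩⟩, ⟨⟨a3, d3⟩, ⟨a4, d4⟩⟩⟩ hq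
        ⟨⟨⟨a1', d1'⟩, ⟨a2', d2'⟩⟩, ⟨⟨a3', d3'⟩, ⟨a4', d4'⟩⟩⟩ hq' h
      simp only [pairEnergy, Finset.coe_filter, Finset.mem_product, Set.mem_ofPred_eq] at hq hq'
      obtain ⟨⟨⟨h1, h2⟩, h3, h4⟩, ha, hd⟩ := hq
      obtain ⟨⟨⟨h1', h2'⟩, h3', h4'⟩, ha', hd'⟩ := hq'
      simp only [Prod.mk.injEq] at h
      obtain ⟨⟨hx, hy, hz⟩, hw, hn1, hn2, hn3⟩ := h
      have h2a : (2 : ZMod (c * N)) * a3 = 2 * a3' := by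
        linear_combination hz - hx - hy
      have hmod : 2 * a3.val % (c * N) = 2 * a3'.val % (c * N) := by
        have : ((2 * a3.val : ℕ) : ZMod (c * N)) = ((2 * a3'.val : ℕ) : ZMod (c * N)) := by
          push_cast
          simpa using h2a
        exact (ZMod.natCast_eq_natCast_iff' _ _ _).1 this
      have e3 : a3 = a3' := by
        apply ZMod.val_injective
        have t1 := Nat.div_add_mod (2 * a3.val) (c * N)
        have t2 := Nat.div_add_mod (2 * a3'.val) (c * N)
        rw [hw, hmod] at t1
        omega
      subst e3
      have e1 : a1 = a1' := by linear_combination hx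
      have e2 : a2 = a2' := by linear_combination hy
      subst e1 e2
      have e4 : a4 = a4' := by linear_combination ha' - ha
      subst e4
      have hdd : ∀ {a d d' : ZMod (c * N)}, (a, d) ∈ S → (a, d') ∈ S → d.val / c = d'.val / c →
          d = d' := by
        intro a d d' h h' hv
        have k1 := hS _ h
        have k2 := hS _ h'
        simp only at k1 k2
        have : redMod c N d = redMod c N d' := by
          calc redMod c N d = redMod c N d * (redMod c N a * redMod c N d') := by rw [k2, mul_one]
            _ = (redMod c N a * redMod c N d) * redMod c N d' := by ring
            _ = _ := by rw [k1, one_mul]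
        rw [redMod_eq_natCast, redMod_eq_natCast, ZMod.natCast_eq_natCast_iff'] at this
        apply ZMod.val_injective
        rw [← Nat.div_add_mod d.val c, ← Nat.div_add_mod d'.val c, hv, this]
      have f1 := hdd h1 h1' hn1
      have f2 := hdd h2 h2' hn2
      have f3 := hdd h3 h3' hn3
      subst f1 f2 f3
      have f4 : d4 = d4' := by linear_combination hd' - hd
      subst f4
      rfl
  refine hcard.trans ?_
  simp only [Finset.card_product, Finset.card_range]
  have := card_filter_prod_eq_zero_le c N
  calc Z.card * (2 * (N * (N * N))) ≤
        (c.divisors.card ^ 2 * (N * (c * N) ^ 2)) * (2 * (N * (N * N))) :=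
        Nat.mul_le_mul_right _ this
    _ = _ := by ring

lemma succ_pow_four_le (k : ℕ) : (k + 1) ^ 4 ≤ 41 * 2 ^ k := by
  rcases Nat.lt_or_ge k 5 with h | h
  · interval_cases k <;> norm_num
  · induction k, h using Nat.le_induction with
    | base => norm_num
    | succ m hm ih =>
      have : (m + 1 + 1) ^ 4 ≤ 2 * (m + 1) ^ 4 := by
        obtain ⟨j, rfl⟩ := Nat.exists_eq_add_of_le hm
        ring_nf
        nlinarith [Nat.zero_le j, Nat.zero_le (j ^ 2), Nat.zero_le (j ^ 3), Nat.zero_le (j ^ 4)]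
      rw [pow_succ 2 m]
      omega

lemma card_divisors_pow_four_le {n : ℕ} (hn : n ≠ 0) : n.divisors.card ^ 4 ≤ 41 ^ 16 * n := by
  rw [Nat.card_divisors hn, ← Finset.prod_pow]
  have h1 : ∀ p ∈ n.primeFactors, (n.factorization p + 1) ^ 4 ≤
      (if p < 16 then 41 else 1) * p ^ n.factorization p := by
    intro p hp
    have hp2 := (Nat.prime_of_mem_primeFactors hp).two_le
    split_ifs with h
    · exact (succ_pow_four_le _).trans (Nat.mul_le_mul_left _ (Nat.pow_le_pow_left hp2 _))
    · calc (n.factorization p + 1) ^ 4 ≤ (2 ^ n.factorization p) ^ 4 :=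
            Nat.pow_le_pow_left (Nat.lt_two_pow_self) 4
        _ = 16 ^ n.factorization p := by rw [← pow_mul, mul_comm, pow_mul]; norm_num
        _ ≤ 1 * p ^ n.factorization p := by
            rw [one_mul]; exact Nat.pow_le_pow_left (not_lt.1 h) _
  refine (Finset.prod_le_prod' h1).trans ?_
  rw [Finset.prod_mul_distrib]
  have h2 : ∏ p ∈ n.primeFactors, p ^ n.factorization p = n :=
    Nat.prod_factorization_pow_eq_self hn
  rw [h2]
  refine Nat.mul_le_mul_right _ ?_
  rw [Finset.prod_ite, Finset.prod_const, Finset.prod_const_one, mul_one]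
  refine Nat.pow_le_pow_right (by norm_num) ?_
  calc _ ≤ (Finset.range 16).card := Finset.card_le_card fun p hp => by
        simpa using (Finset.mem_filter.1 hp).2
    _ = 16 := Finset.card_range 16

lemma le_card_divisors_mul_totient (c : ℕ) : c ≤ c.divisors.card * c.totient := by
  rcases Nat.eq_zero_or_pos c with rfl | hc
  · simp
  · conv_lhs => rw [← Nat.sum_totient c]
    rw [← smul_eq_mul]
    refine Finset.sum_le_card_nsmul _ _ _ fun d hd => ?_
    exact Nat.le_of_dvd (Nat.totient_pos.2 hc) (Nat.totient_dvd_of_dvd (Nat.dvd_of_mem_divisors hd))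

/-- Bounded weights on pairs `(a, d)` modulo `c * N` which are supported on `a * d ≡ 1` modulo
`c` and invariant under the dilations `(u * a, u⁻¹ * d)` with `u ≡ 1` modulo `N`. -/
structure IsDilationWeight (c N : ℕ) (X : ZMod (c * N) → ZMod (c * N) → ℂ) : Prop where
  norm_le : ∀ a d, ‖X a d‖ ≤ 1
  support : ∀ a d, X a d ≠ 0 → redMod c N a * redMod c N d = 1
  dilate : ∀ u : (ZMod (c * N))ˣ, ZMod.unitsMap (Dvd.intro_left c rfl : N ∣ c * N) u = 1 →
    ∀ a d, X (u * a) (↑u⁻¹ * d) = X a d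

/-- The complete exponential sum of a weight on pairs. -/
def weightSum {C : ℕ} [NeZero C] (X : ZMod C → ZMod C → ℂ) (h k : ZMod C) : ℂ :=
  ∑ a, ∑ d, X a d * ZMod.stdAddChar (h * a + k * d)

section DilationWeight

variable {c N : ℕ} [NeZero (c * N)] {X : ZMod (c * N) → ZMod (c * N) → ℂ}

lemma IsDilationWeight.sum_weightSum_pow_four_le (hX : IsDilationWeight c N X) :
    ∑ h, ∑ k, ‖weightSum X h k‖ ^ 4 ≤
      ((c * N : ℕ) : ℝ) ^ 4 * (2 * N ^ 4 * c.divisors.card ^ 2) := by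
  classical
  let S : Finset (ZMod (c * N) × ZMod (c * N)) := Finset.univ.filter fun p => X p.1 p.2 ≠ 0
  have hS : ∀ p ∈ S, redMod c N p.1 * redMod c N p.2 = 1 := fun p hp =>
    hX.support _ _ (Finset.mem_filter.1 hp).2
  have e : ∀ h k, weightSum X h k = pairExpSum S (fun p => X p.1 p.2) h k := by
    intro h k
    rw [pairExpSum, Finset.sum_filter_of_ne, weightSum, ← Finset.univ_product_univ,
      Finset.sum_product]
    intro p _ hp h0
    exact hp (by rw [h0, zero_mul])
  simp_rw [e]
  refine (sum_pairExpSum_pow_four_le S _ fun p _ => hX.norm_le _ _).trans ?_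
  have h1 : ((pairEnergy S).card : ℝ) ≤
      ((2 * N ^ 4 * c.divisors.card ^ 2 * (c * N) ^ 2 : ℕ) : ℝ) := by
    exact_mod_cast card_pairEnergy_le c N S hS
  calc _ ≤ _ := mul_le_mul_of_nonneg_left h1 (by positivity)
    _ = _ := by push_cast; ring

lemma IsDilationWeight.weightSum_dilate (hX : IsDilationWeight c N X) {u : (ZMod (c * N))ˣ}
    (hu : ZMod.unitsMap (Dvd.intro_left c rfl : N ∣ c * N) u = 1) (h k : ZMod (c * N)) :
    weightSum X (h * u) (k * ↑u⁻¹) = weightSum X h k := by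
  rw [weightSum, weightSum]
  conv_rhs => rw [← Equiv.sum_comp (Units.mulLeft u)]
  refine Finset.sum_congr rfl fun a _ => ?_
  conv_rhs => rw [← Equiv.sum_comp (Units.mulLeft u⁻¹)]
  refine Finset.sum_congr rfl fun d _ => ?_
  rw [Units.mulLeft_apply, Units.mulLeft_apply, hX.dilate u hu, mul_assoc, mul_assoc]

lemma sum_comp_le_of_card_fiber_le {α β : Type*} [Fintype α] [Fintype β] [DecidableEq β]
    (f : α → β) (g : β → ℝ) (hg : ∀ b, 0 ≤ g b) {m : ℕ}
    (hf : ∀ b, (Finset.univ.filter fun a => f a = b).card ≤ m) :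
    ∑ a, g (f a) ≤ m * ∑ b, g b := by
  rw [← Finset.sum_fiberwise _ f, Finset.mul_sum]
  refine Finset.sum_le_sum fun b _ => ?_
  rw [Finset.sum_congr rfl fun a ha => by rw [(Finset.mem_filter.1 ha).2],
    Finset.sum_const, nsmul_eq_mul]
  exact mul_le_mul_of_nonneg_right (by exact_mod_cast hf b) (hg b)

lemma card_fiber_mul_inv_le {C : ℕ} [NeZero C] {m : ℤ} (hm : m ≠ 0) (k : ZMod C) :
    (Finset.univ.filter fun u : (ZMod C)ˣ => (m : ZMod C) * ↑u⁻¹ = k).card ≤ m.natAbs := by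
  have hC : 0 < C := NeZero.pos C
  rw [← Finset.card_range m.natAbs]
  refine Finset.card_le_card_of_injOn
    (fun u => m.natAbs * (((u⁻¹ : (ZMod C)ˣ) : ZMod C)).val / C) (fun u _ => ?_) ?_
  · rw [Finset.coe_range, Set.mem_Iio]
    refine Nat.div_lt_of_lt_mul ?_
    rw [mul_comm C]
    exact Nat.mul_lt_mul_of_pos_left (ZMod.val_lt _) (Int.natAbs_pos.2 hm)
  · intro u hu v hv h
    simp only [Finset.coe_filter, Finset.mem_univ, true_and, Set.mem_ofPred_eq] at hu hv h
    have e : ((m.natAbs : ℕ) : ZMod C) * ↑u⁻¹ = (m.natAbs : ℕ) * ↑v⁻¹ := by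
      rcases Int.natAbs_eq m with h1 | h1
      · have h2 : ((m.natAbs : ℕ) : ZMod C) = (m : ZMod C) := by
          conv_rhs => rw [h1]
          simp
        rw [h2, hu, hv]
      · have h2 : ((m.natAbs : ℕ) : ZMod C) = -(m : ZMod C) := by
          conv_rhs => rw [h1]
          simp
        rw [h2, neg_mul, neg_mul, hu, hv]
    have hmod : m.natAbs * (((u⁻¹ : (ZMod C)ˣ) : ZMod C)).val % C =
        m.natAbs * (((v⁻¹ : (ZMod C)ˣ) : ZMod C)).val % C := by
      apply (ZMod.natCast_eq_natCast_iff' _ _ _).1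
      push_cast
      simpa using e
    have hval : m.natAbs * (((u⁻¹ : (ZMod C)ˣ) : ZMod C)).val =
        m.natAbs * (((v⁻¹ : (ZMod C)ˣ) : ZMod C)).val := by
      rw [← Nat.div_add_mod (m.natAbs * _) C, h, hmod, Nat.div_add_mod]
    have := ZMod.val_injective _ (Nat.eq_of_mul_eq_mul_left (Int.natAbs_pos.2 hm) hval)
    exact inv_injective (Units.ext this)

lemma totient_le_card_ker_unitsMap (c N : ℕ) [NeZero (c * N)] :
    c.totient ≤ N * (Finset.univ.filter fun u : (ZMod (c * N))ˣ =>
      ZMod.unitsMap (Dvd.intro_left c rfl : N ∣ c * N) u = 1).card := by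
  classical
  have hC : 0 < c * N := NeZero.pos _
  have hN : 0 < N := Nat.pos_of_mul_pos_left hC
  have : NeZero N := ⟨hN.ne'⟩
  set f := ZMod.unitsMap (Dvd.intro_left c rfl : N ∣ c * N)
  have h1 : c.totient ≤ (c * N).totient :=
    Nat.le_of_dvd (Nat.totient_pos.2 hC) (Nat.totient_dvd_of_dvd (Dvd.intro N rfl))
  refine h1.trans ?_
  rw [← ZMod.card_units_eq_totient, ← Finset.card_univ, mul_comm N]
  have hmaps : ∀ u ∈ (Finset.univ : Finset (ZMod (c * N))ˣ),
      f u ∈ (Finset.univ : Finset (ZMod N)ˣ) := fun _ _ => Finset.mem_univ _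
  refine (Finset.card_le_mul_card_image_of_maps_to hmaps
    (Finset.univ.filter fun u : (ZMod (c * N))ˣ => f u = 1).card ?_).trans ?_
  · intro b _
    by_cases hb : ∃ v, f v = b
    · obtain ⟨v, rfl⟩ := hb
      refine Finset.card_le_card_of_injOn (fun u => v⁻¹ * u) (fun u hu => ?_)
        (mul_right_injective v⁻¹).injOn
      simp only [Finset.coe_filter, Finset.mem_univ, true_and, Set.mem_ofPred_eq] at hu ⊢
      rw [map_mul, map_inv, hu, inv_mul_cancel]
    · rw [Finset.filter_false_of_mem fun u _ hu => hb ⟨u, hu⟩]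
      simp
  · refine Nat.mul_le_mul_left _ ?_
    rw [Finset.card_univ, ZMod.card_units_eq_totient]
    exact Nat.totient_le N

lemma IsDilationWeight.weightSum_pow_four_le (hX : IsDilationWeight c N X) {m : ℤ} (hm : m ≠ 0)
    (h : ZMod (c * N)) :
    ‖weightSum X h m‖ ^ 4 * c ≤
      2 * m.natAbs * N ^ 5 * (c.divisors.card : ℝ) ^ 3 * ((c * N : ℕ) : ℝ) ^ 4 := by
  classical
  set U := Finset.univ.filter fun u : (ZMod (c * N))ˣ =>
      ZMod.unitsMap (Dvd.intro_left c rfl : N ∣ c * N) u = 1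
  have h1 : ‖weightSum X h m‖ ^ 4 * (U.card : ℝ) ≤
      m.natAbs * ∑ h, ∑ k, ‖weightSum X h k‖ ^ 4 := by
    calc ‖weightSum X h m‖ ^ 4 * (U.card : ℝ)
        = ∑ u ∈ U, ‖weightSum X (h * u) (m * ↑u⁻¹)‖ ^ 4 := by
          rw [Finset.sum_congr rfl fun u hu => by
            rw [hX.weightSum_dilate (Finset.mem_filter.1 hu).2], Finset.sum_const, nsmul_eq_mul,
            mul_comm]
      _ ≤ ∑ u : (ZMod (c * N))ˣ, ‖weightSum X (h * u) (m * ↑u⁻¹)‖ ^ 4 :=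
          Finset.sum_le_sum_of_subset_of_nonneg (Finset.subset_univ _) fun _ _ _ => by positivity
      _ ≤ ∑ u : (ZMod (c * N))ˣ, ∑ h', ‖weightSum X h' (m * ↑u⁻¹)‖ ^ 4 :=
          Finset.sum_le_sum fun u _ => Finset.single_le_sum
            (f := fun h' => ‖weightSum X h' (m * ↑u⁻¹)‖ ^ 4)
            (fun _ _ => by positivity) (Finset.mem_univ _)
      _ ≤ m.natAbs * ∑ k, ∑ h', ‖weightSum X h' k‖ ^ 4 :=
          sum_comp_le_of_card_fiber_le (fun u : (ZMod (c * N))ˣ => (m : ZMod (c * N)) * ↑u⁻¹)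
            (fun k => ∑ h', ‖weightSum X h' k‖ ^ 4) (fun k => by positivity)
            (fun k => card_fiber_mul_inv_le hm k)
      _ = _ := by rw [Finset.sum_comm]
  have h2 := hX.sum_weightSum_pow_four_le
  have h3 : (c : ℝ) ≤ c.divisors.card * (N * U.card) := by
    have := (le_card_divisors_mul_totient c).trans
      (Nat.mul_le_mul_left _ (totient_le_card_ker_unitsMap c N))
    exact_mod_cast this
  calc ‖weightSum X h m‖ ^ 4 * c ≤ ‖weightSum X h m‖ ^ 4 * (c.divisors.card * (N * U.card)) :=
        mul_le_mul_of_nonneg_left h3 (by positivity)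
    _ = (c.divisors.card * N) * (‖weightSum X h m‖ ^ 4 * U.card) := by ring
    _ ≤ (c.divisors.card * N) * (m.natAbs *
        (((c * N : ℕ) : ℝ) ^ 4 * (2 * N ^ 4 * c.divisors.card ^ 2))) :=
        mul_le_mul_of_nonneg_left
          (h1.trans (mul_le_mul_of_nonneg_left h2 (by positivity))) (by positivity)
    _ = _ := by ring

end DilationWeight

lemma exists_weightSum_le (N : ℕ) {m : ℤ} (hm : m ≠ 0) {ε : ℝ} (hε : 0 < ε) :
    ∃ c₀ : ℕ, ∀ c : ℕ, c₀ ≤ c → ∀ [NeZero (c * N)], ∀ X, IsDilationWeight c N X →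
      ∀ h, ‖weightSum X h m‖ ≤ ε * c := by
  set A : ℝ := (2 * m.natAbs * N ^ 9) ^ 4 * (41 ^ 16) ^ 3
  obtain ⟨c₀, hc₀⟩ := exists_nat_ge (A / ε ^ 16)
  refine ⟨c₀, fun c hc _ X hX h => ?_⟩
  have hC : 0 < c * N := NeZero.pos _
  have hc0 : 0 < c := Nat.pos_of_mul_pos_right hC
  have hcr : (0 : ℝ) < c := by exact_mod_cast hc0
  have h1 := hX.weightSum_pow_four_le hm h
  have h2 : ((c.divisors.card : ℝ)) ^ 4 ≤ 41 ^ 16 * c := by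
    exact_mod_cast card_divisors_pow_four_le hc0.ne'
  set w := ‖weightSum X h m‖
  have hw : 0 ≤ w := norm_nonneg _
  have h3 : w ^ 16 * c ^ 4 ≤ A * c ^ 16 * c ^ 3 := by
    calc w ^ 16 * c ^ 4 = (w ^ 4 * c) ^ 4 := by ring
      _ ≤ (2 * m.natAbs * N ^ 5 * (c.divisors.card : ℝ) ^ 3 * ((c * N : ℕ) : ℝ) ^ 4) ^ 4 :=
        pow_le_pow_left₀ (by positivity) h1 4
      _ = (2 * m.natAbs * N ^ 9) ^ 4 * ((c.divisors.card : ℝ) ^ 4) ^ 3 * c ^ 16 := by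
        push_cast; ring
      _ ≤ (2 * m.natAbs * N ^ 9) ^ 4 * (41 ^ 16 * c) ^ 3 * c ^ 16 := by gcongr
      _ = _ := by simp only [A]; ring
  have h4 : A ≤ ε ^ 16 * c := by
    rw [div_le_iff₀ (by positivity)] at hc₀
    have : (c₀ : ℝ) ≤ c := by exact_mod_cast hc
    calc A ≤ c₀ * ε ^ 16 := hc₀
      _ ≤ c * ε ^ 16 := by gcongr
      _ = _ := mul_comm _ _
  have h5 : w ^ 16 * c ^ 4 ≤ (ε * c) ^ 16 * c ^ 4 := by
    refine h3.trans ?_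
    calc A * c ^ 16 * c ^ 3 ≤ (ε ^ 16 * c) * c ^ 16 * c ^ 3 := by gcongr
      _ = _ := by ring
  have h6 := le_of_mul_le_mul_right h5 (by positivity)
  exact le_of_pow_le_pow_left₀ (by norm_num) (by positivity) h6

open ZMod in
lemma sum_normSq_stdAddChar_le {C : ℕ} [NeZero C] {ι : Type*} (s : Finset ι) (x : ι → ZMod C)
    (hx : Set.InjOn x s) :
    ∑ h : ZMod C, ‖∑ i ∈ s, stdAddChar (h * x i)‖ ^ 2 ≤ (C : ℝ) * s.card := by
  classical
  have h1 := sum_normSq_expSum_le s (fun _ => 1) (fun _ _ => by simp) x (fun _ => 0)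
  simp only [mul_zero, add_zero, one_mul, Finset.sum_const, Finset.card_univ, ZMod.card,
    nsmul_eq_mul, and_true] at h1
  have h2 : ((s ×ˢ s).filter fun p => x p.1 = x p.2).card ≤ s.card := by
    refine Finset.card_le_card_of_injOn Prod.fst (fun p hp => ?_) fun p hp q hq h => ?_
    · exact (Finset.mem_product.1 (Finset.mem_filter.1 hp).1).1
    · have hp' := Finset.mem_filter.1 hp
      have hq' := Finset.mem_filter.1 hq
      have hp1 := Finset.mem_product.1 hp'.1
      have hq1 := Finset.mem_product.1 hq'.1
      refine Prod.ext h (hx hp1.2 hq1.2 ?_)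
      rw [← hp'.2, ← hq'.2, h]
  have h3 : (((s ×ˢ s).filter fun p => x p.1 = x p.2).card : ℝ) ≤ s.card := by exact_mod_cast h2
  have hC : (0 : ℝ) < C := by exact_mod_cast NeZero.pos C
  rw [← Finset.mul_sum] at h1
  have h4 : (C : ℝ) * ∑ h : ZMod C, ‖∑ i ∈ s, stdAddChar (h * x i)‖ ^ 2 ≤
      C * (C * s.card) := by
    refine h1.trans ?_
    rw [sq, mul_assoc]
    gcongr
  exact le_of_mul_le_mul_left h4 hC

open ZMod in
lemma norm_sum_sum_add_le {C : ℕ} [NeZero C] {ι κ : Type*} (s : Finset ι) (t : Finset κ)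
    (x : ι → ZMod C) (y : κ → ZMod C) (hx : Set.InjOn x s) (hy : Set.InjOn y t)
    (Y : ZMod C → ℂ) {M : ℝ} (hM : ∀ h, ‖∑ b, Y b * stdAddChar (h * b)‖ ≤ M) :
    ‖∑ i ∈ s, ∑ j ∈ t, Y (x i + y j)‖ ≤ M * √(s.card * t.card) := by
  classical
  have hC : (0 : ℝ) < C := by exact_mod_cast NeZero.pos C
  have hM0 : 0 ≤ M := (norm_nonneg _).trans (hM 0)
  have key : (C : ℂ) * ∑ i ∈ s, ∑ j ∈ t, Y (x i + y j) =
      ∑ h, (∑ b, Y b * stdAddChar (h * b)) *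
        ((starRingEnd ℂ) (∑ i ∈ s, stdAddChar (h * x i)) *
          (starRingEnd ℂ) (∑ j ∈ t, stdAddChar (h * y j))) := by
    have e : ∀ h, (∑ b, Y b * stdAddChar (h * b)) *
        ((starRingEnd ℂ) (∑ i ∈ s, stdAddChar (h * x i)) *
          (starRingEnd ℂ) (∑ j ∈ t, stdAddChar (h * y j))) =
        ∑ i ∈ s, ∑ j ∈ t, ∑ b, Y b * stdAddChar (h * (b - (x i + y j))) := by
      intro h
      rw [map_sum, map_sum, Finset.sum_mul_sum, Finset.mul_sum]
      refine Finset.sum_congr rfl fun i _ => ?_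
      rw [Finset.mul_sum]
      refine Finset.sum_congr rfl fun j _ => ?_
      rw [Finset.sum_mul]
      refine Finset.sum_congr rfl fun b _ => ?_
      have : (stdAddChar (h * (b - (x i + y j))) : ℂ) =
          stdAddChar (h * b) * (stdAddChar (-(h * x i)) * stdAddChar (-(h * y j))) := by
        rw [← AddChar.map_add_eq_mul, ← AddChar.map_add_eq_mul]
        congr 1
        ring
      rw [this, ← AddChar.map_neg_eq_conj, ← AddChar.map_neg_eq_conj, mul_assoc]
    simp_rw [e]
    conv_rhs => rw [Finset.sum_comm]
    rw [Finset.mul_sum]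
    refine Finset.sum_congr rfl fun i _ => ?_
    conv_rhs => rw [Finset.sum_comm]
    rw [Finset.mul_sum]
    refine Finset.sum_congr rfl fun j _ => ?_
    rw [Finset.sum_comm]
    simp_rw [← Finset.mul_sum, sum_stdAddChar_mul, sub_eq_zero]
    simp [mul_comm]
  have h1 : (C : ℝ) * ‖∑ i ∈ s, ∑ j ∈ t, Y (x i + y j)‖ ≤
      M * ∑ h : ZMod C,
        ‖∑ i ∈ s, (stdAddChar (h * x i) : ℂ)‖ * ‖∑ j ∈ t, (stdAddChar (h * y j) : ℂ)‖ := by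
    have : (C : ℝ) * ‖∑ i ∈ s, ∑ j ∈ t, Y (x i + y j)‖ =
        ‖(C : ℂ) * ∑ i ∈ s, ∑ j ∈ t, Y (x i + y j)‖ := by
      rw [norm_mul, Complex.norm_natCast]
    rw [this, key, Finset.mul_sum]
    refine (norm_sum_le _ _).trans (Finset.sum_le_sum fun h _ => ?_)
    rw [norm_mul, norm_mul, RCLike.norm_conj, RCLike.norm_conj]
    exact mul_le_mul_of_nonneg_right (hM h) (by positivity)
  have h2 : ∑ h : ZMod C, ‖∑ i ∈ s, (stdAddChar (h * x i) : ℂ)‖ *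
      ‖∑ j ∈ t, (stdAddChar (h * y j) : ℂ)‖ ≤
      C * √(s.card * t.card) := by
    refine (Real.sum_mul_le_sqrt_mul_sqrt _ _ _).trans ?_
    rw [← Real.sqrt_mul (by positivity)]
    refine Real.sqrt_le_iff.2 ⟨by positivity, ?_⟩
    rw [mul_pow, Real.sq_sqrt (by positivity)]
    calc _ ≤ ((C : ℝ) * s.card) * (C * t.card) :=
          mul_le_mul (sum_normSq_stdAddChar_le s x hx) (sum_normSq_stdAddChar_le t y hy)
            (by positivity) (by positivity)
      _ = _ := by ring
  refine le_of_mul_le_mul_left (h1.trans ((mul_le_mul_of_nonneg_left h2 hM0).trans_eq ?_)) hC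
  ring

lemma norm_sum_range_shift_sub_le (g : ℕ → ℂ) {B : ℝ} (hg : ∀ i, ‖g i‖ ≤ B) (n j : ℕ) :
    ‖∑ i ∈ Finset.range n, g (i + j) - ∑ i ∈ Finset.range n, g i‖ ≤ 2 * j * B := by
  induction j with
  | zero => simp
  | succ j ih =>
    have h1 : ∑ i ∈ Finset.range n, g (i + (j + 1)) - ∑ i ∈ Finset.range n, g (i + j) =
        g (n + j) - g (0 + j) := by
      rw [← Finset.sum_range_sub (fun i => g (i + j)), ← Finset.sum_sub_distrib]
      refine Finset.sum_congr rfl fun i _ => ?_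
      congr 2
      ring
    have h2 : ‖g (n + j) - g (0 + j)‖ ≤ B + B :=
      (norm_sub_le _ _).trans (add_le_add (hg _) (hg _))
    calc _ = ‖(∑ i ∈ Finset.range n, g (i + (j + 1)) - ∑ i ∈ Finset.range n, g (i + j)) +
          (∑ i ∈ Finset.range n, g (i + j) - ∑ i ∈ Finset.range n, g i)‖ := by
          rw [sub_add_sub_cancel]
      _ ≤ (B + B) + 2 * j * B := (norm_add_le _ _).trans (add_le_add (by rw [h1]; exact h2) ih)
      _ = _ := by push_cast; ring

open ZMod in
lemma norm_sum_range_le_of_fourier_le {C : ℕ} [NeZero C] (Y : ZMod C → ℂ) {M B : ℝ}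
    (hM : ∀ h, ‖∑ b, Y b * stdAddChar (h * b)‖ ≤ M) (hB : ∀ b, ‖Y b‖ ≤ B) (u : ZMod C)
    {n L : ℕ} (hn : n ≤ C) (hL : L ≤ C) (hL0 : 0 < L) :
    ‖∑ i ∈ Finset.range n, Y (u + i)‖ ≤ 2 * L * B + M * √(C / L) := by
  have hC : (0 : ℝ) < C := by exact_mod_cast NeZero.pos C
  have hLr : (0 : ℝ) < L := by exact_mod_cast hL0
  have hM0 : 0 ≤ M := (norm_nonneg _).trans (hM 0)
  have hB0 : 0 ≤ B := (norm_nonneg _).trans (hB 0)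
  have hinj : ∀ {m : ℕ}, m ≤ C → Set.InjOn (fun i : ℕ => (i : ZMod C)) (Finset.range m) := by
    intro m hm i hi j hj h
    rw [Finset.mem_coe, Finset.mem_range] at hi hj
    have := (ZMod.natCast_eq_natCast_iff' _ _ _).1 h
    rwa [Nat.mod_eq_of_lt (hi.trans_le hm), Nat.mod_eq_of_lt (hj.trans_le hm)] at this
  have h1 := norm_sum_sum_add_le (Finset.range L) (Finset.range n) (fun j => (j : ZMod C))
    (fun i => u + (i : ZMod C)) (hinj hL)
    (fun i hi j hj h => hinj hn hi hj (add_left_cancel h)) Y hM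
  rw [Finset.card_range, Finset.card_range] at h1
  set V := ∑ i ∈ Finset.range n, Y (u + i)
  have h2 : ‖∑ j ∈ Finset.range L, ∑ i ∈ Finset.range n, Y (j + (u + i)) - L * V‖ ≤
      L * (2 * L * B) := by
    have : (L : ℂ) * V = ∑ j ∈ Finset.range L, V := by simp
    rw [this, ← Finset.sum_sub_distrib]
    refine (norm_sum_le _ _).trans ?_
    have : ∀ j ∈ Finset.range L,
        ‖∑ i ∈ Finset.range n, Y (j + (u + i)) - V‖ ≤ 2 * L * B := by
      intro j hj
      have := norm_sum_range_shift_sub_le (fun i => Y (u + i)) (fun i => hB _) n j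
      have e : ∑ i ∈ Finset.range n, Y (j + (u + i)) =
          ∑ i ∈ Finset.range n, Y (u + ((i + j : ℕ) : ZMod C)) := by
        refine Finset.sum_congr rfl fun i _ => ?_
        congr 1
        push_cast
        ring
      rw [e]
      refine this.trans ?_
      have : (j : ℝ) ≤ L := by exact_mod_cast (Finset.mem_range.1 hj).le
      gcongr
    refine (Finset.sum_le_card_nsmul _ _ _ this).trans ?_
    rw [Finset.card_range, nsmul_eq_mul]
  have h3 : (L : ℝ) * ‖V‖ ≤ L * (2 * L * B) + M * √(L * n) := by
    calc (L : ℝ) * ‖V‖ = ‖(L : ℂ) * V‖ := by rw [norm_mul, Complex.norm_natCast]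
      _ ≤ _ := by
        rw [norm_sub_rev] at h2
        have := norm_le_norm_add_norm_sub' ((L : ℂ) * V)
          (∑ j ∈ Finset.range L, ∑ i ∈ Finset.range n, Y (j + (u + i)))
        linarith
  have h4 : √((L : ℝ) * n) ≤ L * √(C / L) := by
    refine Real.sqrt_le_iff.2 ⟨by positivity, ?_⟩
    rw [mul_pow, Real.sq_sqrt (by positivity)]
    have : (n : ℝ) ≤ C := by exact_mod_cast hn
    have e : (L : ℝ) ^ 2 * (C / L) = L * C := by field_simp
    rw [e]
    gcongr
  have h5 := mul_le_mul_of_nonneg_left h4 hM0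
  refine le_of_mul_le_mul_left (a := (L : ℝ)) ?_ hLr
  calc (L : ℝ) * ‖V‖ ≤ L * (2 * L * B) + M * (L * √(C / L)) := by linarith
    _ = _ := by ring

lemma card_filter_redMod_mul_eq_one_le (c N : ℕ) [NeZero (c * N)] (a : ZMod (c * N)) :
    (Finset.univ.filter fun d : ZMod (c * N) => redMod c N a * redMod c N d = 1).card ≤ N := by
  conv_rhs => rw [← Finset.card_range N]
  refine Finset.card_le_card_of_injOn (fun d => d.val / c) (fun d _ => ?_) ?_
  · rw [Finset.coe_range, Set.mem_Iio]
    exact Nat.div_lt_of_lt_mul (ZMod.val_lt d)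
  · intro d hd d' hd' h
    simp only [Finset.coe_filter, Finset.mem_univ, true_and, Set.mem_ofPred_eq] at hd hd' h
    have : redMod c N d = redMod c N d' := by
      calc redMod c N d = redMod c N d * (redMod c N a * redMod c N d') := by rw [hd', mul_one]
        _ = (redMod c N a * redMod c N d) * redMod c N d' := by ring
        _ = _ := by rw [hd, one_mul]
    rw [redMod_eq_natCast, redMod_eq_natCast, ZMod.natCast_eq_natCast_iff'] at this
    apply ZMod.val_injective
    rw [← Nat.div_add_mod d.val c, ← Nat.div_add_mod d'.val c, h, this]

lemma IsDilationWeight.norm_sum_mul_le {c N : ℕ} [NeZero (c * N)]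
    {X : ZMod (c * N) → ZMod (c * N) → ℂ}
    (hX : IsDilationWeight c N X) (a : ZMod (c * N)) (w : ZMod (c * N) → ℂ) {B : ℝ}
    (hw : ∀ d, ‖w d‖ ≤ B) : ‖∑ d, X a d * w d‖ ≤ N * B := by
  classical
  have hB : 0 ≤ B := (norm_nonneg _).trans (hw 0)
  have h : ∑ d, X a d * w d =
      ∑ d with redMod c N a * redMod c N d = 1, X a d * w d := by
    refine (Finset.sum_filter_of_ne fun d _ hd => hX.support a d fun h0 => hd ?_).symm
    rw [h0, zero_mul]
  rw [h]
  refine (norm_sum_le _ _).trans ((Finset.sum_le_card_nsmul _ _ B fun d _ => ?_).trans ?_)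
  · rw [norm_mul]
    exact (mul_le_mul (hX.norm_le a d) (hw d) (norm_nonneg _) zero_le_one).trans_eq (one_mul B)
  · rw [nsmul_eq_mul]
    exact mul_le_mul_of_nonneg_right
      (by exact_mod_cast card_filter_redMod_mul_eq_one_le c N a) hB

lemma exists_norm_sum_range_stdAddChar_le (N : ℕ) {m : ℤ} (hm : m ≠ 0) {ε : ℝ} (hε : 0 < ε) :
    ∃ c₀ : ℕ, ∀ c : ℕ, c₀ ≤ c → ∀ [NeZero (c * N)], ∀ X, IsDilationWeight c N X →
      ∀ (u : ZMod (c * N)) (n : ℕ), n ≤ c * N →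
      ‖∑ i ∈ Finset.range n, ∑ d, X (u + i) d * ZMod.stdAddChar ((m : ZMod (c * N)) * d)‖ ≤
        ε * c := by
  rcases Nat.eq_zero_or_pos N with rfl | hN
  · refine ⟨0, fun c _ h => ?_⟩
    exact absurd (NeZero.ne (c * 0)) (by simp)
  have hNr : (1 : ℝ) ≤ N := by exact_mod_cast hN
  set η : ℝ := min (ε / (8 * N)) (1 / 2)
  have hη : 0 < η := by positivity
  have hη1 : η ≤ ε / (8 * N) := min_le_left _ _
  have hη2 : η ≤ 1 / 2 := min_le_right _ _
  have hs : 0 < √(N / η) := Real.sqrt_pos.2 (by positivity)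
  obtain ⟨c₁, hc₁⟩ := exists_weightSum_le N hm (ε := ε / 2 / √(N / η)) (by positivity)
  obtain ⟨c₂, hc₂⟩ := exists_nat_ge (1 / η)
  refine ⟨max c₁ c₂, fun c hc _ X hX u n hn => ?_⟩
  have hcη : 1 ≤ η * c := by
    have : (c₂ : ℝ) ≤ c := by exact_mod_cast (le_max_right c₁ c₂).trans hc
    rw [div_le_iff₀ hη] at hc₂
    nlinarith
  have hcr : (0 : ℝ) < c := by
    by_contra h
    nlinarith
  set L := ⌈η * c⌉₊
  have hL1 : η * c ≤ L := Nat.le_ceil _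
  have hL2 : (L : ℝ) ≤ 2 * (η * c) := by
    have := Nat.ceil_lt_add_one (a := η * c) (by positivity)
    linarith
  have hL0 : 0 < L := by
    have : (0 : ℝ) < L := by linarith
    exact_mod_cast this
  have hLC : L ≤ c * N := by
    have : (L : ℝ) ≤ c * N := by nlinarith
    exact_mod_cast this
  have h1 := norm_sum_range_le_of_fourier_le
    (fun a => ∑ d, X a d * ZMod.stdAddChar ((m : ZMod (c * N)) * d))
    (M := ε / 2 / √(N / η) * c) (B := N) (fun h => ?_) (fun b => ?_) u hn hLC hL0
  · refine h1.trans ?_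
    have h2 : √(((c * N : ℕ) : ℝ) / L) ≤ √(N / η) := by
      refine Real.sqrt_le_sqrt ?_
      rw [div_le_div_iff₀ (by linarith) hη]
      push_cast
      nlinarith
    calc 2 * (L : ℝ) * N + ε / 2 / √(N / η) * c * √(((c * N : ℕ) : ℝ) / L) ≤
          2 * (2 * (ε / (8 * N) * c)) * N + ε / 2 / √(N / η) * c * √(N / η) := by
          gcongr
          exact hL2.trans (by gcongr)
      _ = ε * c := by field_simp; ring
  · have := hc₁ c ((le_max_left c₁ c₂).trans hc) X hX h
    refine le_trans (le_of_eq ?_) this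
    rw [weightSum]
    congr 1
    refine Finset.sum_congr rfl fun a _ => ?_
    rw [Finset.sum_mul]
    refine Finset.sum_congr rfl fun d _ => ?_
    rw [add_comm, AddChar.map_add_eq_mul, mul_assoc]
  · have := hX.norm_sum_mul_le b (fun d => ZMod.stdAddChar ((m : ZMod (c * N)) * d)) (B := 1)
      fun d => (AddChar.norm_apply _ _).le
    simpa using this

/-- The point `d / c` of the circle `ℝ / N ℤ` for `d` modulo `c * N`. -/
def circlePt (c N : ℕ) (d : ZMod (c * N)) : AddCircle (N : ℝ) :=
  ((d.val / c : ℝ) : AddCircle (N : ℝ))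

lemma circlePt_intCast {c N : ℕ} [NeZero (c * N)] (d : ℤ) :
    circlePt c N d = ((d / c : ℝ) : AddCircle (N : ℝ)) := by
  have hC : 0 < c * N := NeZero.pos _
  have hc : (c : ℝ) ≠ 0 := by exact_mod_cast (Nat.pos_of_mul_pos_right hC).ne'
  rw [circlePt]
  have h1 : (((d : ZMod (c * N)).val : ℤ) : ZMod (c * N)) = d := by simp
  obtain ⟨k, hk⟩ := (ZMod.intCast_eq_intCast_iff_dvd_sub _ _ _).1 h1
  have h2 : (d : ℝ) = ((d : ZMod (c * N)).val : ℝ) + c * N * k := by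
    have : d = ((d : ZMod (c * N)).val : ℤ) + (c * N : ℕ) * k := by omega
    exact_mod_cast this
  have h3 : (d : ℝ) / c = ((d : ZMod (c * N)).val : ℝ) / c + k • (N : ℝ) := by
    rw [zsmul_eq_mul]
    field_simp
    rw [h2]
    ring
  rw [h3, AddCircle.coe_add, AddCircle.coe_zsmul, AddCircle.coe_period, smul_zero, add_zero]

lemma fourier_circlePt {c N : ℕ} [NeZero (c * N)] (k : ℤ) (d : ZMod (c * N)) :
    fourier k (circlePt c N d) = ZMod.stdAddChar ((k : ZMod (c * N)) * d) := by
  have hC : 0 < c * N := NeZero.pos _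
  have hc : (c : ℂ) ≠ 0 := by exact_mod_cast (Nat.pos_of_mul_pos_right hC).ne'
  have hN : (N : ℂ) ≠ 0 := by exact_mod_cast (Nat.pos_of_mul_pos_left hC).ne'
  have h1 : (k : ZMod (c * N)) * d = ((k * d.val : ℤ) : ZMod (c * N)) := by simp
  rw [circlePt, fourier_coe_apply, h1, ZMod.stdAddChar_coe]
  congr 1
  push_cast
  field_simp

/-- Averages over the circle of the test function `F` along every dilation weight are `o(c)`-close
to those of its mean value. -/
def Equidistributes (N : ℕ) [Fact (0 < (N : ℝ))] (F : C(AddCircle (N : ℝ), ℂ)) : Prop :=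
  ∀ κ : ℝ, 0 < κ → ∃ c₀ : ℕ, ∀ c : ℕ, c₀ ≤ c → ∀ [NeZero (c * N)], ∀ X, IsDilationWeight c N X →
    ∀ (u : ZMod (c * N)) (n : ℕ), n ≤ c * N →
    ‖∑ i ∈ Finset.range n, ∑ d, X (u + i) d *
      (F (circlePt c N d) - ∫ x, F x ∂AddCircle.haarAddCircle)‖ ≤ κ * c

lemma integral_fourier_eq_zero {N : ℕ} [Fact (0 < (N : ℝ))] {k : ℤ} (hk : k ≠ 0) :
    ∫ x : AddCircle (N : ℝ), fourier k x ∂AddCircle.haarAddCircle = 0 := by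
  have h := congrFun (fourierCoeff_fourier (T := (N : ℝ)) k) 0
  rw [fourierCoeff] at h
  simpa [Pi.single_apply, hk.symm] using h

lemma equidistributes_fourier (N : ℕ) [Fact (0 < (N : ℝ))] (k : ℤ) :
    Equidistributes N (fourier k) := by
  intro κ hκ
  rcases eq_or_ne k 0 with rfl | hk
  · refine ⟨0, fun c _ _ X _ u n _ => ?_⟩
    simp
    positivity
  · obtain ⟨c₀, h⟩ := exists_norm_sum_range_stdAddChar_le N hk hκ
    refine ⟨c₀, fun c hc _ X hX u n hn => ?_⟩
    simp_rw [integral_fourier_eq_zero hk, sub_zero, fourier_circlePt]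
    exact h c hc X hX u n hn

lemma integrable_continuousMap_circle {N : ℕ} [Fact (0 < (N : ℝ))] (F : C(AddCircle (N : ℝ), ℂ)) :
    MeasureTheory.Integrable F AddCircle.haarAddCircle :=
  F.continuous.integrable_of_hasCompactSupport (HasCompactSupport.of_compactSpace F)

lemma Equidistributes.add {N : ℕ} [Fact (0 < (N : ℝ))] {F G : C(AddCircle (N : ℝ), ℂ)}
    (hF : Equidistributes N F) (hG : Equidistributes N G) : Equidistributes N (F + G) := by
  intro κ hκ
  obtain ⟨c₁, h₁⟩ := hF (κ / 2) (by positivity)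
  obtain ⟨c₂, h₂⟩ := hG (κ / 2) (by positivity)
  refine ⟨max c₁ c₂, fun c hc _ X hX u n hn => ?_⟩
  have e1 := h₁ c ((le_max_left _ _).trans hc) X hX u n hn
  have e2 := h₂ c ((le_max_right _ _).trans hc) X hX u n hn
  simp only [ContinuousMap.add_apply]
  rw [MeasureTheory.integral_add (integrable_continuousMap_circle F)
    (integrable_continuousMap_circle G)]
  simp_rw [add_sub_add_comm, mul_add, Finset.sum_add_distrib]
  exact (norm_add_le _ _).trans (by linarith)

lemma Equidistributes.smul {N : ℕ} [Fact (0 < (N : ℝ))] {F : C(AddCircle (N : ℝ), ℂ)}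
    (hF : Equidistributes N F) (z : ℂ) : Equidistributes N (z • F) := by
  intro κ hκ
  obtain ⟨c₁, h₁⟩ := hF (κ / (‖z‖ + 1)) (by positivity)
  refine ⟨c₁, fun c hc _ X hX u n hn => ?_⟩
  have e1 := h₁ c hc X hX u n hn
  simp only [ContinuousMap.smul_apply, smul_eq_mul]
  rw [MeasureTheory.integral_const_mul]
  simp_rw [← mul_sub, mul_left_comm _ z, ← Finset.mul_sum]
  rw [norm_mul]
  calc ‖z‖ * _ ≤ (‖z‖ + 1) * (κ / (‖z‖ + 1) * c) := by gcongr; linarith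
    _ = κ * c := by field_simp

lemma equidistributes_of_forall_close {N : ℕ} [Fact (0 < (N : ℝ))] {F : C(AddCircle (N : ℝ), ℂ)}
    (h : ∀ η : ℝ, 0 < η → ∃ G, Equidistributes N G ∧ ‖F - G‖ ≤ η) : Equidistributes N F := by
  intro κ hκ
  have hN : (0 : ℝ) < N := Fact.out
  obtain ⟨G, hG, hFG⟩ := h (κ / (4 * N ^ 2)) (by positivity)
  obtain ⟨c₁, h₁⟩ := hG (κ / 2) (by positivity)
  refine ⟨c₁, fun c hc _ X hX u n hn => ?_⟩
  have e1 := h₁ c hc X hX u n hn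
  have hpt : ∀ x, ‖(F - G) x‖ ≤ κ / (4 * N ^ 2) := fun x =>
    ((F - G).norm_coe_le_norm x).trans hFG
  have e2 : ‖∑ i ∈ Finset.range n, ∑ d, X (u + i) d *
      ((F - G) (circlePt c N d) - ∫ x, (F - G) x ∂AddCircle.haarAddCircle)‖ ≤ κ / 2 * c := by
    refine (norm_sum_le _ _).trans ?_
    have hb : ∀ i ∈ Finset.range n, ‖∑ d, X (u + i) d * ((F - G) (circlePt c N d) -
        ∫ x, (F - G) x ∂AddCircle.haarAddCircle)‖ ≤ N * (2 * (κ / (4 * N ^ 2))) := by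
      intro i _
      refine hX.norm_sum_mul_le _ _ fun d => ?_
      have h3 : ‖∫ x, (F - G) x ∂AddCircle.haarAddCircle‖ ≤ κ / (4 * N ^ 2) := by
        have := MeasureTheory.norm_integral_le_of_norm_le_const
          (μ := (AddCircle.haarAddCircle : MeasureTheory.Measure (AddCircle (N : ℝ))))
          (Filter.Eventually.of_forall hpt)
        simpa using this
      calc _ ≤ ‖(F - G) (circlePt c N d)‖ + _ := norm_sub_le _ _
        _ ≤ _ := by linarith [hpt (circlePt c N d)]
    refine (Finset.sum_le_card_nsmul _ _ _ hb).trans ?_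
    rw [Finset.card_range, nsmul_eq_mul]
    have hn' : (n : ℝ) ≤ c * N := by exact_mod_cast hn
    calc (n : ℝ) * (N * (2 * (κ / (4 * N ^ 2)))) ≤ (c * N) * (N * (2 * (κ / (4 * N ^ 2)))) := by
          gcongr
      _ = κ / 2 * c := by field_simp; norm_num
  have e3 : ∑ i ∈ Finset.range n, ∑ d, X (u + i) d *
      (F (circlePt c N d) - ∫ x, F x ∂AddCircle.haarAddCircle) =
      ∑ i ∈ Finset.range n, ∑ d, X (u + i) d *
        (G (circlePt c N d) - ∫ x, G x ∂AddCircle.haarAddCircle) +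
      ∑ i ∈ Finset.range n, ∑ d, X (u + i) d *
        ((F - G) (circlePt c N d) - ∫ x, (F - G) x ∂AddCircle.haarAddCircle) := by
    simp only [ContinuousMap.sub_apply]
    rw [MeasureTheory.integral_sub (integrable_continuousMap_circle F)
      (integrable_continuousMap_circle G)]
    simp_rw [← Finset.sum_add_distrib, ← mul_add]
    refine Finset.sum_congr rfl fun i _ => Finset.sum_congr rfl fun d _ => ?_
    ring
  rw [e3]
  exact (norm_add_le _ _).trans (by linarith)

lemma equidistributes (N : ℕ) [Fact (0 < (N : ℝ))] (F : C(AddCircle (N : ℝ), ℂ)) :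
    Equidistributes N F := by
  refine equidistributes_of_forall_close fun η hη => ?_
  have hF : F ∈ (Submodule.span ℂ (Set.range (@fourier (N : ℝ)))).topologicalClosure := by
    rw [span_fourier_closure_eq_top]; trivial
  obtain ⟨G, hG, hd⟩ := Metric.mem_closure_iff.1 hF η hη
  refine ⟨G, ?_, by rw [← dist_eq_norm]; exact hd.le⟩
  refine Submodule.span_induction (fun g hg => ?_) ?_ (fun _ _ _ _ => Equidistributes.add)
    (fun z _ _ h => h.smul z) hG
  · obtain ⟨k, rfl⟩ := hg
    exact equidistributes_fourier N k
  · have := (equidistributes_fourier N 0).smul 0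
    rwa [zero_smul] at this

/-- The matrix `(a, (a d - 1) / c; c, d)` lies in the ball of radius `T`. -/
def InBall (T c a d : ℝ) : Prop := a ^ 2 + ((a * d - 1) / c) ^ 2 + c ^ 2 + d ^ 2 ≤ T ^ 2

lemma inBall_iff_lt {T c a a₀ d δ θ ε n : ℝ} (hδ : 0 < δ) (hε : 0 < ε)
    (hθ : 16 * θ * (1 + n ^ 2) ≤ δ ^ 2 * ε ^ 2) (hn : 0 ≤ n) (hc1 : 1 ≤ c) (hc : δ * T ≤ c)
    (hT : 1 ≤ T) (hT1 : 2 * (8 * n / δ + 1) < δ ^ 2 * ε ^ 2 * T ^ 2) (ha : |a| ≤ 4 * T)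
    (ha₀ : |a₀| ≤ 4 * T) (haa : |a - a₀| ≤ θ * T) (hd : |d / c| ≤ n)
    (hs : ε < |(|d / c| - √(T ^ 2 / (a₀ ^ 2 + c ^ 2) - 1))|) :
    InBall T c a d ↔ |d / c| < √(T ^ 2 / (a₀ ^ 2 + c ^ 2) - 1) := by
  have hc0 : 0 < c := by linarith
  obtain ⟨y, rfl⟩ : ∃ y, d = y * c := ⟨d / c, by field_simp⟩
  rw [mul_div_cancel_right₀ _ hc0.ne'] at hd hs ⊢
  set q := T ^ 2 / (a₀ ^ 2 + c ^ 2) - 1 with hq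
  set R := a ^ 2 + c ^ 2
  set R₀ := a₀ ^ 2 + c ^ 2 with hR₀
  have hR₀pos : 0 < R₀ := by positivity
  have hRq : R₀ * (1 + q) = T ^ 2 := by rw [hq]; field_simp; ring
  have hcT : δ ^ 2 * T ^ 2 ≤ c ^ 2 := by
    rw [← mul_pow]; exact pow_le_pow_left₀ (by positivity) hc 2
  have hR₀T : δ ^ 2 * T ^ 2 ≤ R₀ := by rw [hR₀]; nlinarith [sq_nonneg a₀]
  have hy2 : y ^ 2 ≤ n ^ 2 := sq_le_sq.2 (by rwa [abs_of_nonneg hn])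
  have hdiff : |a ^ 2 - a₀ ^ 2| ≤ 8 * θ * T ^ 2 := by
    rw [sq_sub_sq, abs_mul]
    calc |a + a₀| * |a - a₀| ≤ (4 * T + 4 * T) * (θ * T) :=
          mul_le_mul ((abs_add_le _ _).trans (add_le_add ha ha₀)) haa (abs_nonneg _) (by linarith)
      _ = _ := by ring
  have hθ0 : 0 ≤ θ := by
    have := (abs_nonneg _).trans haa
    by_contra h
    nlinarith
  have hcross : |2 * a * y / c| ≤ 8 * n / δ := by
    rw [abs_div, abs_mul, abs_mul, abs_two, abs_of_pos hc0, div_le_div_iff₀ hc0 hδ]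
    have h1 : |a| * |y| ≤ 4 * T * n := mul_le_mul ha hd (abs_nonneg _) (by linarith)
    calc 2 * |a| * |y| * δ = 2 * δ * (|a| * |y|) := by ring
      _ ≤ 2 * δ * (4 * T * n) := by gcongr
      _ = 8 * n * (δ * T) := by ring
      _ ≤ 8 * n * c := by gcongr
  have hc2 : 1 / c ^ 2 ≤ 1 := by
    rw [div_le_one (by positivity)]; exact one_le_pow₀ hc1
  have hc2' : 0 ≤ 1 / c ^ 2 := by positivity
  have hexp : a ^ 2 + ((a * (y * c) - 1) / c) ^ 2 + c ^ 2 + (y * c) ^ 2 =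
      R₀ * (1 + y ^ 2) + ((a ^ 2 - a₀ ^ 2) * (1 + y ^ 2) - 2 * a * y / c + 1 / c ^ 2) := by
    rw [hR₀]; field_simp; ring
  have herr : |(a ^ 2 - a₀ ^ 2) * (1 + y ^ 2) - 2 * a * y / c + 1 / c ^ 2| < R₀ * ε ^ 2 := by
    have h1 : |(a ^ 2 - a₀ ^ 2) * (1 + y ^ 2)| ≤ δ ^ 2 * ε ^ 2 * T ^ 2 / 2 := by
      rw [abs_mul, abs_of_nonneg (by positivity : (0 : ℝ) ≤ 1 + y ^ 2)]
      calc |a ^ 2 - a₀ ^ 2| * (1 + y ^ 2) ≤ (8 * θ * T ^ 2) * (1 + n ^ 2) := by gcongr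
        _ = (16 * θ * (1 + n ^ 2)) * T ^ 2 / 2 := by ring
        _ ≤ _ := by gcongr
    have h2 : δ ^ 2 * ε ^ 2 * T ^ 2 ≤ R₀ * ε ^ 2 := by nlinarith [sq_nonneg ε]
    rw [abs_le] at h1 hcross
    rw [abs_lt]
    constructor <;> linarith [h1.1, h1.2, hcross.1, hcross.2]
  rw [abs_lt] at herr
  rw [InBall, hexp]
  have hys : y ^ 2 = |y| ^ 2 := (sq_abs y).symm
  have hsn : 0 ≤ √q := Real.sqrt_nonneg q
  have hyn : 0 ≤ |y| := abs_nonneg y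
  clear_value R₀ R q
  clear hexp hdiff hcross hc2 hc2' hR₀T hcT hθ hT1 hR₀ hq
  rcases lt_abs.1 hs with h | h
  · have h1 : q ≤ √q ^ 2 := by
      rcases le_or_gt 0 q with h0 | h0
      · rw [Real.sq_sqrt h0]
      · exact h0.le.trans (sq_nonneg _)
    have h2 : q + ε ^ 2 ≤ y ^ 2 := by
      have h4 : ε ^ 2 ≤ (|y| - √q) ^ 2 := pow_le_pow_left₀ hε.le h.le 2
      have h5 : 0 ≤ √q * (|y| - √q) := mul_nonneg hsn (by linarith)
      rw [hys]
      linarith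
    refine ⟨fun h3 => ?_, fun h3 => by linarith⟩
    have h6 := mul_le_mul_of_nonneg_left h2 hR₀pos.le
    linarith
  · have hq0 : 0 < q := by
      by_contra h0
      rw [Real.sqrt_eq_zero_of_nonpos (not_lt.1 h0)] at h
      linarith
    have h1 : √q ^ 2 = q := Real.sq_sqrt hq0.le
    have h2 : y ^ 2 + ε ^ 2 ≤ q := by
      have h4 : ε ^ 2 ≤ (-(|y| - √q)) ^ 2 := pow_le_pow_left₀ hε.le h.le 2
      have h5 : 0 ≤ |y| * (√q - |y|) := mul_nonneg hyn (by linarith)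
      rw [hys]
      linarith
    refine ⟨fun _ => by linarith, fun _ => ?_⟩
    have h6 := mul_le_mul_of_nonneg_left h2 hR₀pos.le
    linarith

section Bumps

variable {N : ℕ}

/-- A tent on the circle of height `2` around the origin, at least `1` within distance `2 ε`. -/
def tent (N : ℕ) (ε : ℝ) (x : AddCircle (N : ℝ)) : ℝ := max 0 (2 - ‖x‖ / (2 * ε))

/-- A continuous approximation of the indicator function of `‖x‖ < s`. -/
def cutoff (N : ℕ) (ε s : ℝ) : C(AddCircle (N : ℝ), ℂ) where
  toFun x := ((max 0 (min 1 ((s - ‖x‖) / ε)) : ℝ) : ℂ)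
  continuous_toFun := by fun_prop

/-- A continuous majorant of the indicator function of `|‖x‖ - s| ≤ 2 ε`. -/
def doubleTent (N : ℕ) (ε s : ℝ) : C(AddCircle (N : ℝ), ℂ) where
  toFun x := ((tent N ε (x - (s : ℝ)) + tent N ε (x + (s : ℝ)) : ℝ) : ℂ)
  continuous_toFun := by unfold tent; fun_prop

lemma tent_nonneg (ε : ℝ) (x : AddCircle (N : ℝ)) : 0 ≤ tent N ε x := le_max_left _ _

lemma one_le_tent {ε : ℝ} (hε : 0 < ε) {x : AddCircle (N : ℝ)} (hx : ‖x‖ ≤ 2 * ε) :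
    1 ≤ tent N ε x := by
  refine le_max_of_le_right ?_
  have : ‖x‖ / (2 * ε) ≤ 1 := (div_le_one (by positivity)).2 hx
  linarith

lemma integral_tent_le [Fact (0 < (N : ℝ))] {ε : ℝ} (hε : 0 < ε) :
    ∫ x, tent N ε x ∂AddCircle.haarAddCircle ≤ 16 * ε / N := by
  have hN : (0 : ℝ) < N := Fact.out
  have hcont : Continuous (tent N ε) := by unfold tent; fun_prop
  rw [AddCircle.integral_haarAddCircle, smul_eq_mul, mul_comm, ← div_eq_mul_inv]
  refine div_le_div_of_nonneg_right ?_ hN.le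
  have hvol : MeasureTheory.volume.real (Metric.closedBall (0 : AddCircle (N : ℝ)) (4 * ε)) ≤
      8 * ε := by
    rw [MeasureTheory.measureReal_def, AddCircle.volume_closedBall,
      ENNReal.toReal_ofReal (by positivity)]
    exact (min_le_right _ _).trans_eq (by ring)
  calc ∫ x, tent N ε x = ∫ x in Metric.closedBall (0 : AddCircle (N : ℝ)) (4 * ε), tent N ε x := by
        refine (MeasureTheory.setIntegral_eq_integral_of_forall_compl_eq_zero fun x hx => ?_).symm
        rw [mem_closedBall_zero_iff, not_le] at hx
        refine max_eq_left ?_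
        have : 2 ≤ ‖x‖ / (2 * ε) := by
          rw [le_div_iff₀ (by positivity)]
          linarith
        linarith
    _ ≤ 2 * MeasureTheory.volume.real (Metric.closedBall (0 : AddCircle (N : ℝ)) (4 * ε)) := by
        refine (le_abs_self _).trans ?_
        rw [← Real.norm_eq_abs]
        refine MeasureTheory.norm_setIntegral_le_of_norm_le_const
          (MeasureTheory.measure_lt_top _ _) fun x _ => ?_
        rw [Real.norm_of_nonneg (tent_nonneg _ _), tent]
        refine max_le (by norm_num) ?_
        have : 0 ≤ ‖x‖ / (2 * ε) := by positivity
        linarith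
    _ ≤ 16 * ε := by linarith

lemma integral_doubleTent [Fact (0 < (N : ℝ))] (ε s : ℝ) :
    ∫ x, doubleTent N ε s x ∂AddCircle.haarAddCircle =
      ((2 * ∫ x, tent N ε x ∂AddCircle.haarAddCircle : ℝ) : ℂ) := by
  have hcont : Continuous (tent N ε) := by unfold tent; fun_prop
  have hint : ∀ f : AddCircle (N : ℝ) → ℝ, Continuous f →
      MeasureTheory.Integrable f AddCircle.haarAddCircle := fun f hf =>
    hf.integrable_of_hasCompactSupport (HasCompactSupport.of_compactSpace f)
  have : ∀ x, doubleTent N ε s x =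
      ((tent N ε (x - (s : ℝ)) + tent N ε (x + (s : ℝ)) : ℝ) : ℂ) := fun _ => rfl
  simp_rw [this]
  rw [integral_complex_ofReal, MeasureTheory.integral_add (hint _ (by fun_prop))
    (hint _ (by fun_prop)), MeasureTheory.integral_sub_right_eq_self,
    MeasureTheory.integral_add_right_eq_self, two_mul]

lemma norm_coe_circle_le (y : ℝ) : ‖(y : AddCircle (N : ℝ))‖ ≤ |y| :=
  QuotientAddGroup.norm_mk_le_norm

lemma abs_indicator_sub_cutoff_le [Fact (0 < (N : ℝ))] {ε s s' y : ℝ} {p : Prop} [Decidable p]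
    (hε : 0 < ε) (hy : |y| ≤ N / 2) (hss : |s - s'| ≤ ε) (hp : ε < |(|y| - s)| → (p ↔ |y| < s)) :
    ‖(if p then 1 else 0 : ℂ) - cutoff N ε s' (y : AddCircle (N : ℝ))‖ ≤
      (doubleTent N ε s' (y : AddCircle (N : ℝ))).re := by
  have hN : (0 : ℝ) < N := Fact.out
  have hnorm : ‖(y : AddCircle (N : ℝ))‖ = |y| :=
    (AddCircle.norm_coe_eq_abs_iff _ hN.ne').2 (by rwa [abs_of_pos hN])
  have hcut : cutoff N ε s' (y : AddCircle (N : ℝ)) =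
      ((max 0 (min 1 ((s' - |y|) / ε)) : ℝ) : ℂ) := by rw [← hnorm]; rfl
  have htent : (doubleTent N ε s' (y : AddCircle (N : ℝ))).re =
      tent N ε ((y - s' : ℝ) : AddCircle (N : ℝ)) +
        tent N ε ((y + s' : ℝ) : AddCircle (N : ℝ)) := rfl
  have h0 : 0 ≤ max 0 (min 1 ((s' - |y|) / ε)) := le_max_left _ _
  have h1 : max 0 (min 1 ((s' - |y|) / ε)) ≤ 1 := max_le zero_le_one (min_le_left _ _)
  have t0 := tent_nonneg ε ((y - s' : ℝ) : AddCircle (N : ℝ))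
  have t1 := tent_nonneg ε ((y + s' : ℝ) : AddCircle (N : ℝ))
  rw [hcut, htent]
  have hreal : ‖(if p then 1 else 0 : ℂ) - ((max 0 (min 1 ((s' - |y|) / ε)) : ℝ) : ℂ)‖ =
      |(if p then 1 else 0) - max 0 (min 1 ((s' - |y|) / ε))| := by
    generalize max 0 (min 1 ((s' - |y|) / ε)) = m
    rw [← Real.norm_eq_abs (_ - m), ← Complex.norm_real, Complex.ofReal_sub]
    split_ifs <;> simp
  rw [hreal]
  rcases le_or_gt (|(|y| - s')|) (2 * ε) with h | h
  · have hle : |(if p then 1 else 0) - max 0 (min 1 ((s' - |y|) / ε))| ≤ 1 := by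
      rw [abs_le]; split_ifs <;> constructor <;> linarith
    refine hle.trans ?_
    rcases abs_choice y with hy' | hy'
    · have := one_le_tent hε ((norm_coe_circle_le (N := N) (y - s')).trans (by rwa [hy'] at h))
      linarith
    · have := one_le_tent hε ((norm_coe_circle_le (N := N) (y + s')).trans (by
        rw [hy', ← abs_neg] at h; convert h using 2; ring))
      linarith
  · have hfar : ε < |(|y| - s)| := by
      have : |y| - s' = (|y| - s) + (s - s') := by ring
      rw [this] at h
      linarith [abs_add_le (|y| - s) (s - s')]
    have hz : |(if p then 1 else 0) - max 0 (min 1 ((s' - |y|) / ε))| = 0 := by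
      rw [abs_le] at hss
      rcases lt_abs.1 h with h' | h'
      · have : ¬p := fun hpp => by
          have := (hp hfar).1 hpp
          linarith [hss.2]
        have h2 : (s' - |y|) / ε ≤ 0 := div_nonpos_of_nonpos_of_nonneg (by linarith) hε.le
        rw [if_neg this, max_eq_left ((min_le_right _ _).trans h2)]
        simp
      · have : p := (hp hfar).2 (by linarith [hss.1])
        have h2 : 1 ≤ (s' - |y|) / ε := by rw [le_div_iff₀ hε]; linarith
        rw [if_pos this, min_eq_left h2]
        simp
    rw [hz]
    linarith

end Bumps

section MatWeight

variable {c N : ℕ}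

/-- For `x = a * d` with `a * d - b * c = 1` this is the residue of `b` modulo `N`. -/
def quotMod (c N : ℕ) (x : ZMod (c * N)) : ZMod N := (((x.val : ℤ) - 1) / c : ℤ)

/-- The reduction from residues modulo `c * N` to residues modulo `N`. -/
abbrev redRight (c N : ℕ) : ZMod (c * N) →+* ZMod N := ZMod.castHom (Dvd.intro_left c rfl) _

/-- The weight on pairs `(a, d)` given by a function of the entries modulo `N` of the matrix
`(a, b; c, d)` of determinant one. -/
def matWeight (c N : ℕ) (χ : ZMod N → ZMod N → ZMod N → ZMod N → ℂ) (a d : ZMod (c * N)) : ℂ :=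
  if redMod c N (a * d) = 1 then
    χ (redRight c N a) (quotMod c N (a * d)) c (redRight c N d) else 0

variable {χ : ZMod N → ZMod N → ZMod N → ZMod N → ℂ}

lemma isDilationWeight_matWeight (hχ : ∀ a b c d, ‖χ a b c d‖ ≤ 1) :
    IsDilationWeight c N (matWeight c N χ) where
  norm_le a d := by
    rw [matWeight]
    split_ifs
    · exact hχ _ _ _ _
    · simp
  support a d h := by
    rw [← map_mul]
    by_contra h'
    exact h (if_neg h')
  dilate u hu a d := by
    have h1 : redRight c N u = 1 := congrArg Units.val hu
    have h2 : redRight c N (↑u⁻¹ : ZMod (c * N)) = 1 := by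
      have : redRight c N (u * ↑u⁻¹ : ZMod (c * N)) = 1 := by rw [Units.mul_inv, map_one]
      rwa [map_mul, h1, one_mul] at this
    have h3 : (u * a : ZMod (c * N)) * (↑u⁻¹ * d) = a * d := by
      rw [mul_mul_mul_comm, Units.mul_inv, one_mul]
    rw [matWeight, matWeight, h3, map_mul (redRight c N), map_mul (redRight c N), h1, h2, one_mul,
      one_mul]

lemma quotMod_intCast [NeZero (c * N)] {a b d : ℤ} (h : a * d - b * c = 1) :
    quotMod c N ((a : ZMod (c * N)) * d) = b := by
  have hc : (c : ℤ) ≠ 0 := by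
    exact_mod_cast (Nat.pos_of_mul_pos_right (NeZero.pos (c * N))).ne'
  have h1 : ((((a : ZMod (c * N)) * d).val : ℤ) : ZMod (c * N)) = ((a * d : ℤ) : ZMod (c * N)) := by
    simp
  obtain ⟨k, hk⟩ := (ZMod.intCast_eq_intCast_iff_dvd_sub _ _ _).1 h1
  have h2 : (((a : ZMod (c * N)) * d).val : ℤ) - 1 = (b - N * k) * c := by
    push_cast at hk
    linear_combination h - hk
  rw [quotMod, h2, Int.mul_ediv_cancel _ hc]
  simp

lemma matWeight_intCast [NeZero (c * N)] {a b d : ℤ} (h : a * d - b * c = 1) :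
    matWeight c N χ a d = χ a b c d := by
  have h1 : redMod c N ((a : ZMod (c * N)) * d) = 1 := by
    have : (a * d : ℤ) = b * c + 1 := by linarith
    rw [← Int.cast_mul, this]
    simp
  rw [matWeight, if_pos h1, quotMod_intCast h, map_intCast, map_intCast]

lemma exists_of_redMod_mul_eq_one {a d : ℤ}
    (h : redMod c N ((a : ZMod (c * N)) * d) = 1) : ∃ b : ℤ, a * d - b * c = 1 := by
  rw [← Int.cast_mul, map_intCast] at h
  have h' : ((a * d : ℤ) : ZMod c) = (1 : ℤ) := by rw [h]; simp
  obtain ⟨k, hk⟩ := (ZMod.intCast_eq_intCast_iff_dvd_sub _ _ _).1 h'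
  exact ⟨-k, by linarith⟩

lemma matWeight_add_left [NeZero (c * N)] (a d : ZMod (c * N)) :
    matWeight c N χ a (d + c) = matWeight c N (fun a b c d => χ a (a + b) c (c + d)) a d := by
  obtain ⟨a, rfl⟩ := ZMod.intCast_surjective a
  obtain ⟨d, rfl⟩ := ZMod.intCast_surjective d
  have hcast : ((d : ZMod (c * N)) + c) = ((d + c : ℤ) : ZMod (c * N)) := by simp
  have hred : redMod c N ((a : ZMod (c * N)) * (d + c)) = redMod c N ((a : ZMod (c * N)) * d) := by
    simp
  by_cases h : redMod c N ((a : ZMod (c * N)) * d) = 1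
  · obtain ⟨b, hb⟩ := exists_of_redMod_mul_eq_one h
    have hb' : a * (d + c) - (a + b) * c = 1 := by linarith
    rw [hcast, matWeight_intCast hb', matWeight_intCast hb]
    push_cast
    rw [add_comm (d : ZMod N)]
  · rw [matWeight, if_neg (by rwa [hred]), matWeight, if_neg h]

lemma sum_matWeight_eq [NeZero (c * N)] (a : ZMod (c * N)) :
    ∑ d, matWeight c N χ a d =
      ∑ d, matWeight c N (fun a b c d => χ a (a + b) c (c + d)) a d := by
  rw [← Equiv.sum_comp (Equiv.addRight (c : ZMod (c * N)))]
  exact Finset.sum_congr rfl fun d _ => matWeight_add_left a d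

end MatWeight

open Classical in
/-- The indicator function of the ball, on residues modulo `c * N`. -/
def ballInd (T : ℝ) (c N : ℕ) (a : ℤ) (d : ZMod (c * N)) : ℂ :=
  if InBall T c a d.valMinAbs then 1 else 0

lemma abs_valMinAbs_div_le {c N : ℕ} [NeZero (c * N)] (d : ZMod (c * N)) :
    |(d.valMinAbs / c : ℝ)| ≤ N / 2 := by
  have hc : (0 : ℝ) < c := by
    exact_mod_cast Nat.pos_of_mul_pos_right (NeZero.pos (c * N))
  have h1 : d.valMinAbs.natAbs * 2 ≤ c * N := by
    have := ZMod.natAbs_valMinAbs_le d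
    omega
  have h2 : |(d.valMinAbs : ℝ)| * 2 ≤ c * N := by
    rw [← Int.cast_abs, Int.abs_eq_natAbs]
    exact_mod_cast h1
  rw [abs_div, abs_of_pos hc, div_le_div_iff₀ hc two_pos]
  linarith

lemma circlePt_eq_valMinAbs {c N : ℕ} [NeZero (c * N)] (d : ZMod (c * N)) :
    circlePt c N d = ((d.valMinAbs / c : ℝ) : AddCircle (N : ℝ)) := by
  rw [← circlePt_intCast d.valMinAbs, ZMod.coe_valMinAbs]

lemma exists_norm_sum_mul_ballInd_le (N : ℕ) [Fact (0 < (N : ℝ))] {δ κ : ℝ} (hδ : 0 < δ)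
    (hδ1 : δ ≤ 1) (hκ : 0 < κ) :
    ∃ θ : ℝ, 0 < θ ∧ θ ≤ δ ∧ ∃ T₀ : ℝ, ∀ T : ℝ, T₀ ≤ T → ∀ c : ℕ, δ * T ≤ c → (c : ℝ) ≤ T →
      ∀ [NeZero (c * N)], ∀ Z, IsDilationWeight c N Z → (∀ a, ∑ d, Z a d = 0) →
      ∀ u : ℤ, |(u : ℝ)| ≤ 3 * T → ∀ l : ℕ, l ≤ θ * T →
      ‖∑ i ∈ Finset.range l, ∑ d, Z (u + i) d * ballInd T c N (u + i) d‖ ≤ κ * (θ * T) := by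
  classical
  have hN : (0 : ℝ) < N := Fact.out
  have hN1 : 1 ≤ N := by exact_mod_cast hN
  set n : ℝ := N / 2 with hn
  set ε : ℝ := κ / 64 with hε
  have hε0 : 0 < ε := by positivity
  set θ : ℝ := min δ (δ ^ 2 * ε ^ 2 / (16 * (1 + n ^ 2))) with hθ
  have hθ0 : 0 < θ := by positivity
  have hθ2 : 16 * θ * (1 + n ^ 2) ≤ δ ^ 2 * ε ^ 2 := by
    have := (le_div_iff₀ (by positivity)).1 (min_le_right δ (δ ^ 2 * ε ^ 2 / (16 * (1 + n ^ 2))))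
    rw [← hθ] at this
    linarith
  set κ' : ℝ := κ * θ / 4 with hκ'
  have hκ'0 : 0 < κ' := by positivity
  choose c₁ hc₁ using fun j : ℕ => equidistributes N (cutoff N ε (j * ε)) κ' hκ'0
  choose c₂ hc₂ using fun j : ℕ => equidistributes N (doubleTent N ε (j * ε)) κ' hκ'0
  set J : ℕ := ⌊1 / δ / ε⌋₊
  set m₁ := (Finset.range (J + 1)).sup c₁
  set m₂ := (Finset.range (J + 1)).sup c₂
  refine ⟨θ, hθ0, min_le_left _ _,
    max (1 + (m₁ + m₂) / δ) (1 + (2 * (8 * n / δ + 1)) / (δ ^ 2 * ε ^ 2)),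
    fun T hT c hcT hcT' _ Z hZ hZ0 u hu l hl => ?_⟩
  have hTm : 1 + (m₁ + m₂) / δ ≤ T := (le_max_left _ _).trans hT
  have hT1 : 1 ≤ T := le_trans (by simp; positivity) hTm
  have hTn : 2 * (8 * n / δ + 1) < δ ^ 2 * ε ^ 2 * T ^ 2 := by
    have h1 : (2 * (8 * n / δ + 1)) / (δ ^ 2 * ε ^ 2) < T := by
      linarith [(le_max_right _ _).trans hT]
    rw [div_lt_iff₀ (by positivity)] at h1
    have h2 : T ≤ T ^ 2 := by nlinarith
    have h3 : T * (δ ^ 2 * ε ^ 2) ≤ T ^ 2 * (δ ^ 2 * ε ^ 2) := by gcongr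
    linarith
  have hmc : (m₁ + m₂ : ℝ) ≤ c := by
    have h1 : (m₁ + m₂) / δ ≤ T := by linarith
    rw [div_le_iff₀ hδ] at h1
    linarith
  have hc0 : 0 < c := Nat.pos_of_mul_pos_right (NeZero.pos (c * N))
  have hc1 : (1 : ℝ) ≤ c := by exact_mod_cast hc0
  have hlc : l ≤ c * N := by
    have h1 : (l : ℝ) ≤ c := hl.trans ((mul_le_mul_of_nonneg_right (min_le_left _ _)
      (by linarith)).trans hcT)
    have h2 : l ≤ c := by exact_mod_cast h1
    exact h2.trans (Nat.le_mul_of_pos_right c hN1)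
  set s : ℝ := √(T ^ 2 / ((u : ℝ) ^ 2 + (c : ℝ) ^ 2) - 1) with hs
  have hs1 : s ≤ 1 / δ := by
    refine Real.sqrt_le_iff.2 ⟨by positivity, ?_⟩
    have h1 : T ^ 2 / ((u : ℝ) ^ 2 + (c : ℝ) ^ 2) ≤ (1 / δ) ^ 2 := by
      rw [div_pow, one_pow, div_le_div_iff₀ (by positivity) (by positivity)]
      have : (δ * T) ^ 2 ≤ (c : ℝ) ^ 2 := pow_le_pow_left₀ (by positivity) hcT 2
      nlinarith [sq_nonneg (u : ℝ)]
    linarith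
  set j : ℕ := ⌊s / ε⌋₊ with hj
  have hjJ : j ∈ Finset.range (J + 1) :=
    Finset.mem_range_succ_iff.2 (Nat.floor_le_floor (by gcongr))
  have hsj : |s - j * ε| ≤ ε := by
    have h1 : (j : ℝ) ≤ s / ε := Nat.floor_le (by positivity)
    have h2 : s / ε < j + 1 := Nat.lt_floor_add_one _
    rw [le_div_iff₀ hε0] at h1
    rw [div_lt_iff₀ hε0] at h2
    rw [abs_le]
    constructor <;> linarith
  have hcj₁ : c₁ j ≤ c := by
    have h1 : c₁ j ≤ m₁ := Finset.le_sup (f := c₁) hjJ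
    have h2 : m₁ + m₂ ≤ c := by exact_mod_cast hmc
    omega
  have hcj₂ : c₂ j ≤ c := by
    have h1 : c₂ j ≤ m₂ := Finset.le_sup (f := c₂) hjJ
    have h2 : m₁ + m₂ ≤ c := by exact_mod_cast hmc
    omega
  set F := cutoff N ε (j * ε)
  set G := doubleTent N ε (j * ε)
  have hE : IsDilationWeight c N (matWeight c N fun _ _ _ _ => 1) :=
    isDilationWeight_matWeight fun _ _ _ _ => by simp
  have key1 := hc₁ j c hcj₁ Z hZ u l hlc
  have key2 := hc₂ j c hcj₂ _ hE u l hlc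
  set E : ZMod (c * N) → ZMod (c * N) → ℂ := matWeight c N fun _ _ _ _ => 1 with hEdef
  -- the difference between the indicator and the cut-off
  have hdiff : ∀ i ∈ Finset.range l, ∀ d : ZMod (c * N),
      ‖ballInd T c N (u + i) d - F (circlePt c N d)‖ ≤ (G (circlePt c N d)).re := by
    intro i hi d
    have hil : (i : ℝ) ≤ θ * T := by
      refine le_trans ?_ hl
      exact_mod_cast (Finset.mem_range.1 hi).le
    have hi0 : (0 : ℝ) ≤ i := i.cast_nonneg
    have hθT : θ * T ≤ T := by
      have : θ ≤ 1 := (min_le_left _ _).trans hδ1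
      nlinarith
    rw [circlePt_eq_valMinAbs, ballInd]
    refine abs_indicator_sub_cutoff_le hε0 (abs_valMinAbs_div_le d) hsj fun h => ?_
    refine inBall_iff_lt hδ hε0 hθ2 (by positivity) hc1 hcT hT1 hTn ?_ (by linarith) ?_
      (abs_valMinAbs_div_le d) h
    · push_cast
      refine (abs_add_le _ _).trans ?_
      rw [abs_of_nonneg hi0]
      linarith
    · push_cast
      rw [add_sub_cancel_left, abs_of_nonneg hi0]
      exact hil
  have hG0 : ∀ x, ((G x).re : ℂ) = G x := fun x => by
    rw [← Complex.conj_eq_iff_re]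
    exact Complex.conj_ofReal _
  have hE1 : ∀ a d, ((E a d).re : ℂ) = E a d := fun a d => by
    rw [hEdef, matWeight]; split_ifs <;> simp
  have hZE : ∀ a d, ‖Z a d‖ ≤ (E a d).re := fun a d => by
    rw [hEdef, matWeight, map_mul]
    split_ifs with h
    · simpa using hZ.norm_le a d
    · have : Z a d = 0 := by
        by_contra h'
        exact h (hZ.support a d h')
      simp [this]
  have hmean : ‖∫ x, G x ∂AddCircle.haarAddCircle‖ ≤ 32 * ε / N := by
    rw [integral_doubleTent, Complex.norm_real, Real.norm_of_nonneg
      (mul_nonneg two_pos.le (MeasureTheory.integral_nonneg (tent_nonneg ε)))]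
    have := integral_tent_le (N := N) hε0
    calc _ ≤ 2 * (16 * ε / N) := by gcongr
      _ = _ := by ring
  have hbound2 : ∑ i ∈ Finset.range l, ∑ d, (E (u + i) d).re * (G (circlePt c N d)).re ≤
      κ' * c + l * (32 * ε) := by
    have h1 : ((∑ i ∈ Finset.range l, ∑ d, (E (u + i) d).re * (G (circlePt c N d)).re : ℝ) : ℂ) =
        ∑ i ∈ Finset.range l, ∑ d, E (u + i) d *
          (G (circlePt c N d) - ∫ x, G x ∂AddCircle.haarAddCircle) +
        ∑ i ∈ Finset.range l, ∑ d, E (u + i) d * ∫ x, G x ∂AddCircle.haarAddCircle := by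
      push_cast
      simp_rw [hE1, hG0, ← Finset.sum_add_distrib]
      refine Finset.sum_congr rfl fun i _ => Finset.sum_congr rfl fun d _ => by ring
    have h2 : ‖∑ i ∈ Finset.range l, ∑ d, E (u + i) d * ∫ x, G x ∂AddCircle.haarAddCircle‖ ≤
        l * (32 * ε) := by
      calc _ ≤ ∑ i ∈ Finset.range l, (N : ℝ) * (32 * ε / N) :=
            norm_sum_le_of_le _ fun i _ => hE.norm_sum_mul_le _ _ fun _ => hmean
        _ = _ := by
            rw [Finset.sum_const, Finset.card_range, nsmul_eq_mul]; field_simp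
    refine (le_abs_self _).trans ?_
    rw [← Real.norm_eq_abs, ← Complex.norm_real, h1]
    exact (norm_add_le _ _).trans (add_le_add key2 h2)
  have hsplit : ∑ i ∈ Finset.range l, ∑ d, Z (u + i) d * ballInd T c N (u + i) d =
      ∑ i ∈ Finset.range l, ∑ d, Z (u + i) d * (ballInd T c N (u + i) d - F (circlePt c N d)) +
      ∑ i ∈ Finset.range l, ∑ d, Z (u + i) d *
        (F (circlePt c N d) - ∫ x, F x ∂AddCircle.haarAddCircle) := by
    rw [← Finset.sum_add_distrib]
    refine Finset.sum_congr rfl fun i _ => ?_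
    have h0 : ∑ d, Z (u + i) d * ∫ x, F x ∂AddCircle.haarAddCircle = 0 := by
      rw [← Finset.sum_mul, hZ0, zero_mul]
    rw [← Finset.sum_add_distrib, ← add_zero (∑ d, Z (u + i) d * ballInd T c N (u + i) d),
      ← neg_zero, ← h0, ← Finset.sum_neg_distrib, ← Finset.sum_add_distrib]
    refine Finset.sum_congr rfl fun d _ => by ring
  rw [hsplit]
  have h3 : ‖∑ i ∈ Finset.range l, ∑ d, Z (u + i) d *
      (ballInd T c N (u + i) d - F (circlePt c N d))‖ ≤ κ' * c + l * (32 * ε) := by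
    refine le_trans ?_ hbound2
    refine norm_sum_le_of_le _ fun i hi => norm_sum_le_of_le _ fun d _ => ?_
    rw [norm_mul]
    exact mul_le_mul (hZE _ _) (hdiff i hi d) (norm_nonneg _) ((norm_nonneg _).trans (hZE _ _))
  refine (norm_add_le _ _).trans ((add_le_add h3 key1).trans ?_)
  have h4 : κ' * c ≤ κ' * T := by gcongr
  have h5 : l * (32 * ε) ≤ θ * T * (32 * ε) := by gcongr
  have h6 : κ' * T = κ * (θ * T) / 4 := by rw [hκ']; ring
  have h7 : θ * T * (32 * ε) = κ * (θ * T) / 2 := by rw [hε]; ring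
  linarith

lemma sum_range_mul_eq {M : Type*} [AddCommMonoid M] (f : ℕ → M) (m l : ℕ) :
    ∑ i ∈ Finset.range (m * l), f i =
      ∑ j ∈ Finset.range m, ∑ i ∈ Finset.range l, f (j * l + i) := by
  induction m with
  | zero => simp
  | succ m ih => rw [add_mul, one_mul, Finset.sum_range_add, ih, Finset.sum_range_succ]

lemma ballInd_eq_zero {T : ℝ} {c N : ℕ} {a : ℤ} (hT : 0 ≤ T) (ha : T < a) (d : ZMod (c * N)) :
    ballInd T c N a d = 0 := by
  refine if_neg fun h => ?_
  rw [InBall] at h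
  have : T ^ 2 < (a : ℝ) ^ 2 := pow_lt_pow_left₀ ha hT two_ne_zero
  linarith [sq_nonneg ((a * d.valMinAbs - 1 : ℝ) / c), sq_nonneg (c : ℝ),
    sq_nonneg (d.valMinAbs : ℝ)]

lemma sum_Icc_neg_eq_sum_range (f : ℤ → ℂ) {t : ℕ} {k : ℕ} (hk : 2 * t + 1 ≤ k)
    (hf : ∀ a : ℤ, (t : ℤ) < a → f a = 0) :
    ∑ a ∈ Finset.Icc (-t : ℤ) t, f a = ∑ i ∈ Finset.range k, f (-t + i) := by
  have h1 : Finset.Icc (-t : ℤ) t ⊆ (Finset.range k).image fun i : ℕ => (-t + i : ℤ) := by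
    intro a ha
    rw [Finset.mem_Icc] at ha
    refine Finset.mem_image.2 ⟨(a + t).toNat, Finset.mem_range.2 (by omega), by omega⟩
  rw [Finset.sum_subset h1, Finset.sum_image]
  · intro x _ y _ h
    simpa using h
  · intro a ha ha'
    obtain ⟨i, -, rfl⟩ := Finset.mem_image.1 ha
    refine hf _ ?_
    rw [Finset.mem_Icc] at ha'
    omega

lemma exists_norm_sum_Icc_mul_ballInd_le (N : ℕ) [Fact (0 < (N : ℝ))] {δ κ : ℝ} (hδ : 0 < δ)
    (hδ1 : δ ≤ 1) (hκ : 0 < κ) :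
    ∃ T₀ : ℝ, ∀ T : ℝ, T₀ ≤ T → ∀ c : ℕ, δ * T ≤ c → (c : ℝ) ≤ T →
      ∀ [NeZero (c * N)], ∀ Z, IsDilationWeight c N Z → (∀ a, ∑ d, Z a d = 0) →
      ‖∑ a ∈ Finset.Icc (-⌊T⌋₊ : ℤ) ⌊T⌋₊, ∑ d, Z a d * ballInd T c N a d‖ ≤ κ * T := by
  obtain ⟨θ, hθ0, hθδ, T₀, h⟩ := exists_norm_sum_mul_ballInd_le N hδ hδ1
    (by positivity : 0 < κ / 5)
  refine ⟨max T₀ (2 / θ), fun T hT c hcT hcT' _ Z hZ hZ0 => ?_⟩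
  have hT0 : T₀ ≤ T := (le_max_left _ _).trans hT
  have hTθ : 2 ≤ θ * T := by
    have := (le_max_right _ _).trans hT
    rw [div_le_iff₀ hθ0] at this
    linarith
  have hTpos : 0 < T := pos_of_mul_pos_right (by linarith : 0 < θ * T) hθ0.le
  set l := ⌊θ * T⌋₊
  set t := ⌊T⌋₊
  have hl : (l : ℝ) ≤ θ * T := Nat.floor_le (by positivity)
  have hl2 : θ * T / 2 ≤ l := by
    have := Nat.lt_floor_add_one (θ * T)
    have h' : θ * T < l + 1 := this
    linarith
  have ht : (t : ℝ) ≤ T := Nat.floor_le hTpos.le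
  have hl0 : 0 < l := by
    have : (0 : ℝ) < l := by linarith
    exact_mod_cast this
  set M := 2 * t / l + 1
  have hM1 : 2 * t + 1 ≤ M * l := by
    have := Nat.lt_div_mul_add (a := 2 * t) hl0
    rw [add_mul, one_mul]
    exact this
  have hM2 : (2 * t / l) * l ≤ 2 * t := Nat.div_mul_le_self _ _
  have hM3 : (M : ℝ) * θ ≤ 5 := by
    have h1 : ((2 * t / l : ℕ) : ℝ) * l ≤ 2 * t := by exact_mod_cast hM2
    have h2 : ((2 * t / l : ℕ) : ℝ) * (θ * T / 2) ≤ 2 * T :=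
      (mul_le_mul_of_nonneg_left hl2 (Nat.cast_nonneg _)).trans (h1.trans (by linarith))
    have h3 : ((2 * t / l : ℕ) : ℝ) * θ ≤ 4 := by
      by_contra! h4
      nlinarith
    have : (M : ℝ) = ((2 * t / l : ℕ) : ℝ) + 1 := by push_cast [M]; rfl
    rw [this]
    linarith
  rw [sum_Icc_neg_eq_sum_range (fun a => ∑ d, Z a d * ballInd T c N a d) hM1]
  · rw [sum_range_mul_eq]
    calc _ ≤ ∑ m ∈ Finset.range M, κ / 5 * (θ * T) := by
          refine norm_sum_le_of_le _ fun m hm => ?_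
          have hml : m * l ≤ 2 * t :=
            (Nat.mul_le_mul_right l (Nat.lt_succ_iff.1 (Finset.mem_range.1 hm))).trans hM2
          have hml' : (m : ℝ) * l ≤ 2 * t := by exact_mod_cast hml
          have := h T hT0 c hcT hcT' Z hZ hZ0 (-t + m * l) (by
            push_cast
            rw [abs_le]
            have : (0 : ℝ) ≤ m * l := by positivity
            constructor <;> linarith) l hl
          refine le_of_eq_of_le ?_ this
          congr 1
          refine Finset.sum_congr rfl fun i _ => ?_
          have e : (-t + ((m * l + i : ℕ) : ℤ) : ℤ) = -t + m * l + i := by push_cast; ring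
          simp only [e]
          push_cast
          rfl
      _ = κ / 5 * T * (M * θ) := by rw [Finset.sum_const, Finset.card_range, nsmul_eq_mul]; ring
      _ ≤ κ / 5 * T * 5 := by gcongr
      _ = κ * T := by ring
  · intro a ha
    refine Finset.sum_eq_zero fun d _ => ?_
    rw [ballInd_eq_zero hTpos.le, mul_zero]
    have h1 : T < t + 1 := Nat.lt_floor_add_one T
    have h2 : ((t + 1 : ℤ) : ℝ) ≤ a := by exact_mod_cast ha
    push_cast at h2
    linarith

lemma frobNorm_le_iff {T : ℝ} (hT : 0 ≤ T) (γ : SL2Z) :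
    frobNorm γ ≤ T ↔
      (γ 0 0 : ℝ) ^ 2 + (γ 0 1 : ℝ) ^ 2 + (γ 1 0 : ℝ) ^ 2 + (γ 1 1 : ℝ) ^ 2 ≤ T ^ 2 := by
  rw [frobNorm, Real.sqrt_le_iff]
  push_cast
  exact and_iff_right hT

lemma det_eq_one (γ : SL2Z) : γ 0 0 * γ 1 1 - γ 0 1 * γ 1 0 = 1 := by
  rw [← Matrix.det_fin_two]; exact γ.det_coe

/-- The matrix of determinant one with given entries. -/
def mkSL (a b c d : ℤ) (h : a * d - b * c = 1) : SL2Z := ⟨!![a, b; c, d], by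
  rw [Matrix.det_fin_two]; simpa using h⟩

lemma ext_entries {γ γ' : SL2Z} (h00 : γ 0 0 = γ' 0 0) (h01 : γ 0 1 = γ' 0 1)
    (h10 : γ 1 0 = γ' 1 0) (h11 : γ 1 1 = γ' 1 1) : γ = γ' := by
  ext i j
  fin_cases i <;> fin_cases j <;> assumption

lemma abs_entry_le {T : ℝ} (hT : 0 ≤ T) {γ : SL2Z} (h : frobNorm γ ≤ T) (i j : Fin 2) :
    |(γ i j : ℝ)| ≤ T := by
  rw [frobNorm_le_iff hT] at h
  refine abs_le_of_sq_le_sq ?_ hT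
  have h00 := sq_nonneg (γ 0 0 : ℝ)
  have h01 := sq_nonneg (γ 0 1 : ℝ)
  have h10 := sq_nonneg (γ 1 0 : ℝ)
  have h11 := sq_nonneg (γ 1 1 : ℝ)
  fin_cases i <;> fin_cases j <;> simp only [Fin.zero_eta, Fin.mk_one, Fin.isValue] <;> linarith

lemma finite_frobNorm_le (T : ℝ) : {γ : SL2Z | frobNorm γ ≤ T}.Finite := by
  let B := Set.Icc (-⌈|T|⌉) ⌈|T|⌉
  have hB : (B ×ˢ B ×ˢ B ×ˢ B).Finite :=
    (Set.finite_Icc _ _).prod ((Set.finite_Icc _ _).prod ((Set.finite_Icc _ _).prod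
      (Set.finite_Icc _ _)))
  refine hB.of_injOn (f := fun γ : SL2Z => (γ 0 0, γ 0 1, γ 1 0, γ 1 1)) ?_ ?_
  · intro γ hγ
    have key : ∀ i j, γ i j ∈ B := fun i j => by
      have h1 := abs_le.1 (abs_entry_le (abs_nonneg T) (hγ.trans (le_abs_self T)) i j)
      have h2 := Int.le_ceil |T|
      constructor
      · have : (-⌈|T|⌉ : ℝ) ≤ γ i j := by linarith
        exact_mod_cast this
      · have : (γ i j : ℝ) ≤ ⌈|T|⌉ := by linarith
        exact_mod_cast this
    exact ⟨key 0 0, key 0 1, key 1 0, key 1 1⟩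
  · intro γ _ γ' _ h
    simp only [Prod.mk.injEq] at h
    exact ext_entries h.1 h.2.1 h.2.2.1 h.2.2.2

/-- The matrices of Frobenius norm at most `T`. -/
def ballFin (T : ℝ) : Finset SL2Z := (finite_frobNorm_le T).toFinset

lemma mem_ballFin {T : ℝ} {γ : SL2Z} : γ ∈ ballFin T ↔ frobNorm γ ≤ T := by
  rw [ballFin, Set.Finite.mem_toFinset]; rfl

/-- `f` depends only on the entries modulo `N`, through a function bounded by one. -/
def FactorsMod (N : ℕ) (f : SL2Z → ℂ) : Prop :=
  ∃ χ : ZMod N → ZMod N → ZMod N → ZMod N → ℂ, (∀ a b c d, ‖χ a b c d‖ ≤ 1) ∧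
    ∀ γ : SL2Z, f γ = χ (γ 0 0) (γ 0 1) (γ 1 0) (γ 1 1)

lemma FactorsMod.norm_le {N : ℕ} {f : SL2Z → ℂ} (hf : FactorsMod N f) (γ : SL2Z) : ‖f γ‖ ≤ 1 := by
  obtain ⟨χ, h1, h2⟩ := hf
  rw [h2]
  exact h1 _ _ _ _

lemma FactorsMod.of_dvd {N M : ℕ} (h : N ∣ M) {f : SL2Z → ℂ} (hf : FactorsMod N f) :
    FactorsMod M f := by
  obtain ⟨χ, h1, h2⟩ := hf
  refine ⟨fun a b c d => χ (ZMod.castHom h _ a) (ZMod.castHom h _ b) (ZMod.castHom h _ c)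
    (ZMod.castHom h _ d), fun _ _ _ _ => h1 _ _ _ _, fun γ => ?_⟩
  simp only [map_intCast, h2]

lemma FactorsMod.comp_neg {N : ℕ} {f : SL2Z → ℂ} (hf : FactorsMod N f) :
    FactorsMod N fun γ => f (-γ) := by
  obtain ⟨χ, h1, h2⟩ := hf
  refine ⟨fun a b c d => χ (-a) (-b) (-c) (-d), fun _ _ _ _ => h1 _ _ _ _, fun γ => ?_⟩
  simp [h2]

lemma FactorsMod.comp_mul_right {N : ℕ} {f : SL2Z → ℂ} (hf : FactorsMod N f) (g : SL2Z) :
    FactorsMod N fun γ => f (γ * g) := by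
  obtain ⟨χ, h1, h2⟩ := hf
  refine ⟨fun a b c d => χ (a * g 0 0 + b * g 1 0) (a * g 0 1 + b * g 1 1)
    (c * g 0 0 + d * g 1 0) (c * g 0 1 + d * g 1 1), fun _ _ _ _ => h1 _ _ _ _, fun γ => ?_⟩
  simp [h2, Matrix.SpecialLinearGroup.coe_mul, Matrix.mul_apply, Fin.sum_univ_two]

lemma inBall_entries_iff {T : ℝ} (hT : 0 ≤ T) {γ : SL2Z} {c : ℕ} (hc : γ 1 0 = c) (hc0 : 0 < c) :
    InBall T c (γ 0 0) (γ 1 1) ↔ frobNorm γ ≤ T := by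
  have hcr : (c : ℝ) ≠ 0 := by exact_mod_cast hc0.ne'
  have h1 : ((γ 0 0 : ℝ) * γ 1 1 - 1) / c = γ 0 1 := by
    rw [div_eq_iff hcr]
    have := det_eq_one γ
    rw [hc] at this
    have h2 : (γ 0 0 : ℝ) * γ 1 1 - γ 0 1 * c = 1 := by exact_mod_cast this
    linarith
  rw [InBall, h1, frobNorm_le_iff hT, hc]
  simp

lemma sum_ballFin_eq_sum_matWeight {N c : ℕ} [NeZero (c * N)] {T : ℝ} (hT : 0 ≤ T)
    (hcT : 2 * T < c * N) (χ : ZMod N → ZMod N → ZMod N → ZMod N → ℂ) :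
    ∑ γ ∈ ballFin T with γ 1 0 = (c : ℤ), χ (γ 0 0) (γ 0 1) (γ 1 0) (γ 1 1) =
      ∑ a ∈ Finset.Icc (-⌊T⌋₊ : ℤ) ⌊T⌋₊, ∑ d, matWeight c N χ a d * ballInd T c N a d := by
  classical
  have hc0 : 0 < c := Nat.pos_of_mul_pos_right (NeZero.pos (c * N))
  have hval : ∀ γ ∈ ballFin T, ((γ 1 1 : ℤ) : ZMod (c * N)).valMinAbs = γ 1 1 := by
    intro γ hγ
    have h1 := abs_le.1 (abs_entry_le hT (mem_ballFin.1 hγ) 1 1)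
    rw [ZMod.valMinAbs_spec]
    refine ⟨rfl, ?_, ?_⟩
    · have : (-(c * N : ℕ) : ℝ) < γ 1 1 * 2 := by push_cast; linarith
      exact_mod_cast this
    · have : (γ 1 1 * 2 : ℝ) ≤ (c * N : ℕ) := by push_cast; linarith
      exact_mod_cast this
  rw [← Finset.sum_product']
  refine Finset.sum_bij_ne_zero (fun γ _ _ => (γ 0 0, ((γ 1 1 : ℤ) : ZMod (c * N)))) ?_ ?_ ?_ ?_
  · intro γ hγ _
    obtain ⟨hγ, hγc⟩ := Finset.mem_filter.1 hγ
    refine Finset.mem_product.2 ⟨?_, Finset.mem_univ _⟩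
    have h1 := abs_entry_le hT (mem_ballFin.1 hγ) 0 0
    have h2 : (γ 0 0).natAbs ≤ ⌊T⌋₊ := by
      refine Nat.le_floor ?_
      rwa [Nat.cast_natAbs, Int.cast_abs]
    rw [Finset.mem_Icc]
    dsimp only
    omega
  · intro γ hγ _ γ' hγ' _ h
    obtain ⟨hγ, hγc⟩ := Finset.mem_filter.1 hγ
    obtain ⟨hγ', hγc'⟩ := Finset.mem_filter.1 hγ'
    rw [Prod.mk.injEq] at h
    have h11 : γ 1 1 = γ' 1 1 := by rw [← hval γ hγ, h.2, hval γ' hγ']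
    refine ext_entries h.1 ?_ (hγc.trans hγc'.symm) h11
    have e1 := det_eq_one γ
    have e2 := det_eq_one γ'
    rw [hγc, h.1, h11] at e1
    rw [hγc'] at e2
    have h3 : γ 0 1 * (c : ℤ) = γ' 0 1 * c := by linarith
    exact mul_right_cancel₀ (by exact_mod_cast hc0.ne') h3
  · rintro ⟨a, D⟩ _ h
    have hw : matWeight c N χ a D ≠ 0 := left_ne_zero_of_mul h
    have hB : InBall T c a D.valMinAbs := by
      by_contra h'
      exact right_ne_zero_of_mul h (if_neg h')
    have hred : redMod c N ((a : ZMod (c * N)) * D) = 1 := by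
      by_contra h'
      exact hw (if_neg h')
    rw [← ZMod.coe_valMinAbs D] at hred
    obtain ⟨b, hb⟩ := exists_of_redMod_mul_eq_one hred
    have hmem : mkSL a b c D.valMinAbs hb ∈ (ballFin T).filter fun γ : SL2Z => γ 1 0 = (c : ℤ) := by
      refine Finset.mem_filter.2 ⟨mem_ballFin.2 ?_, by simp [mkSL]⟩
      rw [← inBall_entries_iff hT (c := c) (by simp [mkSL]) hc0]
      simpa [mkSL] using hB
    refine ⟨mkSL a b c D.valMinAbs hb, hmem, ?_, by simp [mkSL]⟩
    rw [← ZMod.coe_valMinAbs D, matWeight_intCast hb] at hw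
    simpa [mkSL] using hw
  · intro γ hγ _
    obtain ⟨hγ, hγc⟩ := Finset.mem_filter.1 hγ
    have h1 : γ 0 0 * γ 1 1 - γ 0 1 * c = 1 := by rw [← hγc]; exact det_eq_one γ
    have h2 : InBall T c (γ 0 0) (γ 1 1) := (inBall_entries_iff hT hγc hc0).2 (mem_ballFin.1 hγ)
    dsimp only
    rw [matWeight_intCast h1, ballInd, hval γ hγ, if_pos h2, hγc, mul_one]
    simp

lemma entries_mul_T (γ : SL2Z) :
    (γ * ModularGroup.T) 0 0 = γ 0 0 ∧ (γ * ModularGroup.T) 0 1 = γ 0 0 + γ 0 1 ∧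
      (γ * ModularGroup.T) 1 0 = γ 1 0 ∧ (γ * ModularGroup.T) 1 1 = γ 1 0 + γ 1 1 := by
  simp [Matrix.SpecialLinearGroup.coe_mul, ModularGroup.coe_T, Matrix.mul_apply, Fin.sum_univ_two]

lemma exists_norm_sum_natCast_le {N₀ : ℕ} (hN₀ : 0 < N₀) {f : SL2Z → ℂ} (hf : FactorsMod N₀ f)
    {δ κ : ℝ} (hδ : 0 < δ) (hδ1 : δ ≤ 1) (hκ : 0 < κ) :
    ∃ T₀ : ℝ, ∀ T : ℝ, T₀ ≤ T → ∀ c : ℕ, δ * T ≤ c →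
      ‖∑ γ ∈ ballFin T with γ 1 0 = (c : ℤ), (f γ - f (γ * ModularGroup.T))‖ ≤ κ * T := by
  obtain ⟨k, hk⟩ := exists_nat_gt (2 / δ)
  have hk0 : 0 < k := by
    have : (0 : ℝ) < k := lt_trans (by positivity) hk
    exact_mod_cast this
  set N := N₀ * k with hN
  have hNpos : 0 < N := Nat.mul_pos hN₀ hk0
  have hkN : (k : ℝ) ≤ N := by exact_mod_cast Nat.le_mul_of_pos_left k hN₀
  have : Fact (0 < (N : ℝ)) := ⟨by exact_mod_cast hNpos⟩
  obtain ⟨χ, hχ1, hχ⟩ := hf.of_dvd (Dvd.intro k rfl : N₀ ∣ N)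
  obtain ⟨T₀, h⟩ := exists_norm_sum_Icc_mul_ballInd_le N hδ hδ1 (by positivity : 0 < κ / 2)
  refine ⟨max T₀ 1, fun T hT c hcT => ?_⟩
  have hT0 : T₀ ≤ T := (le_max_left _ _).trans hT
  have hT1 : 1 ≤ T := (le_max_right _ _).trans hT
  rcases le_or_gt (c : ℝ) T with hcT' | hcT'
  · have hc0 : 0 < c := by
      have : (0 : ℝ) < c := lt_of_lt_of_le (by positivity) hcT
      exact_mod_cast this
    have : NeZero (c * N) := ⟨(Nat.mul_pos hc0 hNpos).ne'⟩
    have h2T : 2 * T < c * N := by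
      rw [div_lt_iff₀ hδ] at hk
      calc 2 * T < k * δ * T := by gcongr
        _ = δ * T * k := by ring
        _ ≤ c * N := by gcongr
    let ψ : ZMod N → ZMod N → ZMod N → ZMod N → ℂ :=
      fun a b c d => (χ a b c d - χ a (a + b) c (c + d)) / 2
    have hψ : ∀ a b c d, ‖ψ a b c d‖ ≤ 1 := fun a b c d => by
      rw [norm_div, Complex.norm_ofNat, div_le_one two_pos]
      linarith [norm_sub_le (χ a b c d) (χ a (a + b) c (c + d)), hχ1 a b c d,
        hχ1 a (a + b) c (c + d)]
    have hψ0 : ∀ a, ∑ d, matWeight c N ψ a d = 0 := fun a => by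
      have e : ∀ d, matWeight c N ψ a d = (matWeight c N χ a d -
          matWeight c N (fun a b c d => χ a (a + b) c (c + d)) a d) / 2 := fun d => by
        rw [matWeight, matWeight, matWeight]
        split_ifs
        · rfl
        · simp
      simp_rw [e]
      rw [← Finset.sum_div, Finset.sum_sub_distrib, sum_matWeight_eq, sub_self, zero_div]
    have key := h T hT0 c hcT hcT' _ (isDilationWeight_matWeight hψ) hψ0
    rw [← sum_ballFin_eq_sum_matWeight (by linarith) h2T] at key
    have e : ∑ γ ∈ ballFin T with γ 1 0 = (c : ℤ), (f γ - f (γ * ModularGroup.T)) =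
        2 * ∑ γ ∈ ballFin T with γ 1 0 = (c : ℤ), ψ (γ 0 0) (γ 0 1) (γ 1 0) (γ 1 1) := by
      rw [Finset.mul_sum]
      refine Finset.sum_congr rfl fun γ _ => ?_
      obtain ⟨e1, e2, e3, e4⟩ := entries_mul_T γ
      rw [hχ, hχ, e1, e2, e3, e4]
      simp only [ψ]
      push_cast
      ring
    rw [e, norm_mul, Complex.norm_ofNat]
    linarith
  · rw [Finset.sum_eq_zero, norm_zero]
    · positivity
    · intro γ hγ
      obtain ⟨hγ, hγc⟩ := Finset.mem_filter.1 hγ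
      have := abs_entry_le (by linarith) (mem_ballFin.1 hγ) 1 0
      rw [hγc] at this
      simp at this
      linarith

lemma frobNorm_neg (γ : SL2Z) : frobNorm (-γ) = frobNorm γ := by
  simp [frobNorm]

lemma exists_norm_sum_intCast_le {N₀ : ℕ} (hN₀ : 0 < N₀) {f : SL2Z → ℂ} (hf : FactorsMod N₀ f)
    {δ κ : ℝ} (hδ : 0 < δ) (hδ1 : δ ≤ 1) (hκ : 0 < κ) :
    ∃ T₀ : ℝ, ∀ T : ℝ, T₀ ≤ T → ∀ c : ℤ, δ * T ≤ |c| →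
      ‖∑ γ ∈ ballFin T with γ 1 0 = c, (f γ - f (γ * ModularGroup.T))‖ ≤ κ * T := by
  obtain ⟨T₁, h₁⟩ := exists_norm_sum_natCast_le hN₀ hf hδ hδ1 hκ
  obtain ⟨T₂, h₂⟩ := exists_norm_sum_natCast_le hN₀ hf.comp_neg hδ hδ1 hκ
  refine ⟨max T₁ T₂, fun T hT c hc => ?_⟩
  obtain ⟨c, rfl | rfl⟩ := c.eq_nat_or_neg
  · exact h₁ T ((le_max_left _ _).trans hT) c (by simpa using hc)
  · have := h₂ T ((le_max_right _ _).trans hT) c (by simpa using hc)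
    refine le_of_eq_of_le ?_ this
    congr 1
    refine Finset.sum_nbij' (fun γ => -γ) (fun γ => -γ) ?_ ?_ (fun _ _ => neg_neg _)
      (fun _ _ => neg_neg _) ?_
    · intro γ hγ
      obtain ⟨hγ, hγc⟩ := Finset.mem_filter.1 hγ
      refine Finset.mem_filter.2 ⟨mem_ballFin.2 ?_, ?_⟩
      · rw [frobNorm_neg]; exact mem_ballFin.1 hγ
      · simp [hγc]
    · intro γ hγ
      obtain ⟨hγ, hγc⟩ := Finset.mem_filter.1 hγ
      refine Finset.mem_filter.2 ⟨mem_ballFin.2 ?_, ?_⟩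
      · rw [frobNorm_neg]; exact mem_ballFin.1 hγ
      · simp [hγc]
    · intro γ _
      simp [neg_mul]

lemma card_sub_one_le_of_dvd_sub {X : ℝ} {m : ℕ} (hm : 0 < m) {F : Finset ℤ} (hne : F.Nonempty)
    (hF : ∀ x ∈ F, |(x : ℝ)| ≤ X) (hd : ∀ x ∈ F, ∀ y ∈ F, (m : ℤ) ∣ x - y) :
    (F.card : ℝ) - 1 ≤ 2 * X / m := by
  have hX : 0 ≤ X := (abs_nonneg _).trans (hF _ hne.choose_spec)
  have hmr : (0 : ℝ) < m := by exact_mod_cast hm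
  set x₀ := F.min' hne
  have hx₀ : x₀ ∈ F := F.min'_mem hne
  have key : ∀ x ∈ F, ∃ j : ℕ, x = x₀ + m * j := fun x hx => by
    obtain ⟨j, hj⟩ := hd x hx x₀ hx₀
    have h0 : 0 ≤ x - x₀ := sub_nonneg.2 (F.min'_le x hx)
    rw [hj] at h0
    have hj0 : 0 ≤ j := nonneg_of_mul_nonneg_right h0 (by exact_mod_cast hm)
    exact ⟨j.toNat, by rw [Int.toNat_of_nonneg hj0]; linarith⟩
  have hcard : F.card ≤ (Finset.range (⌊2 * X / m⌋₊ + 1)).card := by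
    refine Finset.card_le_card_of_injOn (fun x => ((x - x₀) / m).toNat) ?_ ?_
    · intro x hx
      obtain ⟨j, rfl⟩ := key x hx
      have hm' : (m : ℤ) ≠ 0 := by exact_mod_cast hm.ne'
      simp only [add_sub_cancel_left, Finset.coe_range, Set.mem_Iio]
      rw [Int.mul_ediv_cancel_left _ hm', Int.toNat_natCast, Nat.lt_succ_iff]
      refine Nat.le_floor ?_
      rw [le_div_iff₀ hmr]
      have h1 := (abs_le.1 (hF _ hx)).2
      have h2 := (abs_le.1 (hF _ hx₀)).1
      push_cast at h1
      linarith
    · intro x hx y hy h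
      obtain ⟨j, rfl⟩ := key x hx
      obtain ⟨k, rfl⟩ := key y hy
      have hm' : (m : ℤ) ≠ 0 := by exact_mod_cast hm.ne'
      simp only [add_sub_cancel_left] at h
      rw [Int.mul_ediv_cancel_left _ hm', Int.mul_ediv_cancel_left _ hm', Int.toNat_natCast,
        Int.toNat_natCast] at h
      rw [h]
  rw [Finset.card_range] at hcard
  have h1 : (F.card : ℝ) ≤ ⌊2 * X / m⌋₊ + 1 := by exact_mod_cast hcard
  have h2 : (⌊2 * X / m⌋₊ : ℝ) ≤ 2 * X / m := Nat.floor_le (by positivity)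
  linarith

lemma card_column_le {T : ℝ} (hT : 0 ≤ T) {m : ℕ} (hm : 0 < m) {a c : ℤ} (ha : a ≠ 0) (hc : c ≠ 0)
    {S : Finset SL2Z} (hS : S ⊆ ballFin T) (hSa : ∀ γ ∈ S, γ 0 0 = a) (hSc : ∀ γ ∈ S, γ 1 0 = c)
    (hd : ∀ γ ∈ S, ∀ γ' ∈ S, (m * c : ℤ) ∣ γ 1 1 - γ' 1 1) :
    (S.card : ℝ) ≤ 1 + 2 * T / m * (1 / √a.natAbs * (1 / √c.natAbs)) := by
  classical
  have hmr : (0 : ℝ) < m := by exact_mod_cast hm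
  have ha' : (0 : ℝ) < a.natAbs := by exact_mod_cast Int.natAbs_pos.2 ha
  have hc' : (0 : ℝ) < c.natAbs := by exact_mod_cast Int.natAbs_pos.2 hc
  rcases S.eq_empty_or_nonempty with rfl | hne
  · simp only [Finset.card_empty, Nat.cast_zero]
    positivity
  have hdet : ∀ γ ∈ S, a * γ 1 1 - γ 0 1 * c = 1 := fun γ hγ => by
    rw [← hSa γ hγ, ← hSc γ hγ]; exact det_eq_one γ
  have hdb : ∀ γ ∈ S, ∀ γ' ∈ S, (m * a : ℤ) ∣ γ 0 1 - γ' 0 1 := fun γ hγ γ' hγ' => by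
    obtain ⟨j, hj⟩ := hd γ hγ γ' hγ'
    refine ⟨j, mul_right_cancel₀ hc ?_⟩
    linear_combination (hdet γ' hγ') - (hdet γ hγ) + a * hj
  have hinj_d : Set.InjOn (fun γ : SL2Z => γ 1 1) S := fun γ hγ γ' hγ' h => by
    dsimp only at h
    refine ext_entries ((hSa γ hγ).trans (hSa γ' hγ').symm) (mul_right_cancel₀ hc ?_)
      ((hSc γ hγ).trans (hSc γ' hγ').symm) h
    linear_combination (hdet γ' hγ') - (hdet γ hγ) + a * h
  have hinj_b : Set.InjOn (fun γ : SL2Z => γ 0 1) S := fun γ hγ γ' hγ' h => by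
    dsimp only at h
    refine ext_entries ((hSa γ hγ).trans (hSa γ' hγ').symm) h
      ((hSc γ hγ).trans (hSc γ' hγ').symm) (mul_left_cancel₀ ha ?_)
    linear_combination (hdet γ hγ) - (hdet γ' hγ') + c * h
  have h1 : (S.card : ℝ) - 1 ≤ 2 * T / (m * c.natAbs : ℕ) := by
    rw [← Finset.card_image_of_injOn hinj_d]
    refine card_sub_one_le_of_dvd_sub (Nat.mul_pos hm (Int.natAbs_pos.2 hc)) (hne.image _) ?_ ?_
    · intro x hx
      obtain ⟨γ, hγ, rfl⟩ := Finset.mem_image.1 hx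
      exact abs_entry_le hT (mem_ballFin.1 (hS hγ)) 1 1
    · intro x hx y hy
      obtain ⟨γ, hγ, rfl⟩ := Finset.mem_image.1 hx
      obtain ⟨γ', hγ', rfl⟩ := Finset.mem_image.1 hy
      have := hd γ hγ γ' hγ'
      rwa [← Int.natAbs_dvd, Int.natAbs_mul, Int.natAbs_natCast] at this
  have h2 : (S.card : ℝ) - 1 ≤ 2 * T / (m * a.natAbs : ℕ) := by
    rw [← Finset.card_image_of_injOn hinj_b]
    refine card_sub_one_le_of_dvd_sub (Nat.mul_pos hm (Int.natAbs_pos.2 ha)) (hne.image _) ?_ ?_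
    · intro x hx
      obtain ⟨γ, hγ, rfl⟩ := Finset.mem_image.1 hx
      exact abs_entry_le hT (mem_ballFin.1 (hS hγ)) 0 1
    · intro x hx y hy
      obtain ⟨γ, hγ, rfl⟩ := Finset.mem_image.1 hx
      obtain ⟨γ', hγ', rfl⟩ := Finset.mem_image.1 hy
      have := hdb γ hγ γ' hγ'
      rwa [← Int.natAbs_dvd, Int.natAbs_mul, Int.natAbs_natCast] at this
  have h0 : (0 : ℝ) ≤ (S.card : ℝ) - 1 := by
    have : (1 : ℝ) ≤ S.card := by exact_mod_cast hne.card_pos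
    linarith
  have h3 : (S.card : ℝ) - 1 ≤ 2 * T / m * (1 / √a.natAbs * (1 / √c.natAbs)) := by
    refine (pow_le_pow_iff_left₀ h0 (by positivity) two_ne_zero).1 ?_
    calc ((S.card : ℝ) - 1) ^ 2 = ((S.card : ℝ) - 1) * ((S.card : ℝ) - 1) := sq _
      _ ≤ 2 * T / (m * a.natAbs : ℕ) * (2 * T / (m * c.natAbs : ℕ)) :=
          mul_le_mul h2 h1 h0 (by positivity)
      _ = _ := by
          rw [mul_pow, mul_pow, div_pow, div_pow, div_pow, Real.sq_sqrt ha'.le, Real.sq_sqrt hc'.le]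
          push_cast
          field_simp
  linarith

lemma card_le_of_columns {T : ℝ} (hT : 0 ≤ T) {m : ℕ} (hm : 0 < m) {A C : Finset ℤ}
    (hA : ∀ a ∈ A, a ≠ 0) (hC : ∀ c ∈ C, c ≠ 0) {S : Finset SL2Z} (hS : S ⊆ ballFin T)
    (hSA : ∀ γ ∈ S, γ 0 0 ∈ A) (hSC : ∀ γ ∈ S, γ 1 0 ∈ C)
    (hd : ∀ γ ∈ S, ∀ γ' ∈ S, γ 0 0 = γ' 0 0 → γ 1 0 = γ' 1 0 →
      (m * γ 1 0 : ℤ) ∣ γ 1 1 - γ' 1 1) :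
    (S.card : ℝ) ≤ A.card * C.card +
      2 * T / m * ((∑ a ∈ A, 1 / √a.natAbs) * ∑ c ∈ C, 1 / √c.natAbs) := by
  classical
  have h1 : S.card = ∑ p ∈ A ×ˢ C, (S.filter fun γ : SL2Z => (γ 0 0, γ 1 0) = p).card :=
    Finset.card_eq_sum_card_fiberwise fun γ hγ =>
      Finset.mem_coe.2 (Finset.mem_product.2 ⟨hSA γ hγ, hSC γ hγ⟩)
  have h2 : ∀ p ∈ A ×ˢ C, ((S.filter fun γ : SL2Z => (γ 0 0, γ 1 0) = p).card : ℝ) ≤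
      1 + 2 * T / m * (1 / √p.1.natAbs * (1 / √p.2.natAbs)) := by
    rintro ⟨a, c⟩ hp
    obtain ⟨hpa, hpc⟩ := Finset.mem_product.1 hp
    have e : ∀ γ ∈ S.filter fun γ : SL2Z => (γ 0 0, γ 1 0) = (a, c),
        γ ∈ S ∧ γ 0 0 = a ∧ γ 1 0 = c :=
      fun γ hγ => by simpa [and_assoc] using hγ
    refine card_column_le hT hm (hA a hpa) (hC c hpc) ((Finset.filter_subset _ _).trans hS)
      (fun γ hγ => (e γ hγ).2.1) (fun γ hγ => (e γ hγ).2.2) fun γ hγ γ' hγ' => ?_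
    obtain ⟨g1, g2, g3⟩ := e γ hγ
    obtain ⟨g1', g2', g3'⟩ := e γ' hγ'
    rw [← g3]
    exact hd γ g1 γ' g1' (g2.trans g2'.symm) (g3.trans g3'.symm)
  rw [h1, Nat.cast_sum]
  refine (Finset.sum_le_sum h2).trans_eq ?_
  rw [Finset.sum_add_distrib, Finset.sum_const, Finset.card_product, ← Finset.mul_sum,
    Finset.sum_mul_sum, Finset.sum_product]
  simp

lemma sum_one_div_sqrt_le (n : ℕ) : ∑ j ∈ Finset.Icc 1 n, 1 / √(j : ℝ) ≤ 2 * √n := by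
  induction n with
  | zero => simp
  | succ n ih =>
    rw [Finset.sum_Icc_succ_top (by omega)]
    have h0 : (0 : ℝ) < √((n + 1 : ℕ) : ℝ) := Real.sqrt_pos.2 (by positivity)
    have h1 : √(n : ℝ) ^ 2 = n := Real.sq_sqrt (by positivity)
    have h2 : √((n + 1 : ℕ) : ℝ) ^ 2 = n + 1 := by rw [Real.sq_sqrt (by positivity)]; push_cast; rfl
    have h3 : 1 / √((n + 1 : ℕ) : ℝ) ≤ 2 * √((n + 1 : ℕ) : ℝ) - 2 * √n := by
      rw [div_le_iff₀ h0]
      nlinarith [sq_nonneg (√((n + 1 : ℕ) : ℝ) - √n)]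
    linarith

lemma sum_le_of_div_injOn {q : ℕ} (hq : 0 < q) {X : ℝ} (hX : 0 ≤ X) {F : Finset ℕ}
    (hF : ∀ x ∈ F, q ≤ x ∧ (x : ℝ) ≤ X) (hinj : Set.InjOn (fun x => x / q) (F : Set ℕ)) :
    (F.card : ℝ) ≤ X / q ∧ ∑ x ∈ F, 1 / √(x : ℝ) ≤ 2 * √X / q := by
  have hqr : (0 : ℝ) < q := by exact_mod_cast hq
  set n := ⌊X / q⌋₊
  have hn : (n : ℝ) ≤ X / q := Nat.floor_le (by positivity)
  have hmem : ∀ x ∈ F, x / q ∈ Finset.Icc 1 n := fun x hx => by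
    obtain ⟨h1, h2⟩ := hF x hx
    refine Finset.mem_Icc.2 ⟨(Nat.one_le_div_iff hq).2 h1, Nat.le_floor ?_⟩
    exact Nat.cast_div_le.trans (by gcongr)
  constructor
  · refine le_trans ?_ hn
    have := Finset.card_le_card_of_injOn _ hmem hinj
    rw [Nat.card_Icc, Nat.add_sub_cancel] at this
    exact_mod_cast this
  · calc ∑ x ∈ F, 1 / √(x : ℝ) ≤ ∑ x ∈ F, 1 / √q * (1 / √((x / q : ℕ) : ℝ)) := by
          refine Finset.sum_le_sum fun x hx => ?_
          have h1 : 0 < x / q := (Finset.mem_Icc.1 (hmem x hx)).1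
          have h1' : (0 : ℝ) < (x / q : ℕ) := by exact_mod_cast h1
          rw [one_div_mul_one_div, ← Real.sqrt_mul hqr.le]
          refine one_div_le_one_div_of_le (Real.sqrt_pos.2 (by positivity)) (Real.sqrt_le_sqrt ?_)
          exact_mod_cast Nat.mul_div_le x q
      _ = ∑ j ∈ F.image (fun x => x / q), 1 / √q * (1 / √(j : ℝ)) := by
          rw [Finset.sum_image hinj]
      _ ≤ ∑ j ∈ Finset.Icc 1 n, 1 / √q * (1 / √(j : ℝ)) := by
          refine Finset.sum_le_sum_of_subset_of_nonneg ?_ fun _ _ _ => by positivity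
          intro j hj
          obtain ⟨x, hx, rfl⟩ := Finset.mem_image.1 hj
          exact hmem x hx
      _ ≤ 1 / √q * (2 * √(X / q)) := by
          rw [← Finset.mul_sum]
          gcongr
          exact (sum_one_div_sqrt_le n).trans (by gcongr)
      _ = 2 * √X / q := by
          rw [Real.sqrt_div hX]
          have h1 : √(q : ℝ) * √q = q := Real.mul_self_sqrt hqr.le
          calc 1 / √(q : ℝ) * (2 * (√X / √q)) = 2 * √X / (√q * √q) := by ring
            _ = 2 * √X / q := by rw [h1]

lemma sum_le_of_class {q : ℕ} (hq : 0 < q) {X : ℝ} (hX : 0 ≤ X) {F : Finset ℕ} {r : ℤ}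
    (hF : ∀ x ∈ F, 1 ≤ x ∧ (x : ℝ) ≤ X) (hr : ∀ x ∈ F, (q : ℤ) ∣ x - r) :
    (F.card : ℝ) ≤ 1 + X / q ∧ ∑ x ∈ F, 1 / √(x : ℝ) ≤ 1 + 2 * √X / q := by
  classical
  have hinj : Set.InjOn (fun x => x / q) (F : Set ℕ) := fun x hx y hy h => by
    have h1 : (q : ℤ) ∣ x - y := by
      have := dvd_sub (hr x hx) (hr y hy)
      rwa [sub_sub_sub_cancel_right] at this
    have h2 : y % q = x % q := Nat.modEq_iff_dvd.2 h1
    dsimp only at h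
    rw [← Nat.div_add_mod x q, ← Nat.div_add_mod y q, h, h2]
  have hsmall : (F.filter fun x => x < q).card ≤ 1 := by
    refine Finset.card_le_one.2 fun x hx y hy => ?_
    obtain ⟨hx, hxq⟩ := Finset.mem_filter.1 hx
    obtain ⟨hy, hyq⟩ := Finset.mem_filter.1 hy
    refine hinj hx hy ?_
    dsimp only
    rw [Nat.div_eq_of_lt hxq, Nat.div_eq_of_lt hyq]
  have hsmall' : ((F.filter fun x => x < q).card : ℝ) ≤ 1 := by exact_mod_cast hsmall
  obtain ⟨h1, h2⟩ := sum_le_of_div_injOn hq hX (F := F.filter fun x => ¬x < q)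
    (fun x hx => by
      obtain ⟨hx, hxq⟩ := Finset.mem_filter.1 hx
      exact ⟨not_lt.1 hxq, (hF x hx).2⟩)
    (hinj.mono (Finset.coe_subset.2 (Finset.filter_subset _ _)))
  constructor
  · rw [← Finset.card_filter_add_card_filter_not (fun x => x < q), Nat.cast_add]
    linarith
  · rw [← Finset.sum_filter_add_sum_filter_not F (fun x => x < q)]
    have h3 : ∑ x ∈ F with x < q, 1 / √(x : ℝ) ≤ ∑ x ∈ F with x < q, 1 := by
      refine Finset.sum_le_sum fun x hx => ?_
      have h4 : (1 : ℝ) ≤ x := by exact_mod_cast (hF x (Finset.mem_filter.1 hx).1).1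
      rw [div_le_one (by positivity)]
      exact Real.one_le_sqrt.2 h4
    rw [Finset.sum_const, nsmul_eq_mul, mul_one] at h3
    linarith

lemma sum_natAbs_le {A : Finset ℤ} {F : Finset ℕ} (g : ℕ → ℝ) (hg : ∀ x, 0 ≤ g x)
    (hA : ∀ a ∈ A, a.natAbs ∈ F) : ∑ a ∈ A, g a.natAbs ≤ 2 * ∑ x ∈ F, g x := by
  classical
  have key : ∀ B ⊆ A, Set.InjOn Int.natAbs (B : Set ℤ) → ∑ a ∈ B, g a.natAbs ≤ ∑ x ∈ F, g x := by
    intro B hB hinj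
    rw [← Finset.sum_image hinj]
    refine Finset.sum_le_sum_of_subset_of_nonneg ?_ fun _ _ _ => hg _
    intro x hx
    obtain ⟨a, ha, rfl⟩ := Finset.mem_image.1 hx
    exact hA a (hB ha)
  rw [← Finset.sum_filter_add_sum_filter_not A (fun a => 0 ≤ a), two_mul]
  refine add_le_add (key _ (Finset.filter_subset _ _) ?_) (key _ (Finset.filter_subset _ _) ?_)
  · intro x hx y hy h
    simp only [Finset.coe_filter, Set.mem_ofPred_eq] at hx hy
    omega
  · intro x hx y hy h
    simp only [Finset.coe_filter, Set.mem_ofPred_eq] at hx hy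
    omega

lemma entry_mem_Icc {T : ℝ} (hT : 0 ≤ T) {γ : SL2Z} (h : γ ∈ ballFin T) (i j : Fin 2) :
    γ i j ∈ Finset.Icc (-⌊T⌋₊ : ℤ) ⌊T⌋₊ := by
  have h1 := abs_entry_le hT (mem_ballFin.1 h) i j
  have h2 : (γ i j).natAbs ≤ ⌊T⌋₊ := Nat.le_floor (by rwa [Nat.cast_natAbs, Int.cast_abs])
  rw [Finset.mem_Icc]
  omega

lemma card_le_of_unit_entry {T : ℝ} (hT : 1 ≤ T) {S : Finset SL2Z} (hS : S ⊆ ballFin T)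
    (i j k l : Fin 2) (hij : ∀ γ ∈ S, γ i j = 1 ∨ γ i j = -1)
    (hinj : Set.InjOn (fun γ : SL2Z => (γ i j, γ k l)) S) : (S.card : ℝ) ≤ 6 * T := by
  have h1 : S.card ≤ (({1, -1} : Finset ℤ) ×ˢ Finset.Icc (-⌊T⌋₊ : ℤ) ⌊T⌋₊).card := by
    refine Finset.card_le_card_of_injOn _ (fun γ hγ => ?_) hinj
    refine Finset.mem_coe.2 (Finset.mem_product.2 ⟨?_, entry_mem_Icc (by linarith) (hS hγ) k l⟩)
    simpa using hij γ hγ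
  rw [Finset.card_product, Int.card_Icc, Finset.card_pair (by norm_num)] at h1
  have h2 : S.card ≤ 2 * (2 * ⌊T⌋₊ + 1) := h1.trans (by omega)
  have h3 : (⌊T⌋₊ : ℝ) ≤ T := Nat.floor_le (by linarith)
  have h4 : (S.card : ℝ) ≤ 2 * (2 * ⌊T⌋₊ + 1) := by exact_mod_cast h2
  linarith

lemma card_lower_left_eq_zero_le {T : ℝ} (hT : 1 ≤ T) :
    (((ballFin T).filter fun γ : SL2Z => γ 1 0 = 0).card : ℝ) ≤ 6 * T := by
  have hu : ∀ γ : SL2Z, γ 1 0 = 0 → γ 0 0 * γ 1 1 = 1 := fun γ h => by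
    have := det_eq_one γ
    rwa [h, mul_zero, sub_zero] at this
  refine card_le_of_unit_entry hT (Finset.filter_subset _ _) 0 0 0 1 (fun γ hγ => ?_) ?_
  · exact Int.isUnit_iff.1 (IsUnit.of_mul_eq_one _ (hu γ (Finset.mem_filter.1 hγ).2))
  · intro γ hγ γ' hγ' h
    have h0 := (Finset.mem_filter.1 hγ).2
    have h0' := (Finset.mem_filter.1 hγ').2
    obtain ⟨h1, h2⟩ := Prod.mk.inj h
    refine ext_entries h1 h2 (h0.trans h0'.symm) ?_
    have e := hu γ h0
    have e' := hu γ' h0'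
    rw [← h1] at e'
    exact mul_left_cancel₀ (left_ne_zero_of_mul_eq_one e) (e.trans e'.symm)

lemma card_upper_right_eq_zero_le {T : ℝ} (hT : 1 ≤ T) :
    (((ballFin T).filter fun γ : SL2Z => γ 0 1 = 0).card : ℝ) ≤ 6 * T := by
  have hu : ∀ γ : SL2Z, γ 0 1 = 0 → γ 0 0 * γ 1 1 = 1 := fun γ h => by
    have := det_eq_one γ
    rwa [h, zero_mul, sub_zero] at this
  refine card_le_of_unit_entry hT (Finset.filter_subset _ _) 0 0 1 0 (fun γ hγ => ?_) ?_
  · exact Int.isUnit_iff.1 (IsUnit.of_mul_eq_one _ (hu γ (Finset.mem_filter.1 hγ).2))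
  · intro γ hγ γ' hγ' h
    have h0 := (Finset.mem_filter.1 hγ).2
    have h0' := (Finset.mem_filter.1 hγ').2
    obtain ⟨h1, h2⟩ := Prod.mk.inj h
    refine ext_entries h1 (h0.trans h0'.symm) h2 ?_
    have e := hu γ h0
    have e' := hu γ' h0'
    rw [← h1] at e'
    exact mul_left_cancel₀ (left_ne_zero_of_mul_eq_one e) (e.trans e'.symm)

lemma card_upper_left_eq_zero_le {T : ℝ} (hT : 1 ≤ T) :
    (((ballFin T).filter fun γ : SL2Z => γ 0 0 = 0).card : ℝ) ≤ 6 * T := by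
  have hu : ∀ γ : SL2Z, γ 0 0 = 0 → γ 1 0 * -γ 0 1 = 1 := fun γ h => by
    have := det_eq_one γ
    rw [h] at this
    linarith
  refine card_le_of_unit_entry hT (Finset.filter_subset _ _) 1 0 1 1 (fun γ hγ => ?_) ?_
  · exact Int.isUnit_iff.1 (IsUnit.of_mul_eq_one _ (hu γ (Finset.mem_filter.1 hγ).2))
  · intro γ hγ γ' hγ' h
    have h0 := (Finset.mem_filter.1 hγ).2
    have h0' := (Finset.mem_filter.1 hγ').2
    obtain ⟨h1, h2⟩ := Prod.mk.inj h
    refine ext_entries (h0.trans h0'.symm) ?_ h1 h2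
    have e := hu γ h0
    have e' := hu γ' h0'
    rw [← h1] at e'
    exact neg_injective (mul_left_cancel₀ (left_ne_zero_of_mul_eq_one e) (e.trans e'.symm))

/-- The nonzero integers of absolute value at most `X`. -/
def punctured (X : ℝ) : Finset ℤ := (Finset.Icc (-⌊X⌋₊ : ℤ) ⌊X⌋₊).filter (· ≠ 0)

lemma natAbs_of_mem_punctured {X : ℝ} (hX : 0 ≤ X) {a : ℤ} (ha : a ∈ punctured X) :
    a.natAbs ∈ Finset.Icc 1 ⌊X⌋₊ ∧ (a.natAbs : ℝ) ≤ X := by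
  obtain ⟨h1, h2⟩ := Finset.mem_filter.1 ha
  rw [Finset.mem_Icc] at h1
  have h3 : a.natAbs ≤ ⌊X⌋₊ := by omega
  refine ⟨Finset.mem_Icc.2 ⟨by omega, h3⟩, (Nat.le_floor_iff hX).1 h3⟩

lemma card_and_sum_of_subset_punctured {X : ℝ} (hX : 0 ≤ X) {p : ℕ} (hp : 0 < p) {A : Finset ℤ}
    (hA : A ⊆ punctured X) (hd : ∀ a ∈ A, (p : ℤ) ∣ a) :
    (A.card : ℝ) ≤ 2 * (X / p) ∧ ∑ a ∈ A, 1 / √(a.natAbs : ℝ) ≤ 2 * (2 * √X / p) := by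
  classical
  set F := A.image Int.natAbs
  have hF : ∀ x ∈ F, p ∣ x ∧ 0 < x ∧ (x : ℝ) ≤ X := fun x hx => by
    obtain ⟨a, ha, rfl⟩ := Finset.mem_image.1 hx
    obtain ⟨h1, h2⟩ := natAbs_of_mem_punctured hX (hA ha)
    exact ⟨Int.natCast_dvd.1 (hd a ha), (Finset.mem_Icc.1 h1).1, h2⟩
  obtain ⟨h1, h2⟩ := sum_le_of_div_injOn hp hX (F := F)
    (fun x hx => ⟨Nat.le_of_dvd (hF x hx).2.1 (hF x hx).1, (hF x hx).2.2⟩) (by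
      intro x hx y hy h
      dsimp only at h
      rw [← Nat.div_mul_cancel (hF x hx).1, h, Nat.div_mul_cancel (hF y hy).1])
  have hAF : ∀ a ∈ A, a.natAbs ∈ F := fun a ha => Finset.mem_image_of_mem _ ha
  constructor
  · have := sum_natAbs_le (fun _ => (1 : ℝ)) (fun _ => zero_le_one) hAF
    simp only [Finset.sum_const, nsmul_eq_mul, mul_one] at this
    linarith
  · have := sum_natAbs_le (fun x => 1 / √(x : ℝ)) (fun _ => by positivity) hAF
    linarith

lemma card_lower_left_le {T δ : ℝ} (hT : 1 ≤ T) (hδ : 0 ≤ δ) (hδ1 : δ ≤ 1) :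
    (((ballFin T).filter fun γ : SL2Z => |(γ 1 0 : ℝ)| ≤ δ * T).card : ℝ) ≤
      36 * √δ * T ^ 2 + 12 * T := by
  classical
  have hT0 : 0 ≤ T := by linarith
  set S := (ballFin T).filter fun γ : SL2Z => |(γ 1 0 : ℝ)| ≤ δ * T ∧ γ 0 0 ≠ 0 ∧ γ 1 0 ≠ 0
  have hsub : ((ballFin T).filter fun γ : SL2Z => |(γ 1 0 : ℝ)| ≤ δ * T) ⊆
      S ∪ (((ballFin T).filter fun γ : SL2Z => γ 0 0 = 0) ∪
        (ballFin T).filter fun γ : SL2Z => γ 1 0 = 0) := by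
    intro γ hγ
    simp only [S, Finset.mem_union, Finset.mem_filter] at hγ ⊢
    tauto
  have hSmem : ∀ γ ∈ S, γ ∈ ballFin T ∧ |(γ 1 0 : ℝ)| ≤ δ * T ∧ γ 0 0 ≠ 0 ∧ γ 1 0 ≠ 0 :=
    fun γ hγ => Finset.mem_filter.1 hγ
  obtain ⟨a1, a2⟩ := card_and_sum_of_subset_punctured hT0 one_pos (Finset.Subset.refl _)
    fun _ _ => by simp
  obtain ⟨c1, c2⟩ := card_and_sum_of_subset_punctured (mul_nonneg hδ hT0) one_pos
    (Finset.Subset.refl _) fun _ _ => by simp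
  have hne : ∀ X : ℝ, ∀ a ∈ punctured X, a ≠ 0 := fun X a ha => (Finset.mem_filter.1 ha).2
  have h1 := card_le_of_columns hT0 one_pos (hne T) (hne (δ * T)) (S := S)
    (Finset.filter_subset _ _)
    (fun γ hγ => Finset.mem_filter.2 ⟨entry_mem_Icc hT0 (hSmem γ hγ).1 0 0, (hSmem γ hγ).2.2.1⟩)
    (fun γ hγ => by
      have h2 : (γ 1 0).natAbs ≤ ⌊δ * T⌋₊ := Nat.le_floor (by
        rw [Nat.cast_natAbs, Int.cast_abs]; exact (hSmem γ hγ).2.1)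
      refine Finset.mem_filter.2 ⟨?_, (hSmem γ hγ).2.2.2⟩
      rw [Finset.mem_Icc]
      omega)
    (fun γ hγ γ' hγ' h00 h10 => by
      have e := det_eq_one γ
      have e' := det_eq_one γ'
      rw [← h00, ← h10] at e'
      have hcop : IsCoprime (γ 1 0) (γ 0 0) := ⟨-γ 0 1, γ 1 1, by linarith⟩
      rw [Nat.cast_one, one_mul]
      exact hcop.dvd_of_dvd_mul_left ⟨γ 0 1 - γ' 0 1, by linear_combination e - e'⟩)
  have h0 := card_upper_left_eq_zero_le hT
  have h0' := card_lower_left_eq_zero_le hT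
  have hcard : (((ballFin T).filter fun γ : SL2Z => |(γ 1 0 : ℝ)| ≤ δ * T).card : ℝ) ≤
      S.card + (((ballFin T).filter fun γ : SL2Z => γ 0 0 = 0).card +
        ((ballFin T).filter fun γ : SL2Z => γ 1 0 = 0).card) := by
    exact_mod_cast (Finset.card_le_card hsub).trans ((Finset.card_union_le _ _).trans
      (Nat.add_le_add_left (Finset.card_union_le _ _) _))
  have hS : (S.card : ℝ) ≤ 36 * √δ * T ^ 2 := by
    refine h1.trans ?_
    simp only [Nat.cast_one, div_one] at a1 a2 c1 c2 ⊢
    have hδs : δ ≤ √δ := Real.le_sqrt_of_sq_le (by nlinarith)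
    have hTT : √T * √T = T := Real.mul_self_sqrt hT0
    calc _ ≤ 2 * T * (2 * (δ * T)) + 2 * T * ((2 * (2 * √T)) * (2 * (2 * √(δ * T)))) := by
          gcongr
      _ = 4 * δ * T ^ 2 + 32 * √δ * T * (√T * √T) := by rw [Real.sqrt_mul hδ]; ring
      _ = 4 * δ * T ^ 2 + 32 * √δ * T ^ 2 := by rw [hTT]; ring
      _ ≤ 4 * √δ * T ^ 2 + 32 * √δ * T ^ 2 := by gcongr
      _ = _ := by ring
  linarith

lemma dvd_uGamma_iff (p : ℕ) (γ : SL2Z) :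
    p ∣ uGamma γ ↔ (p : ℤ) ∣ γ 1 0 ∧ (p : ℤ) ∣ γ 1 1 - γ 0 0 ∧ (p : ℤ) ∣ γ 0 1 := by
  rw [uGamma, Int.dvd_gcd_iff, Int.natCast_dvd_natCast, Int.dvd_gcd_iff]

lemma card_dvd_uGamma_le {T : ℝ} (hT : 1 ≤ T) {p : ℕ} (hp : p.Prime) :
    (((ballFin T).filter fun γ : SL2Z => γ 1 0 ≠ 0 ∧ p ∣ uGamma γ).card : ℝ) ≤
      112 * T ^ 2 / p ^ 2 := by
  classical
  have hT0 : 0 ≤ T := by linarith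
  have hp1 : (1 : ℝ) ≤ p := by exact_mod_cast hp.one_lt.le
  have hpZ : Prime (p : ℤ) := Nat.prime_iff_prime_int.1 hp
  set S := (ballFin T).filter fun γ : SL2Z => γ 1 0 ≠ 0 ∧ p ∣ uGamma γ
  have hSmem : ∀ γ ∈ S, γ ∈ ballFin T ∧ γ 1 0 ≠ 0 ∧ (p : ℤ) ∣ γ 1 0 ∧ (p : ℤ) ∣ γ 1 1 - γ 0 0 ∧
      (p : ℤ) ∣ γ 0 1 := fun γ hγ => by
    obtain ⟨h1, h2, h3⟩ := Finset.mem_filter.1 hγ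
    exact ⟨h1, h2, (dvd_uGamma_iff p γ).1 h3⟩
  rcases lt_or_ge T p with hTp | hpT
  · have : S = ∅ := by
      refine Finset.eq_empty_of_forall_notMem fun γ hγ => ?_
      obtain ⟨h1, h2, h3, -⟩ := hSmem γ hγ
      have h4 := abs_entry_le hT0 (mem_ballFin.1 h1) 1 0
      have h5 : (p : ℤ) ≤ |γ 1 0| := Int.le_of_dvd (abs_pos.2 h2) ((dvd_abs _ _).2 h3)
      have h6 : (p : ℝ) ≤ |(γ 1 0 : ℝ)| := by exact_mod_cast h5
      linarith
    rw [this, Finset.card_empty, Nat.cast_zero]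
    positivity
  have hnd : ∀ γ ∈ S, ¬(p : ℤ) ∣ γ 0 0 := fun γ hγ h => by
    obtain ⟨-, -, h3, -, -⟩ := hSmem γ hγ
    refine hpZ.not_dvd_one ?_
    rw [← det_eq_one γ]
    exact dvd_sub (h.mul_right _) (h3.mul_left _)
  have hclass : ∀ γ ∈ S, (p : ℤ) ∣ γ 0 0 - 1 ∨ (p : ℤ) ∣ γ 0 0 + 1 := fun γ hγ => by
    obtain ⟨-, -, h3, h4, -⟩ := hSmem γ hγ
    refine hpZ.dvd_or_dvd ?_
    have e : (γ 0 0 - 1) * (γ 0 0 + 1) = γ 0 1 * γ 1 0 - γ 0 0 * (γ 1 1 - γ 0 0) := by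
      linear_combination det_eq_one γ
    rw [e]
    exact dvd_sub (h3.mul_left _) (h4.mul_left _)
  set A := (punctured T).filter fun a => (p : ℤ) ∣ a - 1 ∨ (p : ℤ) ∣ a + 1
  set C := (punctured T).filter fun c => (p : ℤ) ∣ c
  have hne : ∀ a ∈ punctured T, a ≠ 0 := fun a ha => (Finset.mem_filter.1 ha).2
  have h1 := card_le_of_columns hT0 hp.pos (A := A) (C := C)
    (fun a ha => hne a (Finset.mem_filter.1 ha).1) (fun a ha => hne a (Finset.mem_filter.1 ha).1)
    (S := S) (Finset.filter_subset _ _)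
    (fun γ hγ => Finset.mem_filter.2 ⟨Finset.mem_filter.2 ⟨entry_mem_Icc hT0 (hSmem γ hγ).1 0 0,
      fun h => hnd γ hγ (h ▸ dvd_zero _)⟩, hclass γ hγ⟩)
    (fun γ hγ => Finset.mem_filter.2 ⟨Finset.mem_filter.2 ⟨entry_mem_Icc hT0 (hSmem γ hγ).1 1 0,
      (hSmem γ hγ).2.1⟩, (hSmem γ hγ).2.2.1⟩)
    (fun γ hγ γ' hγ' h00 h10 => by
      have e := det_eq_one γ
      have e' := det_eq_one γ'
      rw [← h00, ← h10] at e'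
      have hcop : IsCoprime (γ 1 0) (γ 0 0) := ⟨-γ 0 1, γ 1 1, by linarith⟩
      obtain ⟨k, hk⟩ : γ 1 0 ∣ γ 1 1 - γ' 1 1 :=
        hcop.dvd_of_dvd_mul_left ⟨γ 0 1 - γ' 0 1, by linear_combination e - e'⟩
      have hb : γ 0 1 - γ' 0 1 = γ 0 0 * k := mul_right_cancel₀ (hSmem γ hγ).2.1 (by
        linear_combination e' - e + γ 0 0 * hk)
      have hpk : (p : ℤ) ∣ γ 0 0 * k := by
        rw [← hb]
        exact dvd_sub (hSmem γ hγ).2.2.2.2 (hSmem γ' hγ').2.2.2.2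
      obtain ⟨j, rfl⟩ := (hpZ.dvd_or_dvd hpk).resolve_left (hnd γ hγ)
      exact ⟨j, by rw [hk]; ring⟩)
  obtain ⟨c1, c2⟩ := card_and_sum_of_subset_punctured (A := C) hT0 hp.pos
    (Finset.filter_subset _ _) fun c hc => (Finset.mem_filter.1 hc).2
  set F : ℤ → Finset ℕ := fun r => (Finset.Icc 1 ⌊T⌋₊).filter fun x => (p : ℤ) ∣ x - r
  have hF : ∀ r : ℤ, ((F r).card : ℝ) ≤ 1 + T / p ∧
      ∑ x ∈ F r, 1 / √(x : ℝ) ≤ 1 + 2 * √T / p := fun r =>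
    sum_le_of_class hp.pos hT0 (fun x hx => by
      have := Finset.mem_Icc.1 (Finset.mem_filter.1 hx).1
      exact ⟨this.1, (Nat.le_floor_iff hT0).1 this.2⟩) fun x hx => (Finset.mem_filter.1 hx).2
  have hAF : ∀ a ∈ A, a.natAbs ∈ F 1 ∪ F (-1) := fun a ha => by
    obtain ⟨ha, hcl⟩ := Finset.mem_filter.1 ha
    have hI := (natAbs_of_mem_punctured hT0 ha).1
    simp only [F, Finset.mem_union, Finset.mem_filter, hI, true_and]
    rcases Int.natAbs_eq a with h | h
    · rw [← h, sub_neg_eq_add]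
      exact hcl
    · have h' : (a.natAbs : ℤ) = -a := by omega
      rw [h', ← dvd_neg (b := -a - 1), ← dvd_neg (b := -a - -1)]
      have e1 : -(-a - 1) = a + 1 := by ring
      have e2 : -(-a - -1) = a - 1 := by ring
      rw [e1, e2]
      exact hcl.symm
  have a1 : (A.card : ℝ) ≤ 4 * (1 + T / p) := by
    have h2 := sum_natAbs_le (fun _ => (1 : ℝ)) (fun _ => zero_le_one) hAF
    simp only [Finset.sum_const, nsmul_eq_mul, mul_one] at h2
    have h3 : ((F 1 ∪ F (-1)).card : ℝ) ≤ (F 1).card + (F (-1)).card := by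
      exact_mod_cast Finset.card_union_le _ _
    linarith [(hF 1).1, (hF (-1)).1]
  have a2 : ∑ a ∈ A, 1 / √(a.natAbs : ℝ) ≤ 4 * (1 + 2 * √T / p) := by
    have h2 := sum_natAbs_le (fun x => 1 / √(x : ℝ)) (fun _ => by positivity) hAF
    have h3 : ∑ x ∈ F 1 ∪ F (-1), 1 / √(x : ℝ) ≤
        ∑ x ∈ F 1, 1 / √(x : ℝ) + ∑ x ∈ F (-1), 1 / √(x : ℝ) := by
      rw [← Finset.sum_union_inter]
      exact le_add_of_nonneg_right (Finset.sum_nonneg fun _ _ => by positivity)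
    linarith [(hF 1).2, (hF (-1)).2]
  refine h1.trans ?_
  have hTT : √T * √T = T := Real.mul_self_sqrt hT0
  have hs1 : √T ≤ T := Real.sqrt_le_self_iff.2 (Or.inr hT)
  have hx1 : 1 ≤ T / p := (one_le_div (by linarith)).2 hpT
  have hxs : T / p / p ≤ T / p := div_le_self (by positivity) hp1
  calc _ ≤ 4 * (1 + T / p) * (2 * (T / p)) +
        2 * T / p * ((4 * (1 + 2 * √T / p)) * (2 * (2 * √T / p))) := by gcongr
    _ = 8 * (T / p) * 1 + 8 * (T / p) ^ 2 + 32 * (T / p) * (√T / p) +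
        64 * (T / p) * ((√T * √T) / p / p) := by ring
    _ ≤ 8 * (T / p) * (T / p) + 8 * (T / p) ^ 2 + 32 * (T / p) * (T / p) +
        64 * (T / p) * (T / p) := by
      rw [hTT]
      gcongr
    _ = 112 * T ^ 2 / p ^ 2 := by ring

lemma card_not_hyperbolic_le {T : ℝ} (hT : 1 ≤ T) :
    (((ballFin T).filter fun γ : SL2Z => |trZ γ| ≤ 2).card : ℝ) ≤
      (30 * 41 ^ 4 + 12) * (T * √T) := by
  classical
  have hT0 : 0 ≤ T := by linarith
  set S := (ballFin T).filter fun γ : SL2Z => |trZ γ| ≤ 2 ∧ γ 0 1 ≠ 0 ∧ γ 1 0 ≠ 0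
  have hsub : ((ballFin T).filter fun γ : SL2Z => |trZ γ| ≤ 2) ⊆
      S ∪ (((ballFin T).filter fun γ : SL2Z => γ 0 1 = 0) ∪
        (ballFin T).filter fun γ : SL2Z => γ 1 0 = 0) := by
    intro γ hγ
    simp only [S, Finset.mem_union, Finset.mem_filter] at hγ ⊢
    tauto
  have hcard : (((ballFin T).filter fun γ : SL2Z => |trZ γ| ≤ 2).card : ℝ) ≤
      S.card + (((ballFin T).filter fun γ : SL2Z => γ 0 1 = 0).card +
        ((ballFin T).filter fun γ : SL2Z => γ 1 0 = 0).card) := by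
    exact_mod_cast (Finset.card_le_card hsub).trans ((Finset.card_union_le _ _).trans
      (Nat.add_le_add_left (Finset.card_union_le _ _) _))
  have h0 := card_upper_right_eq_zero_le hT
  have h0' := card_lower_left_eq_zero_le hT
  have hSmem : ∀ γ ∈ S, γ ∈ ballFin T ∧ |trZ γ| ≤ 2 ∧ γ 0 1 ≠ 0 ∧ γ 1 0 ≠ 0 :=
    fun γ hγ => Finset.mem_filter.1 hγ
  set P := Finset.Icc (-⌊T⌋₊ : ℤ) ⌊T⌋₊ ×ˢ Finset.Icc (-2 : ℤ) 2
  have h1 : S.card = ∑ p ∈ P, (S.filter fun γ : SL2Z => (γ 0 0, trZ γ) = p).card :=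
    Finset.card_eq_sum_card_fiberwise fun γ hγ => Finset.mem_coe.2 (Finset.mem_product.2
      ⟨entry_mem_Icc hT0 (hSmem γ hγ).1 0 0, Finset.mem_Icc.2 (abs_le.1 (hSmem γ hγ).2.1)⟩)
  have h2 : ∀ p ∈ P, ((S.filter fun γ : SL2Z => (γ 0 0, trZ γ) = p).card : ℝ) ≤
      2 * (41 ^ 4 * √T) := by
    rintro ⟨a, t⟩ -
    set R := S.filter fun γ : SL2Z => (γ 0 0, trZ γ) = (a, t)
    have hR : ∀ γ ∈ R, γ ∈ S ∧ γ 0 0 = a ∧ trZ γ = t := fun γ hγ => by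
      simpa [R, and_assoc] using hγ
    set n := a * (t - a) - 1
    have hn : ∀ γ ∈ R, γ 0 1 * γ 1 0 = n := fun γ hγ => by
      obtain ⟨-, g1, g2⟩ := hR γ hγ
      have := det_eq_one γ
      have h11 : γ 1 1 = t - a := by rw [← g2, ← g1, trZ]; ring
      rw [g1, h11] at this
      linarith
    rcases R.eq_empty_or_nonempty with hR0 | ⟨γ₀, hγ₀⟩
    · rw [hR0, Finset.card_empty, Nat.cast_zero]
      positivity
    have hn0 : n.natAbs ≠ 0 := by
      rw [Int.natAbs_ne_zero, ← hn γ₀ hγ₀]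
      exact mul_ne_zero (hSmem γ₀ (hR γ₀ hγ₀).1).2.2.1 (hSmem γ₀ (hR γ₀ hγ₀).1).2.2.2
    have hinj : Set.InjOn (fun γ : SL2Z => γ 1 0) R := by
      intro γ hγ γ' hγ' h
      dsimp only at h
      obtain ⟨g0, g1, g2⟩ := hR γ hγ
      obtain ⟨g0', g1', g2'⟩ := hR γ' hγ'
      refine ext_entries (g1.trans g1'.symm) (mul_right_cancel₀ (hSmem γ g0).2.2.2 ?_) h ?_
      · rw [hn γ hγ, h, hn γ' hγ']
      · rw [trZ] at g2 g2'
        linarith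
    have hdiv : ∀ c ∈ R.image (fun γ : SL2Z => γ 1 0), c.natAbs ∈ n.natAbs.divisors := by
      intro c hc
      obtain ⟨γ, hγ, rfl⟩ := Finset.mem_image.1 hc
      rw [Nat.mem_divisors]
      refine ⟨Int.natAbs_dvd_natAbs.2 ?_, hn0⟩
      rw [← hn γ hγ]
      exact dvd_mul_left _ _
    have h3 := sum_natAbs_le (fun _ => (1 : ℝ)) (fun _ => zero_le_one) hdiv
    simp only [Finset.sum_const, nsmul_eq_mul, mul_one] at h3
    rw [Finset.card_image_of_injOn hinj] at h3
    refine h3.trans (mul_le_mul_of_nonneg_left ?_ two_pos.le)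
    refine (pow_le_pow_iff_left₀ (by positivity) (by positivity) four_ne_zero).1 ?_
    have h4 : ((n.natAbs.divisors.card : ℝ)) ^ 4 ≤ 41 ^ 16 * n.natAbs := by
      exact_mod_cast card_divisors_pow_four_le hn0
    have h5 : (n.natAbs : ℝ) ≤ T ^ 2 := by
      rw [← hn γ₀ hγ₀, Int.natAbs_mul, Nat.cast_mul, Nat.cast_natAbs, Nat.cast_natAbs, Int.cast_abs,
        Int.cast_abs, sq]
      have := mem_ballFin.1 (hSmem γ₀ (hR γ₀ hγ₀).1).1
      exact mul_le_mul (abs_entry_le hT0 this 0 1) (abs_entry_le hT0 this 1 0) (abs_nonneg _) hT0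
    have h6 : √T ^ 4 = T ^ 2 := by
      rw [show (4 : ℕ) = 2 * 2 from rfl, pow_mul, Real.sq_sqrt hT0]
    rw [mul_pow, h6, ← pow_mul]
    exact h4.trans (by gcongr)
  have h3 : (S.card : ℝ) ≤ P.card * (2 * (41 ^ 4 * √T)) := by
    rw [h1, Nat.cast_sum, ← nsmul_eq_mul]
    exact Finset.sum_le_card_nsmul _ _ _ h2
  have h4 : (P.card : ℝ) ≤ 15 * T := by
    have h5 : P.card = (2 * ⌊T⌋₊ + 1) * 5 := by
      rw [Finset.card_product, Int.card_Icc, Int.card_Icc]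
      congr 1
      omega
    have h6 : (⌊T⌋₊ : ℝ) ≤ T := Nat.floor_le hT0
    rw [h5]
    push_cast
    linarith
  have h7 : 1 ≤ √T := Real.one_le_sqrt.2 hT
  have h8 : (P.card : ℝ) * (2 * (41 ^ 4 * √T)) ≤ 15 * T * (2 * (41 ^ 4 * √T)) := by gcongr
  have h9 : T ≤ T * √T := le_mul_of_one_le_right hT0 h7
  linarith

lemma exists_entries_of_isCoprime {a c M : ℤ} (ha : 1 ≤ a) (hc : 1 ≤ c) (haM : a ≤ M) (hcM : c ≤ M)
    (h : IsCoprime a c) :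
    ∃ γ : SL2Z, γ 0 0 = a ∧ γ 1 0 = c ∧ |γ 0 1| ≤ M ∧ |γ 1 1| ≤ M := by
  obtain ⟨u, v, huv⟩ := h
  have hdiv := Int.emod_add_mul_ediv u c
  have h0 := Int.emod_nonneg u (by omega : c ≠ 0)
  have h1 := Int.emod_lt_of_pos u (by omega : 0 < c)
  set d := u % c
  set q := u / c
  have hb : a * d - -(v + a * q) * c = 1 := by linear_combination huv + a * hdiv
  refine ⟨mkSL a (-(v + a * q)) c d hb, by simp [mkSL], by simp [mkSL], ?_, ?_⟩
  · have e : (mkSL a (-(v + a * q)) c d hb) 0 1 = -(v + a * q) := by simp [mkSL]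
    rw [e]
    set b := -(v + a * q)
    refine abs_le.2 ⟨?_, ?_⟩
    · by_contra! hlt
      nlinarith [mul_nonneg (by omega : 0 ≤ a) h0]
    · by_contra! hlt
      nlinarith
  · have e : (mkSL a (-(v + a * q)) c d hb) 1 1 = d := by simp [mkSL]
    rw [e, abs_of_nonneg h0]
    omega

lemma card_coprime_ge (M : ℕ) :
    (M : ℝ) ^ 2 / 4 ≤ (((Finset.Icc 1 M ×ˢ Finset.Icc 1 M).filter
      fun x => Nat.Coprime x.1 x.2).card : ℝ) := by
  classical
  set P := Finset.Icc 1 M ×ˢ Finset.Icc 1 M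
  have hP : ∀ x ∈ P, (1 ≤ x.1 ∧ x.1 ≤ M) ∧ 1 ≤ x.2 ∧ x.2 ≤ M := fun x hx => by simpa [P] using hx
  have hfib : ∀ n, 1 ≤ n → ((P.filter fun x => Nat.gcd x.1 x.2 = n).card : ℝ) ≤
      (M : ℝ) ^ 2 * (1 / (n : ℝ) ^ 2) := fun n hn => by
    have h1 : (P.filter fun x => Nat.gcd x.1 x.2 = n).card ≤
        (Finset.Icc 1 (M / n) ×ˢ Finset.Icc 1 (M / n)).card := by
      refine Finset.card_le_card_of_injOn (fun x => (x.1 / n, x.2 / n)) ?_ ?_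
      · intro x hx
        obtain ⟨hx, hg⟩ := Finset.mem_filter.1 hx
        obtain ⟨⟨a1, a2⟩, b1, b2⟩ := hP x hx
        have d1 : n ∣ x.1 := hg ▸ Nat.gcd_dvd_left _ _
        have d2 : n ∣ x.2 := hg ▸ Nat.gcd_dvd_right _ _
        simp only [Finset.coe_product, Finset.coe_Icc, Set.mem_prod, Set.mem_Icc]
        exact ⟨⟨Nat.div_pos (Nat.le_of_dvd a1 d1) hn, Nat.div_le_div_right a2⟩,
          Nat.div_pos (Nat.le_of_dvd b1 d2) hn, Nat.div_le_div_right b2⟩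
      · intro x hx y hy hxy
        obtain ⟨-, hg⟩ := Finset.mem_filter.1 hx
        obtain ⟨-, hg'⟩ := Finset.mem_filter.1 hy
        have d1 : n ∣ x.1 := hg ▸ Nat.gcd_dvd_left _ _
        have d2 : n ∣ x.2 := hg ▸ Nat.gcd_dvd_right _ _
        have d1' : n ∣ y.1 := hg' ▸ Nat.gcd_dvd_left _ _
        have d2' : n ∣ y.2 := hg' ▸ Nat.gcd_dvd_right _ _
        rw [Prod.mk.injEq] at hxy
        exact Prod.ext ((Nat.div_left_inj d1 d1').1 hxy.1) ((Nat.div_left_inj d2 d2').1 hxy.2)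
    have h2 : ((M / n : ℕ) : ℝ) ≤ (M : ℝ) / n := Nat.cast_div_le
    calc _ ≤ (((Finset.Icc 1 (M / n) ×ˢ Finset.Icc 1 (M / n)).card : ℕ) : ℝ) := by exact_mod_cast h1
      _ = ((M / n : ℕ) : ℝ) ^ 2 := by
        rw [Finset.card_product, Nat.card_Icc, Nat.add_sub_cancel]
        push_cast
        ring
      _ ≤ ((M : ℝ) / n) ^ 2 := by gcongr
      _ = _ := by ring
  have htot : P.card = ∑ n ∈ Finset.Icc 1 M, (P.filter fun x => Nat.gcd x.1 x.2 = n).card :=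
    Finset.card_eq_sum_card_fiberwise fun x hx => by
      obtain ⟨⟨a1, a2⟩, b1, b2⟩ := hP x hx
      exact Finset.mem_coe.2 (Finset.mem_Icc.2 ⟨Nat.gcd_pos_of_pos_left _ a1,
        (Nat.gcd_le_left _ a1).trans a2⟩)
  have hPc : (P.card : ℝ) = (M : ℝ) ^ 2 := by
    rw [Finset.card_product, Nat.card_Icc, Nat.add_sub_cancel]
    push_cast
    ring
  rcases Nat.eq_zero_or_pos M with rfl | hM
  · simp
  have hsq : ∑ n ∈ Finset.Ioc 1 M, 1 / (n : ℝ) ^ 2 ≤ 3 / 4 := by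
    rcases Nat.lt_or_ge M 2 with hM2 | hM2
    · rw [Finset.Ioc_eq_empty (by omega), Finset.sum_empty]
      norm_num
    · have h1 := sum_Ioc_inv_sq_le_sub (α := ℝ) two_ne_zero hM2
      have h2 : (0 : ℝ) ≤ (M : ℝ)⁻¹ := by positivity
      rw [← Finset.sum_Ioc_consecutive _ one_le_two hM2]
      simp only [one_div] at *
      simp only [show Finset.Ioc 1 2 = {2} from rfl, Finset.sum_singleton]
      push_cast at *
      linarith
  rw [← Finset.add_sum_Ioc_eq_sum_Icc hM] at htot
  have hsum : ∑ n ∈ Finset.Ioc 1 M, ((P.filter fun x => Nat.gcd x.1 x.2 = n).card : ℝ) ≤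
      (M : ℝ) ^ 2 * (3 / 4) :=
    (Finset.sum_le_sum fun n hn => hfib n (Finset.mem_Ioc.1 hn).1.le).trans (by
      rw [← Finset.mul_sum]
      gcongr)
  have htot' : (P.card : ℝ) = ((P.filter fun x => Nat.gcd x.1 x.2 = 1).card : ℝ) +
      ∑ n ∈ Finset.Ioc 1 M, ((P.filter fun x => Nat.gcd x.1 x.2 = n).card : ℝ) := by
    exact_mod_cast htot
  have : ((P.filter fun x => Nat.Coprime x.1 x.2).card : ℝ) =
      ((P.filter fun x => Nat.gcd x.1 x.2 = 1).card : ℝ) := rfl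
  linarith

lemma card_ballFin_ge {T : ℝ} (hT : 4 ≤ T) : T ^ 2 / 64 ≤ ((ballFin T).card : ℝ) := by
  classical
  have hT0 : 0 ≤ T := by linarith
  set M := ⌊T / 2⌋₊
  have hM : (M : ℝ) ≤ T / 2 := Nat.floor_le (by positivity)
  have hM' : T / 4 ≤ M := by
    have := Nat.lt_floor_add_one (T / 2)
    linarith
  have h1 := card_coprime_ge M
  set Q := (Finset.Icc 1 M ×ˢ Finset.Icc 1 M).filter fun x => Nat.Coprime x.1 x.2
  have h2 : Q.card ≤ (ballFin T).card := by
    refine Finset.card_le_card_of_surjOn (fun γ : SL2Z => ((γ 0 0).toNat, (γ 1 0).toNat)) ?_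
    rintro ⟨a, c⟩ hx
    simp only [Q, Finset.coe_filter, Finset.mem_product, Finset.mem_Icc, Set.mem_ofPred_eq] at hx
    obtain ⟨⟨⟨ha, haM⟩, hc, hcM⟩, hac⟩ := hx
    obtain ⟨γ, g1, g2, g3, g4⟩ := exists_entries_of_isCoprime (a := a) (c := c) (M := M)
      (by exact_mod_cast ha) (by exact_mod_cast hc) (by exact_mod_cast haM) (by exact_mod_cast hcM)
      (Nat.isCoprime_iff_coprime.2 hac)
    refine ⟨γ, Finset.mem_coe.2 (mem_ballFin.2 ((frobNorm_le_iff hT0 γ).2 ?_)), by simp [g1, g2]⟩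
    have b1 : (γ 0 0 : ℝ) ^ 2 ≤ (T / 2) ^ 2 := by
      rw [g1]
      push_cast
      have : (a : ℝ) ≤ M := by exact_mod_cast haM
      gcongr
      linarith
    have b3 : (γ 1 0 : ℝ) ^ 2 ≤ (T / 2) ^ 2 := by
      rw [g2]
      push_cast
      have : (c : ℝ) ≤ M := by exact_mod_cast hcM
      gcongr
      linarith
    have b2 : (γ 0 1 : ℝ) ^ 2 ≤ (T / 2) ^ 2 := by
      refine sq_le_sq' ?_ ?_ <;>
      · have : |(γ 0 1 : ℝ)| ≤ M := by exact_mod_cast g3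
        linarith [abs_le.1 this]
    have b4 : (γ 1 1 : ℝ) ^ 2 ≤ (T / 2) ^ 2 := by
      refine sq_le_sq' ?_ ?_ <;>
      · have : |(γ 1 1 : ℝ)| ≤ M := by exact_mod_cast g4
        linarith [abs_le.1 this]
    linarith
  have h3 : (Q.card : ℝ) ≤ (ballFin T).card := by exact_mod_cast h2
  have h4 : (T / 4) ^ 2 ≤ (M : ℝ) ^ 2 := by gcongr
  linarith

open Asymptotics in
lemma isLittleO_sum_sub_mul_T {N₀ : ℕ} (hN₀ : 0 < N₀) {f : SL2Z → ℂ} (hf : FactorsMod N₀ f) :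
    (fun T : ℝ => ∑ γ ∈ ballFin T, (f γ - f (γ * ModularGroup.T))) =o[atTop]
      fun T : ℝ => T ^ 2 := by
  classical
  refine isLittleO_iff.2 fun ε hε => ?_
  set s := min 1 (ε / 288)
  have hs : 0 < s := by positivity
  have hs1 : s ≤ 1 := min_le_left _ _
  have hsε : s ≤ ε / 288 := min_le_right _ _
  have hδ1 : s ^ 2 ≤ 1 := pow_le_one₀ hs.le hs1
  obtain ⟨T₀, hT₀⟩ := exists_norm_sum_intCast_le hN₀ hf (δ := s ^ 2) (κ := ε / 6) (by positivity)
    hδ1 (by positivity)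
  filter_upwards [eventually_ge_atTop T₀, eventually_ge_atTop 1, eventually_ge_atTop (96 / ε)]
    with T hT h1 hTε
  have hT0 : 0 ≤ T := by linarith
  have hnorm : ∀ γ : SL2Z, ‖f γ - f (γ * ModularGroup.T)‖ ≤ 2 := fun γ =>
    (norm_sub_le _ _).trans (by linarith [hf.norm_le γ, hf.norm_le (γ * ModularGroup.T)])
  rw [← Finset.sum_filter_add_sum_filter_not (ballFin T)
    fun γ : SL2Z => |(γ 1 0 : ℝ)| ≤ s ^ 2 * T]
  have hA : ‖∑ γ ∈ (ballFin T).filter (fun γ : SL2Z => |(γ 1 0 : ℝ)| ≤ s ^ 2 * T),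
      (f γ - f (γ * ModularGroup.T))‖ ≤ (36 * s * T ^ 2 + 12 * T) * 2 := by
    refine (norm_sum_le_of_le _ fun γ _ => hnorm γ).trans ?_
    rw [Finset.sum_const, nsmul_eq_mul]
    have := card_lower_left_le h1 (sq_nonneg s) hδ1
    rw [Real.sqrt_sq hs.le] at this
    gcongr
  set C := (Finset.Icc (-⌊T⌋₊ : ℤ) ⌊T⌋₊).filter fun c : ℤ => ¬|(c : ℝ)| ≤ s ^ 2 * T
  have hmaps : ∀ γ ∈ (ballFin T).filter (fun γ : SL2Z => ¬|(γ 1 0 : ℝ)| ≤ s ^ 2 * T),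
      γ 1 0 ∈ C := fun γ hγ => by
    obtain ⟨g1, g2⟩ := Finset.mem_filter.1 hγ
    exact Finset.mem_filter.2 ⟨entry_mem_Icc hT0 g1 1 0, g2⟩
  have hB : ‖∑ γ ∈ (ballFin T).filter (fun γ : SL2Z => ¬|(γ 1 0 : ℝ)| ≤ s ^ 2 * T),
      (f γ - f (γ * ModularGroup.T))‖ ≤ 3 * T * (ε / 6 * T) := by
    rw [← Finset.sum_fiberwise_of_maps_to hmaps]
    refine (norm_sum_le_of_le (f := fun c : ℤ => _) C (n := fun _ => ε / 6 * T)
      fun c hc => ?_).trans ?_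
    · have hc' := (Finset.mem_filter.1 hc).2
      have e : ((ballFin T).filter fun γ : SL2Z => ¬|(γ 1 0 : ℝ)| ≤ s ^ 2 * T).filter
          (fun γ : SL2Z => γ 1 0 = c) = (ballFin T).filter fun γ : SL2Z => γ 1 0 = c := by
        ext γ
        simp only [Finset.mem_filter]
        refine ⟨fun h => ⟨h.1.1, h.2⟩, fun h => ⟨⟨h.1, ?_⟩, h.2⟩⟩
        rw [h.2]
        exact hc'
      rw [e]
      exact hT₀ T hT c (by push_cast; exact (not_le.1 hc').le)
    · rw [Finset.sum_const, nsmul_eq_mul]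
      have h3 : (C.card : ℝ) ≤ 3 * T := by
        have h4 : C.card ≤ 2 * ⌊T⌋₊ + 1 := by
          refine (Finset.card_filter_le _ _).trans ?_
          rw [Int.card_Icc]
          omega
        have h5 : (⌊T⌋₊ : ℝ) ≤ T := Nat.floor_le hT0
        have h6 : (C.card : ℝ) ≤ 2 * ⌊T⌋₊ + 1 := by exact_mod_cast h4
        linarith
      gcongr
  refine (norm_add_le _ _).trans ((add_le_add hA hB).trans ?_)
  rw [Real.norm_of_nonneg (by positivity)]
  have h7 : 96 ≤ T * ε := (div_le_iff₀ hε).1 hTε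
  have h8 : 96 * T ≤ ε * T ^ 2 := by nlinarith
  have h9 : s * T ^ 2 ≤ ε / 288 * T ^ 2 := by gcongr
  linarith

lemma frobNorm_mul_S (γ : SL2Z) : frobNorm (γ * ModularGroup.S) = frobNorm γ := by
  simp only [frobNorm, Matrix.SpecialLinearGroup.coe_mul, ModularGroup.coe_S, Matrix.mul_apply,
    Fin.sum_univ_two]
  congr 2
  simp
  ring

lemma sum_ballFin_mul_S (f : SL2Z → ℂ) (T : ℝ) :
    ∑ γ ∈ ballFin T, f (γ * ModularGroup.S) = ∑ γ ∈ ballFin T, f γ :=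
  Finset.sum_equiv (Equiv.mulRight ModularGroup.S)
    (fun γ => by simp [mem_ballFin, frobNorm_mul_S]) fun γ _ => rfl

open Asymptotics in
lemma isLittleO_sum_sub_mul {N₀ : ℕ} (hN₀ : 0 < N₀) (h : SL2Z) {f : SL2Z → ℂ}
    (hf : FactorsMod N₀ f) :
    (fun T : ℝ => ∑ γ ∈ ballFin T, (f γ - f (γ * h))) =o[atTop] fun T : ℝ => T ^ 2 := by
  have hmem : h ∈ Subgroup.closure {ModularGroup.S, ModularGroup.T} := by
    rw [SpecialLinearGroup.SL2Z_generators]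
    trivial
  induction hmem using Subgroup.closure_induction generalizing f with
  | mem x hx =>
    rcases hx with rfl | rfl
    · simp only [Finset.sum_sub_distrib, sum_ballFin_mul_S, sub_self]
      exact isLittleO_zero _ _
    · exact isLittleO_sum_sub_mul_T hN₀ hf
  | one => simp
  | mul x y _ _ hx hy =>
    refine ((hy hf).add (hx (hf.comp_mul_right y))).congr_left fun T => ?_
    rw [← Finset.sum_add_distrib]
    exact Finset.sum_congr rfl fun γ _ => by rw [mul_assoc, sub_add_sub_cancel]
  | inv x _ hx =>
    refine (hx (hf.comp_mul_right x⁻¹)).neg_left.congr_left fun T => ?_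
    rw [← Finset.sum_neg_distrib]
    exact Finset.sum_congr rfl fun γ _ => by simp

lemma card_SL_two (p : ℕ) [Fact p.Prime] :
    Nat.card (Matrix.SpecialLinearGroup (Fin 2) (ZMod p)) = p * (p ^ 2 - 1) := by
  have hp : 1 < p := (Fact.out : p.Prime).one_lt
  have h1 : Nat.card (Matrix.SpecialLinearGroup (Fin 2) (ZMod p)) =
      Nat.card (Matrix.GeneralLinearGroup.det (n := Fin 2) (R := ZMod p)).ker := by
    refine Nat.card_congr (Equiv.ofBijective
      (fun g => ⟨Matrix.SpecialLinearGroup.toGL g, ?_⟩) ⟨fun g g' h => ?_, fun g => ?_⟩)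
    · rw [MonoidHom.mem_ker]
      ext
      simp
    · exact Matrix.SpecialLinearGroup.toGL_injective (Subtype.mk.inj h)
    · refine ⟨⟨g.1.1, ?_⟩, ?_⟩
      · exact congrArg Units.val (MonoidHom.mem_ker.1 g.2)
      · ext
        rfl
  have h2 := Subgroup.card_mul_index (Matrix.GeneralLinearGroup.det (n := Fin 2) (R := ZMod p)).ker
  rw [Subgroup.index_ker, MonoidHom.range_eq_top.2 Matrix.GeneralLinearGroup.det_surjective,
    Subgroup.card_top, Nat.card_units, Nat.card_zmod, Matrix.card_GL_field, Fin.prod_univ_two,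
    Fintype.card_eq_nat_card, Nat.card_zmod, ← h1] at h2
  have h3 : p ^ 2 - p = p * (p - 1) := by rw [Nat.mul_sub, sq, mul_one]
  simp only [Fin.val_zero, Fin.val_one, pow_zero, pow_one, h3] at h2
  exact Nat.eq_of_mul_eq_mul_right (by omega : 0 < p - 1) (by rw [h2]; ring)

/-- Being a scalar matrix. -/
def IsScalarMat {R : Type*} [CommRing R] (g : Matrix.SpecialLinearGroup (Fin 2) R) : Prop :=
  g 1 0 = 0 ∧ g 1 1 - g 0 0 = 0 ∧ g 0 1 = 0

lemma card_isScalarMat (p : ℕ) [Fact p.Prime] :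
    Nat.card {g : Matrix.SpecialLinearGroup (Fin 2) (ZMod p) // IsScalarMat g} =
      if p = 2 then 1 else 2 := by
  have hdet : ∀ g : Matrix.SpecialLinearGroup (Fin 2) (ZMod p),
      g 0 0 * g 1 1 - g 0 1 * g 1 0 = 1 := fun g => by
    rw [← Matrix.det_fin_two]; exact g.det_coe
  have hsq : ∀ g : Matrix.SpecialLinearGroup (Fin 2) (ZMod p), IsScalarMat g ↔ g = 1 ∨ g = -1 := by
    intro g
    constructor
    · rintro ⟨h1, h2, h3⟩
      have h4 : g 1 1 = g 0 0 := sub_eq_zero.1 h2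
      have h5 : g 0 0 * g 0 0 = 1 := by
        have := hdet g
        rwa [h1, h4, mul_zero, sub_zero] at this
      refine (mul_self_eq_one_iff.1 h5).imp (fun h => ?_) fun h => ?_ <;>
      · ext i j
        fin_cases i <;> fin_cases j <;> simp [h1, h3, h4, h]
    · rintro (rfl | rfl) <;> simp [IsScalarMat]
  simp only [hsq]
  split_ifs with hp
  · subst hp
    rw [Nat.card_eq_one_iff_unique]
    refine ⟨⟨fun x y => Subtype.ext ?_⟩, ⟨⟨1, Or.inl rfl⟩⟩⟩
    have h : (-1 : Matrix.SpecialLinearGroup (Fin 2) (ZMod 2)) = 1 := by decide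
    have key : ∀ z : {g : Matrix.SpecialLinearGroup (Fin 2) (ZMod 2) // g = 1 ∨ g = -1},
        z.1 = 1 := fun z => z.2.elim id fun h' => h'.trans h
    rw [key x, key y]
  · have hne : (1 : Matrix.SpecialLinearGroup (Fin 2) (ZMod p)) ≠ -1 := fun h => by
      have h1 := congrArg (fun g : Matrix.SpecialLinearGroup (Fin 2) (ZMod p) => g 0 0) h
      have : Fact (2 < p) := ⟨lt_of_le_of_ne (Fact.out : p.Prime).two_le (Ne.symm hp)⟩
      exact ZMod.neg_one_ne_one (n := p) (by simpa using h1.symm)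
    exact (Nat.card_coe_set_eq {1, -1}).trans (Set.ncard_pair hne)

/-- The proportion of non-scalar matrices in `SL(2, ℤ/p)`. -/
def nonscalarDensity (p : ℕ) : ℝ := 1 - (if p = 2 then 1 else 2) / ((p : ℝ) * ((p : ℝ) ^ 2 - 1))

lemma card_not_isScalarMat (p : ℕ) [Fact p.Prime] :
    (Nat.card {g : Matrix.SpecialLinearGroup (Fin 2) (ZMod p) // ¬IsScalarMat g} : ℝ) =
      nonscalarDensity p * Nat.card (Matrix.SpecialLinearGroup (Fin 2) (ZMod p)) := by
  classical
  have hp : 1 < p := (Fact.out : p.Prime).one_lt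
  have hp1 : (1 : ℝ) < p := by exact_mod_cast hp
  have h1 := Nat.card_congr (Equiv.sumCompl
    fun g : Matrix.SpecialLinearGroup (Fin 2) (ZMod p) => IsScalarMat g)
  rw [Nat.card_sum, card_isScalarMat] at h1
  have h2 : (Nat.card (Matrix.SpecialLinearGroup (Fin 2) (ZMod p)) : ℝ) =
      (p : ℝ) * ((p : ℝ) ^ 2 - 1) := by
    rw [card_SL_two, Nat.cast_mul, Nat.cast_sub (Nat.one_le_pow _ _ hp.le)]
    push_cast
    ring
  have h3 : (0 : ℝ) < (p : ℝ) * ((p : ℝ) ^ 2 - 1) := by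
    have : (1 : ℝ) < (p : ℝ) ^ 2 := one_lt_pow₀ hp1 two_ne_zero
    exact mul_pos (by linarith) (by linarith)
  have h4 : ((if p = 2 then 1 else 2 : ℕ) : ℝ) +
      Nat.card {g : Matrix.SpecialLinearGroup (Fin 2) (ZMod p) // ¬IsScalarMat g} =
      Nat.card (Matrix.SpecialLinearGroup (Fin 2) (ZMod p)) := by exact_mod_cast h1
  push_cast at h4
  rw [nonscalarDensity, sub_mul, one_mul, ← h4, h4, h2, div_mul_cancel₀ _ h3.ne', ← h2, ← h4]
  ring

/-- Reduction of an integral matrix modulo each of the elements of `s`. -/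
def reduction (s : Finset ℕ) :
    SL2Z →* ∀ p : s, Matrix.SpecialLinearGroup (Fin 2) (ZMod (p : ℕ)) :=
  MonoidHom.pi fun p => Matrix.SpecialLinearGroup.map (Int.castRingHom (ZMod (p : ℕ)))

lemma reduction_apply (s : Finset ℕ) (γ : SL2Z) (p : s) (i j : Fin 2) :
    reduction s γ p i j = (γ i j : ZMod (p : ℕ)) :=
  rfl

lemma reduction_surjective {s : Finset ℕ} (hs : ∀ p ∈ s, p.Prime) :
    Function.Surjective (reduction s) := by
  classical
  rw [← MonoidHom.range_eq_top, eq_top_iff]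
  rintro g -
  refine Subgroup.pi_mem_of_mulSingle_mem g fun p => ?_
  have : Fact (p : ℕ).Prime := ⟨hs p p.2⟩
  refine Matrix.SL2.transvection_induction
    (fun A => Pi.mulSingle p A ∈ (reduction s).range) ?_ ?_ (g p)
  · intro i j hij c
    have hcop : Nat.Coprime p (∏ q ∈ s.erase p, q) := Nat.Coprime.prod_right fun q hq =>
      (Nat.coprime_primes (hs p p.2) (hs q (Finset.mem_of_mem_erase hq))).2
        (Finset.ne_of_mem_erase hq).symm
    obtain ⟨k, hk1, hk2⟩ := Nat.chineseRemainder hcop c.val 0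
    refine ⟨Matrix.SpecialLinearGroup.transvection hij (k : ℤ), ?_⟩
    funext q
    ext i' j'
    rw [reduction_apply]
    by_cases hqp : q = p
    · subst hqp
      have hkc : (k : ZMod (q : ℕ)) = c := by
        rw [(ZMod.natCast_eq_natCast_iff _ _ _).2 hk1, ZMod.natCast_zmod_val]
      rw [Pi.mulSingle_eq_same]
      fin_cases i <;> fin_cases j <;> fin_cases i' <;> fin_cases j' <;>
        simp_all [Matrix.SpecialLinearGroup.transvection_coe]
    · have hk0 : (k : ZMod (q : ℕ)) = 0 := by
        rw [ZMod.natCast_eq_zero_iff]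
        exact (Finset.dvd_prod_of_mem _ (Finset.mem_erase.2
          ⟨fun h => hqp (Subtype.ext h), q.2⟩)).trans (Nat.modEq_zero_iff_dvd.1 hk2)
      rw [Pi.mulSingle_eq_of_ne hqp]
      fin_cases i <;> fin_cases j <;> fin_cases i' <;> fin_cases j' <;>
        simp_all [Matrix.SpecialLinearGroup.transvection_coe]
  · intro A B hA hB
    rw [Pi.mulSingle_mul]
    exact mul_mem hA hB

open Asymptotics in
lemma isLittleO_sum_comp_hom {G : Type*} [Group G] [Fintype G] {N₀ : ℕ} (hN₀ : 0 < N₀)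
    {π : SL2Z →* G} (hπ : Function.Surjective π) (φ : G → ℂ)
    (hf : FactorsMod N₀ fun γ => φ (π γ)) :
    (fun T : ℝ => ((Fintype.card G : ℂ) * ∑ γ ∈ ballFin T, φ (π γ)) -
      (ballFin T).card * ∑ g, φ g) =o[atTop] fun T : ℝ => T ^ 2 := by
  choose lift hlift using hπ
  refine (IsLittleO.sum (s := Finset.univ)
    fun g _ => isLittleO_sum_sub_mul hN₀ (lift g) hf).congr_left fun T => ?_
  rw [Finset.sum_apply, Finset.sum_comm]
  have h1 : ∀ γ ∈ ballFin T, ∑ g, (φ (π γ) - φ (π (γ * lift g))) =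
      Fintype.card G * φ (π γ) - ∑ g, φ g := fun γ _ => by
    rw [Finset.sum_sub_distrib, Finset.sum_const, Finset.card_univ, nsmul_eq_mul]
    congr 1
    simp only [map_mul, hlift]
    exact Fintype.sum_equiv (Equiv.mulLeft (π γ)) _ _ fun _ => rfl
  rw [Finset.sum_congr rfl h1, Finset.sum_sub_distrib, ← Finset.mul_sum, Finset.sum_const,
    nsmul_eq_mul]

lemma isScalarMat_reduction_iff (s : Finset ℕ) (γ : SL2Z) (p : s) :
    IsScalarMat (reduction s γ p) ↔ (p : ℕ) ∣ uGamma γ := by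
  rw [dvd_uGamma_iff, IsScalarMat, reduction_apply, reduction_apply, reduction_apply,
    reduction_apply, ← Int.cast_sub, ZMod.intCast_zmod_eq_zero_iff_dvd,
    ZMod.intCast_zmod_eq_zero_iff_dvd, ZMod.intCast_zmod_eq_zero_iff_dvd]

open Classical in
lemma factorsMod_indicator (s : Finset ℕ) :
    FactorsMod (∏ p ∈ s, p) fun γ => if ∀ p : s, ¬IsScalarMat (reduction s γ p) then 1 else 0 := by
  refine ⟨fun a b c d => if ∀ p : s, ¬((c.cast : ZMod (p : ℕ)) = 0 ∧
    (d.cast - a.cast : ZMod (p : ℕ)) = 0 ∧ (b.cast : ZMod (p : ℕ)) = 0) then 1 else 0,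
    fun a b c d => ?_, fun γ => ?_⟩
  · dsimp only
    split_ifs <;> simp
  · have key : (∀ p : s, ¬IsScalarMat (reduction s γ p)) ↔
        ∀ p : s, ¬(((γ 1 0 : ZMod (∏ p ∈ s, p)).cast : ZMod (p : ℕ)) = 0 ∧
          ((γ 1 1 : ZMod (∏ p ∈ s, p)).cast - (γ 0 0 : ZMod (∏ p ∈ s, p)).cast :
            ZMod (p : ℕ)) = 0 ∧ ((γ 0 1 : ZMod (∏ p ∈ s, p)).cast : ZMod (p : ℕ)) = 0) := by
      refine forall_congr' fun p => ?_
      have hd : (p : ℕ) ∣ ∏ p ∈ s, p := Finset.dvd_prod_of_mem _ p.2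
      rw [ZMod.cast_intCast hd, ZMod.cast_intCast hd, ZMod.cast_intCast hd, ZMod.cast_intCast hd]
      rfl
    by_cases h : ∀ p : s, ¬IsScalarMat (reduction s γ p)
    · exact (if_pos h).trans (if_pos (key.1 h)).symm
    · exact (if_neg h).trans (if_neg fun h' => h (key.2 h')).symm

open Asymptotics in
lemma isLittleO_card_forall_not_dvd {s : Finset ℕ} (hs : ∀ p ∈ s, p.Prime) :
    (fun T : ℝ => (((ballFin T).filter fun γ : SL2Z => ∀ p ∈ s, ¬p ∣ uGamma γ).card : ℝ) -
      (∏ p ∈ s, nonscalarDensity p) * (ballFin T).card) =o[atTop] fun T : ℝ => T ^ 2 := by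
  classical
  have hfact : ∀ p : s, Fact (p : ℕ).Prime := fun p => ⟨hs p p.2⟩
  have hfin : ∀ p : s, Fintype (Matrix.SpecialLinearGroup (Fin 2) (ZMod (p : ℕ))) :=
    fun p => Fintype.ofFinite _
  have h := isLittleO_sum_comp_hom (Finset.prod_pos fun p hp => (hs p hp).pos)
    (reduction_surjective hs) (fun g => if ∀ p : s, ¬IsScalarMat (g p) then 1 else 0)
    (factorsMod_indicator s)
  set G := ∀ p : s, Matrix.SpecialLinearGroup (Fin 2) (ZMod (p : ℕ))
  have hG : (Fintype.card G : ℝ) ≠ 0 := by exact_mod_cast Fintype.card_ne_zero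
  have h1 : ∀ T, ∑ γ ∈ ballFin T, (if ∀ p : s, ¬IsScalarMat (reduction s γ p) then (1 : ℂ) else 0) =
      ((ballFin T).filter fun γ : SL2Z => ∀ p ∈ s, ¬p ∣ uGamma γ).card := fun T => by
    rw [Finset.sum_boole]
    simp only [isScalarMat_reduction_iff, Subtype.forall]
  have h2 : ((Finset.univ.filter fun g : G => ∀ p : s, ¬IsScalarMat (g p)).card : ℝ) =
      (∏ p ∈ s, nonscalarDensity p) * Fintype.card G := by
    rw [← Fintype.card_subtype, Fintype.card_eq_nat_card, Fintype.card_eq_nat_card,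
      Nat.card_congr (Equiv.subtypePiEquivPi (p := fun (p : s) => fun g :
        Matrix.SpecialLinearGroup (Fin 2) (ZMod (p : ℕ)) => ¬IsScalarMat g)), Nat.card_pi,
      Nat.card_pi, ← Finset.prod_coe_sort s nonscalarDensity,
      Nat.cast_prod, Nat.cast_prod, ← Finset.prod_mul_distrib]
    exact Finset.prod_congr rfl fun p _ => card_not_isScalarMat p
  simp only [h1, Finset.sum_boole] at h
  have h3 := (h.const_mul_left ((Fintype.card G : ℂ)⁻¹))
  rw [← Complex.isLittleO_ofReal_left]
  refine h3.congr_left fun T => ?_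
  have h4 : ((Finset.univ.filter fun g : G => ∀ p : s, ¬IsScalarMat (g p)).card : ℂ) =
      ((∏ p ∈ s, nonscalarDensity p : ℝ) : ℂ) * Fintype.card G := by exact_mod_cast h2
  have hG' : (Fintype.card G : ℂ) ≠ 0 := by exact_mod_cast hG
  rw [h4]
  change (Fintype.card G : ℂ)⁻¹ * ((Fintype.card G : ℂ) * _ - _) = _
  push_cast
  field_simp

/-- The matrices counted in the numerator. -/
def primitiveFin (T : ℝ) : Finset SL2Z :=
  (ballFin T).filter fun γ => 2 < |trZ γ| ∧ uGamma γ = 1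

lemma summable_compl_inv_sq (s : Finset ℕ) :
    Summable fun n : {n : ℕ // n ∉ s} => 1 / ((n : ℕ) : ℝ) ^ 2 :=
  (Real.summable_one_div_nat_pow.2 one_lt_two).subtype _

lemma card_primitiveFin_le (s : Finset ℕ) (T : ℝ) :
    (primitiveFin T).card ≤
      ((ballFin T).filter fun γ : SL2Z => ∀ p ∈ s.filter Nat.Prime, ¬p ∣ uGamma γ).card := by
  refine Finset.card_le_card fun γ hγ => ?_
  obtain ⟨h1, -, h2⟩ := Finset.mem_filter.1 hγ
  refine Finset.mem_filter.2 ⟨h1, fun p hp h => ?_⟩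
  rw [h2] at h
  exact (Finset.mem_filter.1 hp).2.one_lt.ne' (Nat.dvd_one.1 h)

lemma trZ_of_lower_left_eq_zero {γ : SL2Z} (h : γ 1 0 = 0) : |trZ γ| ≤ 2 := by
  have hd := det_eq_one γ
  rw [h, mul_zero, sub_zero] at hd
  rw [trZ]
  rcases Int.mul_eq_one_iff_eq_one_or_neg_one.1 hd with ⟨h1, h2⟩ | ⟨h1, h2⟩ <;> rw [h1, h2] <;>
    decide

lemma card_forall_not_dvd_le (s : Finset ℕ) {T : ℝ} (hT : 1 ≤ T) :
    (((ballFin T).filter fun γ : SL2Z => ∀ p ∈ s.filter Nat.Prime, ¬p ∣ uGamma γ).card : ℝ) ≤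
      (primitiveFin T).card + (30 * 41 ^ 4 + 12) * (T * √T) +
        112 * T ^ 2 * ∑' n : {n : ℕ // n ∉ s}, 1 / ((n : ℕ) : ℝ) ^ 2 := by
  classical
  have hT0 : 0 ≤ T := by linarith
  set R := (Finset.Icc 1 ⌊T⌋₊).filter fun p => p.Prime ∧ p ∉ s
  have hsub : ((ballFin T).filter fun γ : SL2Z => ∀ p ∈ s.filter Nat.Prime, ¬p ∣ uGamma γ) ⊆
      primitiveFin T ∪ ((ballFin T).filter fun γ : SL2Z => |trZ γ| ≤ 2) ∪
        R.biUnion fun p => (ballFin T).filter fun γ : SL2Z => γ 1 0 ≠ 0 ∧ p ∣ uGamma γ := by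
    intro γ hγ
    obtain ⟨hγ, hs⟩ := Finset.mem_filter.1 hγ
    rcases le_or_gt |trZ γ| 2 with htr | htr
    · exact Finset.mem_union_left _ (Finset.mem_union_right _ (Finset.mem_filter.2 ⟨hγ, htr⟩))
    by_cases hu : uGamma γ = 1
    · exact Finset.mem_union_left _ (Finset.mem_union_left _ (Finset.mem_filter.2 ⟨hγ, htr, hu⟩))
    obtain ⟨p, hp, hpu⟩ := Nat.exists_prime_and_dvd hu
    have hc : γ 1 0 ≠ 0 := fun h => absurd (trZ_of_lower_left_eq_zero h) (not_le.2 htr)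
    refine Finset.mem_union_right _ (Finset.mem_biUnion.2
      ⟨p, Finset.mem_filter.2 ⟨Finset.mem_Icc.2 ⟨hp.pos, Nat.le_floor ?_⟩, hp, fun h =>
        hs p (Finset.mem_filter.2 ⟨h, hp⟩) hpu⟩, Finset.mem_filter.2 ⟨hγ, hc, hpu⟩⟩)
    have h4 := abs_entry_le hT0 (mem_ballFin.1 hγ) 1 0
    have h5 : (p : ℤ) ≤ |γ 1 0| :=
      Int.le_of_dvd (abs_pos.2 hc) ((dvd_abs _ _).2 ((dvd_uGamma_iff p γ).1 hpu).1)
    have h6 : (p : ℝ) ≤ |(γ 1 0 : ℝ)| := by exact_mod_cast h5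
    linarith
  have h1 : (((ballFin T).filter fun γ : SL2Z =>
      ∀ p ∈ s.filter Nat.Prime, ¬p ∣ uGamma γ).card : ℝ) ≤
      (primitiveFin T).card + ((ballFin T).filter fun γ : SL2Z => |trZ γ| ≤ 2).card +
        ∑ p ∈ R, (((ballFin T).filter fun γ : SL2Z => γ 1 0 ≠ 0 ∧ p ∣ uGamma γ).card : ℝ) := by
    exact_mod_cast (Finset.card_le_card hsub).trans ((Finset.card_union_le _ _).trans
      (add_le_add (Finset.card_union_le _ _) Finset.card_biUnion_le))
  have h2 : ∑ p ∈ R, (((ballFin T).filter fun γ : SL2Z => γ 1 0 ≠ 0 ∧ p ∣ uGamma γ).card : ℝ) ≤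
      112 * T ^ 2 * ∑' n : {n : ℕ // n ∉ s}, 1 / ((n : ℕ) : ℝ) ^ 2 := by
    calc _ ≤ ∑ p ∈ R, 112 * T ^ 2 * (1 / (p : ℝ) ^ 2) := Finset.sum_le_sum fun p hp =>
          (card_dvd_uGamma_le hT (Finset.mem_filter.1 hp).2.1).trans_eq (by ring)
      _ = 112 * T ^ 2 * ∑ p ∈ R, 1 / (p : ℝ) ^ 2 := by rw [Finset.mul_sum]
      _ = 112 * T ^ 2 * ∑ n ∈ R.subtype (· ∉ s), 1 / ((n : ℕ) : ℝ) ^ 2 := by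
        rw [Finset.sum_subtype_of_mem (fun n : ℕ => 1 / (n : ℝ) ^ 2)
          fun p hp => (Finset.mem_filter.1 hp).2.2]
      _ ≤ _ := by
        gcongr
        exact (summable_compl_inv_sq s).sum_le_tsum _ fun _ _ => by positivity
  linarith [card_not_hyperbolic_le hT]

/-- The local factor at an odd prime. -/
def oddFactor (p : ℕ) : ℝ := 1 - 2 / ((p : ℝ) * ((p : ℝ) ^ 2 - 1))

lemma hasProd_oddFactor :
    HasProd ({p : ℕ | p.Prime ∧ p ≠ 2}.mulIndicator oddFactor)
      (∏' p : {p : ℕ // p.Prime ∧ p ≠ 2}, oddFactor p) := by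
  have hsum : Summable fun p : {p : ℕ // p.Prime ∧ p ≠ 2} =>
      -(2 / (((p : ℕ) : ℝ) * (((p : ℕ) : ℝ) ^ 2 - 1))) := by
    refine Summable.of_norm_bounded
      (((Real.summable_one_div_nat_pow.2 one_lt_two).mul_left 2).subtype _) fun p => ?_
    have hp : (2 : ℝ) ≤ (p : ℕ) := by exact_mod_cast p.2.1.two_le
    have h1 : ((p : ℕ) : ℝ) ^ 2 ≤ ((p : ℕ) : ℝ) * (((p : ℕ) : ℝ) ^ 2 - 1) := by nlinarith
    rw [norm_neg, Real.norm_of_nonneg (div_nonneg two_pos.le ((sq_nonneg _).trans h1))]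
    simp only [Function.comp_apply]
    rw [mul_one_div]
    gcongr
  have hm : Multipliable fun p : {p : ℕ // p.Prime ∧ p ≠ 2} => oddFactor p := by
    simp only [oddFactor, sub_eq_add_neg]
    exact Real.multipliable_one_add_of_summable hsum
  exact hasProd_subtype_iff_mulIndicator.1 hm.hasProd

lemma prod_nonscalarDensity {s : Finset ℕ} (h2 : 2 ∈ s) :
    ∏ p ∈ s.filter Nat.Prime, nonscalarDensity p =
      5 / 6 * ∏ p ∈ s, {p : ℕ | p.Prime ∧ p ≠ 2}.mulIndicator oddFactor p := by
  classical
  rw [← Finset.mul_prod_erase _ _ (Finset.mem_filter.2 ⟨h2, Nat.prime_two⟩)]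
  congr 1
  · norm_num [nonscalarDensity]
  · have h1 : (s.filter Nat.Prime).erase 2 = s.filter fun p => p.Prime ∧ p ≠ 2 := by
      ext p
      simp only [Finset.mem_erase, Finset.mem_filter]
      tauto
    rw [h1, Finset.prod_filter]
    refine Finset.prod_congr rfl fun p _ => ?_
    rw [Set.mulIndicator_apply]
    by_cases hp : p.Prime ∧ p ≠ 2
    · rw [if_pos hp, if_pos (by exact hp), nonscalarDensity, if_neg hp.2, oddFactor]
    · rw [if_neg hp, if_neg (by exact hp)]

lemma tendsto_prod_nonscalarDensity :
    Tendsto (fun s : Finset ℕ => ∏ p ∈ s.filter Nat.Prime, nonscalarDensity p) atTop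
      (𝓝 (5 / 6 * ∏' p : {p : ℕ // p.Prime ∧ p ≠ 2}, oddFactor p)) := by
  refine (hasProd_oddFactor.const_mul (5 / 6)).congr' ?_
  filter_upwards [eventually_ge_atTop {2}] with s hs
  exact (prod_nonscalarDensity (hs (Finset.mem_singleton_self 2))).symm

lemma natCard_subtype_eq (T : ℝ) (P : SL2Z → Prop) [DecidablePred P] :
    Nat.card {γ : SL2Z // frobNorm γ ≤ T ∧ P γ} = ((ballFin T).filter P).card := by
  rw [← Fintype.card_coe, ← Nat.card_eq_fintype_card]
  exact Nat.card_congr (Equiv.subtypeEquivRight fun γ => by rw [Finset.mem_filter, mem_ballFin])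

lemma tendsto_card_primitiveFin_div :
    Tendsto (fun T : ℝ => ((primitiveFin T).card : ℝ) / (ballFin T).card) atTop
      (𝓝 (5 / 6 * ∏' p : {p : ℕ // p.Prime ∧ p ≠ 2}, oddFactor p)) := by
  set L := 5 / 6 * ∏' p : {p : ℕ // p.Prime ∧ p ≠ 2}, oddFactor p
  refine Metric.tendsto_nhds.2 fun ε hε => ?_
  have htail := tendsto_tsum_compl_atTop_zero fun n : ℕ => 1 / (n : ℝ) ^ 2
  obtain ⟨s, hs1, hs2⟩ := ((Metric.tendsto_nhds.1 tendsto_prod_nonscalarDensity (ε / 4)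
    (by positivity)).and (Metric.tendsto_nhds.1 htail (ε / 4 / (64 * 112)) (by positivity))).exists
  have hA := Asymptotics.isLittleO_iff.1 (isLittleO_card_forall_not_dvd (s := s.filter Nat.Prime)
    fun p hp => (Finset.mem_filter.1 hp).2) (c := ε / 4 / 64) (by positivity)
  set K : ℝ := 30 * 41 ^ 4 + 12
  have hK : 0 < K := by positivity
  filter_upwards [hA, eventually_ge_atTop 4, eventually_ge_atTop ((64 * K / (ε / 8)) ^ 2)]
    with T hA hT4 hTK
  have hT0 : 0 ≤ T := by linarith
  have hB := card_ballFin_ge hT4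
  have hBpos : 0 < ((ballFin T).card : ℝ) := lt_of_lt_of_le (by positivity) hB
  have hup : ((primitiveFin T).card : ℝ) ≤ _ := Nat.cast_le.2 (card_primitiveFin_le s T)
  have hlo := card_forall_not_dvd_le s (by linarith : 1 ≤ T)
  rw [Real.norm_of_nonneg (sq_nonneg T), Real.norm_eq_abs, abs_le] at hA
  rw [Real.dist_eq, abs_lt] at hs1
  rw [Real.dist_0_eq_abs, abs_lt] at hs2
  set A : ℝ := (((ballFin T).filter fun γ : SL2Z =>
    ∀ p ∈ s.filter Nat.Prime, ¬p ∣ uGamma γ).card : ℝ)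
  set D := ∏ p ∈ s.filter Nat.Prime, nonscalarDensity p
  set t : ℝ := ∑' n : {n : ℕ // n ∉ s}, 1 / ((n : ℕ) : ℝ) ^ 2
  set B : ℝ := ((ballFin T).card : ℝ)
  change -(ε / 4) < D - L ∧ D - L < ε / 4 at hs1
  change A ≤ _ + K * (T * √T) + _ at hlo
  have hsT : 64 * K / (ε / 8) ≤ √T := Real.le_sqrt_of_sq_le hTK
  have h1 : 64 * K ≤ √T * (ε / 8) := (div_le_iff₀ (by positivity)).1 hsT
  have h2 : 64 * (K * (T * √T)) ≤ ε / 8 * T ^ 2 := by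
    calc 64 * (K * (T * √T)) = 64 * K * (T * √T) := by ring
      _ ≤ √T * (ε / 8) * (T * √T) := by gcongr
      _ = ε / 8 * (T * (√T * √T)) := by ring
      _ = ε / 8 * T ^ 2 := by rw [Real.mul_self_sqrt hT0, sq]
  have h3 : 112 * T ^ 2 * t ≤ 112 * T ^ 2 * (ε / 4 / (64 * 112)) := by
    gcongr
    exact hs2.2.le
  have h4 : ε * (T ^ 2 / 64) ≤ ε * B := by gcongr
  have h5 : 0 < ε * B := by positivity
  rw [Real.dist_eq, abs_lt]
  have h6 : (L - ε / 4) * B ≤ D * B := by gcongr; linarith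
  have h7 : D * B ≤ (L + ε / 4) * B := by gcongr; linarith
  constructor
  · rw [lt_sub_iff_add_lt, lt_div_iff₀ hBpos]
    linarith
  · rw [sub_lt_iff_lt_add, div_lt_iff₀ hBpos]
    linarith

/-- The proportion of `γ ∈ Γ_T` which are hyperbolic with `u_γ = 1` (i.e. the
associated quadratic form is primitive, `Δ_γ = Tr(γ)² - 4`) converges to
`(5/6)·∏_{p odd prime} (1 - 2/(p(p²-1)))`. -/
theorem statement8 :
    Tendsto (fun T : ℝ =>
        (Nat.card {γ : SL2Z // frobNorm γ ≤ T ∧ 2 < |trZ γ| ∧ uGamma γ = 1} : ℝ) /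
          (Nat.card {γ : SL2Z // frobNorm γ ≤ T} : ℝ))
      atTop
      (𝓝 ((5 / 6) * ∏' p : {p : ℕ // p.Prime ∧ p ≠ 2},
        (1 - 2 / ((p.1 : ℝ) * ((p.1 : ℝ) ^ 2 - 1))))) := by
  refine tendsto_card_primitiveFin_div.congr fun T => ?_
  rw [natCard_subtype_eq T fun γ => 2 < |trZ γ| ∧ uGamma γ = 1, primitiveFin]
  have h := natCard_subtype_eq T fun _ => True
  simp only [and_true, Finset.filter_true] at h
  rw [h]
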